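/- arXiv:1609.05443 — 2 statements merged into one kernel-verified Lean document; each statement's English description precedes it below -/
import Mathlib

section
/- For every 1/2 ≤ ν < 1 and every x > 0, the auxiliary Wright function admits the sine-transform representation F_ν(x) = (2/π) · ∫₀^∞ τ · E_{2ν,2ν}(−τ²) · sin(xτ) dτ, the integral being convergent, where E_{2ν,2ν} is the two-parameter (generalized) Mittag-Leffler function. -/
open Real MeasureTheory Set

/-- The auxiliary Wright function `F_ν(x) = Σ_{n=1}^∞ (−x)^n/(n! · Γ(−νn))`. -/
noncomputable def wrightF (ν x : ℝ) : ℝ :=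
  ∑' n : ℕ, (-x) ^ (n + 1) / (((n + 1).factorial : ℝ) * Real.Gamma (-(ν * (n + 1))))

/-- The two-parameter (generalized) Mittag-Leffler function
`E_{α,β}(z) = Σ_{n=0}^∞ z^n/Γ(αn + β)`. -/
noncomputable def mittagLeffler2 (α β z : ℝ) : ℝ :=
  ∑' n : ℕ, z ^ n / Real.Gamma (α * n + β)

/-- The reflection formula, including the poles of `Γ`, where both sides vanish. -/
lemma inv_Gamma_neg {a : ℝ} (ha : 0 ≤ a) :
    (Real.Gamma (-a))⁻¹ = -(Real.Gamma (a + 1) * Real.sin (π * a)) / π := by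
  have hpos : 0 < Real.Gamma (a + 1) := Real.Gamma_pos_of_pos (by linarith)
  have h := Real.Gamma_mul_Gamma_one_sub (-a)
  rw [show 1 - -a = a + 1 by ring, show π * -a = -(π * a) by ring, Real.sin_neg] at h
  rw [eq_div_of_mul_eq hpos.ne' h]
  by_cases hs : Real.sin (π * a) = 0
  · simp [hs]
  · field_simp

lemma rpow_isLittleO_id {ν : ℝ} (h1 : ν < 1) :
    (fun u : ℝ => u ^ ν) =o[Filter.atTop] fun u : ℝ => u := by
  refine Asymptotics.isLittleO_of_tendsto' ?_
    ((tendsto_rpow_neg_atTop (sub_pos.2 h1)).congr' ?_)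
  · filter_upwards [Filter.eventually_gt_atTop 0] with u hu h
    exact absurd h hu.ne'
  · filter_upwards [Filter.eventually_gt_atTop 0] with u hu
    rw [neg_sub, Real.rpow_sub_one hu.ne']

lemma integrableOn_exp_neg_add_mul_rpow {ν : ℝ} (h0 : 0 < ν) (h1 : ν < 1) (C : ℝ) :
    IntegrableOn (fun u : ℝ => Real.exp (-u + C * u ^ ν)) (Ioi 0) := by
  have hcont : Continuous (fun u : ℝ => Real.exp (-u + C * u ^ ν)) := by
    have := Real.continuous_rpow_const h0.le
    fun_prop
  refine integrable_of_isBigO_exp_neg (b := 1 / 2) (by norm_num) hcont.continuousOn ?_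
  have hb := ((rpow_isLittleO_id h1).const_mul_left C).bound (show (0 : ℝ) < 1 / 2 by norm_num)
  refine Asymptotics.IsBigO.of_bound 1 ?_
  filter_upwards [hb, Filter.eventually_gt_atTop 0] with u hu hu0
  rw [Real.norm_eq_abs, Real.norm_eq_abs, abs_of_pos hu0] at hu
  rw [Real.norm_eq_abs, Real.norm_eq_abs, Real.abs_exp, Real.abs_exp, one_mul]
  exact Real.exp_le_exp.2 (by linarith [le_abs_self (C * u ^ ν)])

lemma im_mul_exp_pow (r θ : ℝ) (n : ℕ) :
    (((r : ℂ) * Complex.exp (θ * Complex.I)) ^ n / (n.factorial : ℂ)).im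
      = r ^ n * Real.sin (θ * n) / n.factorial := by
  rw [mul_pow, ← Complex.exp_nat_mul, ← mul_assoc, ← Complex.ofReal_natCast n.factorial,
    ← Complex.ofReal_pow, Complex.div_ofReal_im, Complex.im_ofReal_mul, ← Complex.ofReal_natCast,
    ← Complex.ofReal_mul, Complex.exp_ofReal_mul_I_im, mul_comm θ]

/-- The auxiliary Wright function as a real integral along the negative axis. -/
lemma wrightF_eq_integral {ν : ℝ} (h0 : 0 < ν) (h1 : ν < 1) (x : ℝ) :
    wrightF ν x = (1 / π) * ∫ u in Ioi (0 : ℝ),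
      Real.exp (-u - x * u ^ ν * Real.cos (π * ν)) *
        Real.sin (x * u ^ ν * Real.sin (π * ν)) := by
  set z : ℝ → ℂ := fun u => ((-x * u ^ ν : ℝ) : ℂ) * Complex.exp ((π * ν : ℝ) * Complex.I) with hz
  set F : ℕ → ℝ → ℝ := fun n u =>
    -(1 / π) * Real.exp (-u) * ((z u) ^ (n + 1) / ((n + 1).factorial : ℂ)).im with hF
  have hFeq : ∀ n u, F n u = -(1 / π) * Real.exp (-u) * ((-x * u ^ ν) ^ (n + 1)
      * Real.sin (π * ν * (n + 1 : ℕ)) / (n + 1).factorial) := fun n u => by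
    simp only [hF, hz, im_mul_exp_pow]
  have hexp : ∀ y : ℝ, HasSum (fun n : ℕ => y ^ (n + 1) / (n + 1).factorial)
      (Real.exp y - 1) := fun y => by
    have h := NormedSpace.expSeries_div_hasSum_exp (y : ℝ)
    rw [← Real.exp_eq_exp_ℝ] at h
    simpa using (hasSum_nat_add_iff' 1).2 h
  have hcexp : ∀ y : ℂ, HasSum (fun n : ℕ => y ^ (n + 1) / ((n + 1).factorial : ℂ))
      (Complex.exp y - 1) := fun y => by
    have h := NormedSpace.expSeries_div_hasSum_exp (y : ℂ)
    rw [← Complex.exp_eq_exp_ℂ] at h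
    simpa using (hasSum_nat_add_iff' 1).2 h
  have key := hasSum_integral_of_dominated_convergence (μ := volume.restrict (Ioi (0 : ℝ)))
    (F := F)
    (f := fun u => -(1 / π) * Real.exp (-u) * (Complex.exp (z u) - 1).im)
    (fun n u => (1 / π) * Real.exp (-u) * ((|x| * u ^ ν) ^ (n + 1) / (n + 1).factorial))
    ?_ ?_ ?_ ?_ ?_
  · have hterm : ∀ n, ∫ u in Ioi (0 : ℝ), F n u
        = (-x) ^ (n + 1) / (((n + 1).factorial : ℝ) * Real.Gamma (-(ν * (n + 1)))) := by
      intro n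
      have hpos : 0 < ν * ((n : ℝ) + 1) := by positivity
      have : ∀ u ∈ Ioi (0 : ℝ), F n u = (-(1 / π) * ((-x) ^ (n + 1)
          * Real.sin (π * ν * (n + 1 : ℕ)) / (n + 1).factorial)) *
            (Real.exp (-u) * u ^ (ν * (n + 1) + 1 - 1)) := by
        intro u hu
        have hu : (0 : ℝ) < u := hu
        rw [hFeq, mul_pow, ← Real.rpow_mul_natCast hu.le]
        push_cast
        rw [show ν * ((n : ℝ) + 1) + 1 - 1 = ν * (n + 1) by ring]
        ring
      rw [setIntegral_congr_fun measurableSet_Ioi this, integral_const_mul,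
        ← Real.Gamma_eq_integral (by linarith), div_mul_eq_div_div, div_eq_mul_inv _ (Real.Gamma _),
        inv_Gamma_neg hpos.le]
      push_cast
      rw [mul_assoc π ν]
      ring
    rw [funext hterm] at key
    rw [wrightF, key.tsum_eq, ← integral_const_mul]
    refine setIntegral_congr_fun measurableSet_Ioi fun u _ => ?_
    have hze : z u = ((-x * u ^ ν * Real.cos (π * ν) : ℝ) : ℂ) +
        ((-x * u ^ ν * Real.sin (π * ν) : ℝ) : ℂ) * Complex.I := by
      simp only [hz]
      rw [Complex.exp_mul_I, ← Complex.ofReal_cos, ← Complex.ofReal_sin]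
      push_cast
      ring
    have hre : (z u).re = -x * u ^ ν * Real.cos (π * ν) := by
      rw [hze, Complex.add_re, Complex.ofReal_re, Complex.re_ofReal_mul, Complex.I_re]
      ring
    have hima : (z u).im = -x * u ^ ν * Real.sin (π * ν) := by
      rw [hze, Complex.add_im, Complex.ofReal_im, Complex.im_ofReal_mul, Complex.I_im]
      ring
    have him : (Complex.exp (z u) - 1).im = -(Real.exp (-(x * u ^ ν * Real.cos (π * ν))) *
        Real.sin (x * u ^ ν * Real.sin (π * ν))) := by
      rw [Complex.sub_im, Complex.one_im, sub_zero, Complex.exp_im, hre, hima]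
      simp only [neg_mul, Real.sin_neg]
      ring
    simp only [him]
    rw [sub_eq_add_neg, Real.exp_add]
    ring
  · intro n
    refine (Measurable.aestronglyMeasurable ?_)
    simp only [funext (hFeq n)]
    fun_prop
  · intro n
    filter_upwards [ae_restrict_mem measurableSet_Ioi] with u hu
    have hu : (0 : ℝ) < u := hu
    rw [hFeq, Real.norm_eq_abs, abs_mul, abs_mul, abs_neg, abs_of_pos (by positivity : 0 < 1 / π),
      abs_of_pos (Real.exp_pos _), abs_div, abs_mul, abs_pow, abs_mul, abs_neg, Nat.abs_cast,
      abs_of_pos (Real.rpow_pos_of_pos hu ν)]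
    gcongr
    exact mul_le_of_le_one_right (by positivity) (Real.abs_sin_le_one _)
  · filter_upwards with u
    exact ((hexp _).summable).mul_left _
  · have : ∀ u, ∑' n : ℕ, (1 / π) * Real.exp (-u) * ((|x| * u ^ ν) ^ (n + 1) / (n + 1).factorial)
        = (1 / π) * (Real.exp (-u + |x| * u ^ ν) - Real.exp (-u)) := fun u => by
      rw [((hexp _).mul_left _).tsum_eq, Real.exp_add]
      ring
    simp only [this]
    refine Integrable.const_mul (Integrable.sub
      (integrableOn_exp_neg_add_mul_rpow h0 h1 |x|) ?_) _
    simpa [IntegrableOn] using integrableOn_exp_neg_add_mul_rpow h0 h1 0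
  · filter_upwards with u
    exact ((Complex.hasSum_im (hcexp (z u))).mul_left _)

lemma continuous_wrightF {ν : ℝ} (h0 : 0 < ν) (h1 : ν < 1) : Continuous (wrightF ν) := by
  rw [funext (wrightF_eq_integral h0 h1)]
  refine continuous_const.mul (continuous_iff_continuousAt.2 fun x₀ => ?_)
  have hr := Real.continuous_rpow_const h0.le
  refine continuousAt_of_dominated (bound := fun u => Real.exp (-u + (|x₀| + 1) * u ^ ν))
    (Filter.Eventually.of_forall fun x => (Continuous.aestronglyMeasurable (by fun_prop))) ?_
    (integrableOn_exp_neg_add_mul_rpow h0 h1 _)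
    (Filter.Eventually.of_forall fun u => (by fun_prop))
  filter_upwards [Metric.ball_mem_nhds x₀ one_pos] with x hx
  filter_upwards [ae_restrict_mem measurableSet_Ioi] with u hu
  have hu : (0 : ℝ) < u := hu
  rw [Real.norm_eq_abs, abs_mul, abs_of_pos (Real.exp_pos _)]
  refine (mul_le_of_le_one_right (Real.exp_pos _).le (Real.abs_sin_le_one _)).trans ?_
  refine Real.exp_le_exp.2 ?_
  have hxx : |x| ≤ |x₀| + 1 := by
    rw [Metric.mem_ball, Real.dist_eq] at hx
    linarith [abs_sub_abs_le_abs_sub x x₀]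
  have : |x * Real.cos (π * ν)| ≤ |x₀| + 1 := by
    rw [abs_mul]
    exact (mul_le_of_le_one_right (abs_nonneg _) (Real.abs_cos_le_one _)).trans hxx
  have h2 := mul_le_mul_of_nonneg_right ((neg_abs_le _).trans' (neg_le_neg this))
    (Real.rpow_nonneg hu.le ν)
  linarith

lemma wrightF_sine_transform_half (x : ℝ) :
    IntegrableOn
      (fun τ : ℝ => τ * mittagLeffler2 (2 * (1 / 2)) (2 * (1 / 2)) (-τ ^ 2) * Real.sin (x * τ))
        (Ioi 0) ∧
    wrightF (1 / 2) x = (2 / π) * ∫ τ in Ioi (0 : ℝ),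
      τ * mittagLeffler2 (2 * (1 / 2)) (2 * (1 / 2)) (-τ ^ 2) * Real.sin (x * τ) := by
  have hE : ∀ z : ℝ, mittagLeffler2 (2 * (1 / 2)) (2 * (1 / 2)) z = Real.exp z := fun z => by
    rw [Real.exp_eq_exp_ℝ, NormedSpace.exp_eq_tsum_div, mittagLeffler2]
    refine tsum_congr fun n => ?_
    rw [show (2 : ℝ) * (1 / 2) * n + 2 * (1 / 2) = n + 1 by ring, Real.Gamma_nat_eq_factorial]
  simp only [hE]
  constructor
  · have h := integrable_mul_exp_neg_mul_sq (b := 1) one_pos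
    refine (h.mono (by fun_prop) ?_).integrableOn
    filter_upwards with τ
    rw [norm_mul, neg_one_mul]
    exact mul_le_of_le_one_right (norm_nonneg _) (Real.abs_sin_le_one _)
  · rw [wrightF_eq_integral (by norm_num) (by norm_num), ← integral_const_mul,
      ← integral_const_mul, ← integral_comp_rpow_Ioi _ two_ne_zero]
    refine setIntegral_congr_fun measurableSet_Ioi fun τ hτ => ?_
    have hτ : (0 : ℝ) < τ := hτ
    simp only [smul_eq_mul]
    rw [← Real.rpow_mul hτ.le, show π * (1 / 2) = π / 2 by ring, Real.cos_pi_div_two,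
      Real.sin_pi_div_two]
    norm_num
    ring

lemma norm_add_mul_I_pos {c : ℝ} (hc : 0 < c) (y : ℝ) : 0 < ‖(c + y * Complex.I : ℂ)‖ := by
  refine norm_pos_iff.2 fun h => ?_
  have := congrArg Complex.re h
  simp at this
  exact hc.ne' this

lemma le_norm_add_mul_I {c : ℝ} (hc : 0 < c) (y : ℝ) : c ≤ ‖(c + y * Complex.I : ℂ)‖ := by
  have := Complex.abs_re_le_norm (c + y * Complex.I)
  simpa [abs_of_pos hc] using this

lemma add_mul_I_mem_slitPlane {c : ℝ} (hc : 0 < c) (y : ℝ) :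
    (c + y * Complex.I : ℂ) ∈ Complex.slitPlane := Or.inl (by simpa using hc)

lemma hasDerivAt_add_mul_I (c y : ℝ) :
    HasDerivAt (fun y : ℝ => (c + y * Complex.I : ℂ)) Complex.I y := by
  simpa using ((Complex.ofRealCLM.hasDerivAt (x := y)).mul_const Complex.I).const_add (c : ℂ)

lemma continuous_add_mul_I_cpow {c : ℝ} (hc : 0 < c) (s : ℂ) :
    Continuous fun y : ℝ => (c + y * Complex.I : ℂ) ^ s :=
  continuous_iff_continuousAt.2 fun y =>
    (hasDerivAt_add_mul_I c y).continuousAt.cpow continuousAt_const (add_mul_I_mem_slitPlane hc y)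

lemma integrable_norm_add_mul_I_rpow {c : ℝ} (hc : 0 < c) {s : ℝ} (hs : 1 < s) :
    Integrable fun y : ℝ => ‖(c + y * Complex.I : ℂ)‖ ^ (-s) := by
  set m : ℝ := min 1 (c ^ 2) with hm
  have hm0 : 0 < m := lt_min one_pos (by positivity)
  have hcont : Continuous fun y : ℝ => ‖(c + y * Complex.I : ℂ)‖ ^ (-s) :=
    Continuous.rpow_const (by fun_prop) fun y => Or.inl (norm_add_mul_I_pos hc y).ne'
  have hint := (integrable_rpow_neg_one_add_norm_sq (E := ℝ) (μ := volume) (r := s)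
    (by simpa using hs)).const_mul (m ^ (-s / 2))
  refine hint.mono' hcont.aestronglyMeasurable (Filter.Eventually.of_forall fun y => ?_)
  rw [Real.norm_of_nonneg (Real.rpow_nonneg (norm_nonneg _) _),
    ← Real.mul_rpow hm0.le (by positivity), Complex.norm_add_mul_I, Real.sqrt_eq_rpow,
    ← Real.rpow_mul (by positivity), show (1 / 2 : ℝ) * -s = -s / 2 by ring]
  refine Real.rpow_le_rpow_of_nonpos (by positivity) ?_ (by linarith)
  rw [Real.norm_eq_abs, sq_abs]
  nlinarith [min_le_left 1 (c ^ 2), min_le_right 1 (c ^ 2), sq_nonneg y]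

lemma cos_mul_norm_rpow_le_re_cpow {ν : ℝ} (h0 : 0 < ν) (h1 : ν < 1) {p : ℂ} (hp : 0 < p.re) :
    Real.cos (π / 2 * ν) * ‖p‖ ^ ν ≤ (p ^ (ν : ℂ)).re := by
  rw [Complex.cpow_ofReal_re, mul_comm]
  have harg : |p.arg| ≤ π / 2 := Complex.abs_arg_le_pi_div_two_iff.2 hp.le
  gcongr
  rw [← Real.cos_abs (p.arg * ν), abs_mul, abs_of_pos h0]
  refine Real.cos_le_cos_of_nonneg_of_le_pi (by positivity) ?_ (by gcongr)
  nlinarith [Real.pi_pos]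

lemma cos_half_pi_mul_pos {ν : ℝ} (h0 : 0 < ν) (h1 : ν < 1) : 0 < Real.cos (π / 2 * ν) :=
  Real.cos_pos_of_mem_Ioo ⟨by nlinarith [Real.pi_pos], by nlinarith [Real.pi_pos]⟩

lemma exp_neg_le_two_div_sq {z : ℝ} (hz : 0 < z) : Real.exp (-z) ≤ 2 / z ^ 2 := by
  rw [Real.exp_neg, inv_le_comm₀ (Real.exp_pos _) (by positivity), inv_div]
  linarith [Real.quadratic_le_exp_of_nonneg hz.le]

/-- The integrand of the Bromwich integral for the auxiliary Wright function. -/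
noncomputable def bromwichKernel (ν x : ℝ) (p : ℂ) : ℂ := Complex.exp (p - x * p ^ (ν : ℂ))

lemma continuous_bromwichKernel {c : ℝ} (hc : 0 < c) (ν x : ℝ) :
    Continuous fun y : ℝ => bromwichKernel ν x (c + y * Complex.I) := by
  have := continuous_add_mul_I_cpow hc ν
  unfold bromwichKernel
  fun_prop

lemma norm_bromwichKernel_le_exp {ν : ℝ} (h0 : 0 < ν) (h1 : ν < 1) {x : ℝ} (hx : 0 < x)
    {c : ℝ} (hc : 0 < c) (y : ℝ) :
    ‖bromwichKernel ν x (c + y * Complex.I)‖ ≤ Real.exp c *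
      Real.exp (-(x * (Real.cos (π / 2 * ν) * ‖(c + y * Complex.I : ℂ)‖ ^ ν))) := by
  rw [bromwichKernel, Complex.norm_exp, ← Real.exp_add, Complex.sub_re, Complex.re_ofReal_mul]
  have h := cos_mul_norm_rpow_le_re_cpow h0 h1 (p := c + y * Complex.I) (by simpa using hc)
  have h' := mul_le_mul_of_nonneg_left h hx.le
  refine Real.exp_le_exp.2 ?_
  have : (c + y * Complex.I : ℂ).re = c := by simp
  linarith

lemma norm_bromwichKernel_le {ν : ℝ} (h0 : 0 < ν) (h1 : ν < 1) {x : ℝ} (hx : 0 < x)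
    {c : ℝ} (hc : 0 < c) (y : ℝ) :
    ‖bromwichKernel ν x (c + y * Complex.I)‖ ≤
      2 * Real.exp c / (x * Real.cos (π / 2 * ν)) ^ 2 *
        ‖(c + y * Complex.I : ℂ)‖ ^ (-(2 * ν)) := by
  have hb := cos_half_pi_mul_pos h0 h1
  have hn := norm_add_mul_I_pos hc y
  have hr := Real.rpow_pos_of_pos hn ν
  refine (norm_bromwichKernel_le_exp h0 h1 hx hc y).trans ?_
  refine (mul_le_mul_of_nonneg_left (exp_neg_le_two_div_sq (by positivity))
    (Real.exp_pos c).le).trans (le_of_eq ?_)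
  rw [Real.rpow_neg hn.le, mul_comm 2 ν, Real.rpow_mul hn.le, Real.rpow_two]
  field_simp

lemma integrable_bromwichKernel {ν : ℝ} (h0 : 1 / 2 < ν) (h1 : ν < 1) {x : ℝ} (hx : 0 < x)
    {c : ℝ} (hc : 0 < c) :
    Integrable fun y : ℝ => bromwichKernel ν x (c + y * Complex.I) :=
  ((integrable_norm_add_mul_I_rpow hc (s := 2 * ν) (by linarith)).const_mul _).mono'
    (continuous_bromwichKernel hc ν x).aestronglyMeasurable
    (Filter.Eventually.of_forall (norm_bromwichKernel_le (by linarith) h1 hx hc))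

/-- The kernel `bromwichKernel` times `dp`, in the logarithmic variable `p = exp w`. -/
noncomputable def logKernel (ν x : ℝ) (w : ℂ) : ℂ :=
  Complex.exp (w + Complex.exp w - x * Complex.exp (ν * w))

lemma logKernel_log (ν x : ℝ) {p : ℂ} (hp : p ≠ 0) :
    logKernel ν x (Complex.log p) = p * bromwichKernel ν x p := by
  rw [logKernel, bromwichKernel, Complex.exp_log hp, add_sub_assoc, Complex.exp_add,
    Complex.exp_log hp, Complex.cpow_def_of_ne_zero hp, mul_comm (ν : ℂ)]

lemma exists_primitive_logKernel (ν x : ℝ) :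
    ∃ Q : ℂ → ℂ, ∀ w, HasDerivAt Q (logKernel ν x w) w := by
  have hd : Differentiable ℂ (logKernel ν x) := by
    unfold logKernel
    fun_prop
  obtain ⟨Q, hQ⟩ := hd.isExactOn_univ
  exact ⟨Q, fun w => hQ w (mem_univ w)⟩

lemma norm_logKernel (ν x s θ : ℝ) :
    ‖logKernel ν x (s + θ * Complex.I)‖ =
      Real.exp (s + Real.exp s * Real.cos θ - x * (Real.exp (ν * s) * Real.cos (ν * θ))) := by
  have hre : ((ν : ℂ) * (s + θ * Complex.I)).re = ν * s := by simp
  have him : ((ν : ℂ) * (s + θ * Complex.I)).im = ν * θ := by simp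
  rw [logKernel, Complex.norm_exp, Complex.sub_re, Complex.add_re, Complex.re_ofReal_mul,
    Complex.exp_re, Complex.exp_re, hre, him]
  simp

/-- Moving along a vertical segment changes a primitive of the kernel by at most `π` times the
supremum of the kernel. -/
lemma norm_primitive_sub_le {ν x : ℝ} {Q : ℂ → ℂ} (hQ : ∀ w, HasDerivAt Q (logKernel ν x w) w)
    {s θ₀ M : ℝ} (h0 : 0 ≤ θ₀) (hπ : θ₀ ≤ π) (hM : 0 ≤ M)
    (hbound : ∀ θ ∈ Icc θ₀ π, ‖logKernel ν x (s + θ * Complex.I)‖ ≤ M) :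
    ‖Q (s + π * Complex.I) - Q (s + θ₀ * Complex.I)‖ ≤ M * π := by
  have h := (convex_Icc θ₀ π).norm_image_sub_le_of_norm_hasDerivWithin_le (C := M)
    (f := fun θ : ℝ => Q (s + θ * Complex.I))
    (f' := fun θ : ℝ => logKernel ν x (s + θ * Complex.I) * Complex.I)
    (fun θ _ => ((hQ _).comp_of_eq θ (hasDerivAt_add_mul_I s θ) rfl).hasDerivWithinAt)
    (fun θ hθ => by simpa using hbound θ hθ) (left_mem_Icc.2 hπ) (right_mem_Icc.2 hπ)
  refine h.trans ?_
  gcongr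
  rw [Real.norm_eq_abs, abs_of_nonneg (by linarith)]
  linarith

lemma integral_bromwichKernel_eq_primitive {ν x : ℝ} {Q : ℂ → ℂ}
    (hQ : ∀ w, HasDerivAt Q (logKernel ν x w) w) {c : ℝ} (hc : 0 < c) (T : ℝ) :
    Complex.I * ∫ y in (0 : ℝ)..T, bromwichKernel ν x (c + y * Complex.I) =
      Q (Complex.log (c + T * Complex.I)) - Q (Complex.log c) := by
  have h := intervalIntegral.integral_eq_sub_of_hasDerivAt (a := 0) (b := T)
    (f := fun y : ℝ => Q (Complex.log (c + y * Complex.I)))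
    (f' := fun y : ℝ => Complex.I * bromwichKernel ν x (c + y * Complex.I)) (fun y _ => ?_)
    ((continuous_const.mul (continuous_bromwichKernel hc ν x)).intervalIntegrable _ _)
  · rw [← intervalIntegral.integral_const_mul, h]
    simp
  · have hp : (c + y * Complex.I : ℂ) ≠ 0 := norm_pos_iff.1 (norm_add_mul_I_pos hc y)
    have hd := (hQ _).comp_of_eq y
      ((hasDerivAt_add_mul_I c y).clog_real (add_mul_I_mem_slitPlane hc y)) rfl
    rw [logKernel_log ν x hp] at hd
    refine hd.congr_deriv ?_
    rw [mul_right_comm, mul_div_cancel₀ _ hp]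

lemma integral_ray_eq_primitive {ν x : ℝ} (h0 : 0 < ν) {Q : ℂ → ℂ}
    (hQ : ∀ w, HasDerivAt Q (logKernel ν x w) w) {ε R : ℝ} (hε : 0 < ε) (hR : 0 < R) :
    ∫ u in ε..R, Real.exp (-u - x * u ^ ν * Real.cos (π * ν)) *
        Real.sin (x * u ^ ν * Real.sin (π * ν)) =
      (Q (Real.log R + π * Complex.I) - Q (Real.log ε + π * Complex.I)).im := by
  have hr := Real.continuous_rpow_const h0.le
  refine (intervalIntegral.integral_eq_sub_of_hasDerivAt (a := ε) (b := R)
    (f := fun u : ℝ => (Q (Real.log u + π * Complex.I)).im) (fun u hu => ?_)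
    (Continuous.intervalIntegrable (by fun_prop) _ _)).trans (by rw [Complex.sub_im])
  have hu0 : 0 < u := (lt_min hε hR).trans_le hu.1
  have hlog : HasDerivAt (fun u : ℝ => ((Real.log u : ℝ) + π * Complex.I : ℂ)) ((u⁻¹ : ℝ) : ℂ) u :=
    ((Real.hasDerivAt_log hu0.ne').ofReal_comp).add_const _
  have hd := (hQ _).comp_of_eq u hlog rfl
  have him := (Complex.imCLM.hasFDerivAt.comp_hasDerivAt u hd)
  refine him.congr_deriv ?_
  have hexp : Complex.exp ((Real.log u : ℝ) + π * Complex.I) = -u := by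
    rw [Complex.exp_add, Complex.exp_pi_mul_I, ← Complex.ofReal_exp, Real.exp_log hu0]
    simp
  have hexpν : Complex.exp (ν * ((Real.log u : ℝ) + π * Complex.I)) =
      ((u ^ ν : ℝ) : ℂ) * Complex.exp ((π * ν : ℝ) * Complex.I) := by
    rw [mul_add, Complex.exp_add, Real.rpow_def_of_pos hu0]
    push_cast
    ring_nf
  have hval : logKernel ν x ((Real.log u : ℝ) + π * Complex.I) =
      -u * Complex.exp (((-u - x * u ^ ν * Real.cos (π * ν) : ℝ) : ℂ) +
        ((-(x * u ^ ν * Real.sin (π * ν)) : ℝ) : ℂ) * Complex.I) := by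
    rw [logKernel, add_sub_assoc, Complex.exp_add, hexp, hexpν, Complex.exp_mul_I,
      ← Complex.ofReal_cos, ← Complex.ofReal_sin]
    congr 2
    push_cast
    ring
  rw [hval]
  have : ∀ z : ℂ, Complex.imCLM (-(u : ℂ) * z * ((u⁻¹ : ℝ) : ℂ)) = -z.im := fun z => by
    rw [Complex.imCLM_apply, mul_comm, Complex.im_ofReal_mul, ← Complex.ofReal_neg,
      Complex.im_ofReal_mul]
    field_simp
  rw [this, Complex.exp_im]
  simp only [Complex.add_re, Complex.add_im, Complex.ofReal_re, Complex.ofReal_im,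
    Complex.re_ofReal_mul, Complex.im_ofReal_mul, Complex.I_re, Complex.I_im, mul_zero, add_zero,
    mul_one, zero_add, Real.sin_neg]
  ring

lemma im_primitive_ofReal_sub {ν x : ℝ} {Q : ℂ → ℂ}
    (hQ : ∀ w, HasDerivAt Q (logKernel ν x w) w) (a b : ℝ) : (Q b - Q a).im = 0 := by
  have hk : ∀ s : ℝ, logKernel ν x s =
      ((Real.exp (s + Real.exp s - x * Real.exp (ν * s)) : ℝ) : ℂ) := fun s => by
    rw [logKernel]; push_cast; rfl
  rw [← intervalIntegral.integral_eq_sub_of_hasDerivAt (a := a) (b := b)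
    (f := fun s : ℝ => Q s) (f' := fun s : ℝ => logKernel ν x s)
    (fun s _ => (hQ s).comp_ofReal)
    (Continuous.intervalIntegrable (by simp only [hk]; fun_prop) _ _)]
  simp only [hk, intervalIntegral.integral_ofReal, Complex.ofReal_im]

lemma norm_logKernel_arc_le {ν : ℝ} (h0 : 1 / 2 < ν) (h1 : ν < 1) {x : ℝ} (hx : 0 < x) :
    ∃ δ₁ > 0, ∃ δ₂ > 0, ∀ c ≥ 0, ∀ R > 0, ∀ θ ∈ Icc 0 π, R * Real.cos θ ≤ c →
      ‖logKernel ν x (Real.log R + θ * Complex.I)‖ ≤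
        R * Real.exp (c - δ₁ * R ^ ν) + R * Real.exp (-(δ₂ * R) + x * R ^ ν) := by
  have hπ := Real.pi_pos
  have hν : 0 < ν := by linarith
  set φ : ℝ := (π / 2 + π / (2 * ν)) / 2 with hφ
  have hd : π / (2 * ν) < π := by rw [div_lt_iff₀ (by linarith)]; nlinarith
  have hd' : π / 2 < π / (2 * ν) := by
    rw [div_lt_div_iff₀ (by linarith) (by linarith)]; nlinarith
  have hνd : ν * (π / (2 * ν)) = π / 2 := by field_simp
  have hcos : 0 < Real.cos (ν * φ) :=
    Real.cos_pos_of_mem_Ioo ⟨by nlinarith, by nlinarith⟩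
  have hcos' : Real.cos φ < 0 := Real.cos_neg_of_pi_div_two_lt_of_lt (by linarith) (by linarith)
  refine ⟨x * Real.cos (ν * φ), by positivity, -Real.cos φ, by linarith, ?_⟩
  intro c hc R hR θ hθ hRc
  have hRν : Real.exp (ν * Real.log R) = R ^ ν := by
    rw [Real.rpow_def_of_pos hR, mul_comm]
  have hRp : 0 < R ^ ν := Real.rpow_pos_of_pos hR ν
  rw [norm_logKernel, Real.exp_log hR, hRν, add_sub_assoc, Real.exp_add, Real.exp_log hR,
    ← mul_add]
  refine mul_le_mul_of_nonneg_left ?_ hR.le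
  rcases le_total θ φ with h | h
  · refine le_add_of_le_of_nonneg (Real.exp_le_exp.2 ?_) (Real.exp_pos _).le
    have : Real.cos (ν * φ) ≤ Real.cos (ν * θ) :=
      Real.cos_le_cos_of_nonneg_of_le_pi (mul_nonneg hν.le hθ.1) (by nlinarith) (by gcongr)
    have h2 := mul_le_mul_of_nonneg_left this (mul_pos hx hRp).le
    nlinarith
  · refine le_add_of_nonneg_of_le (Real.exp_pos _).le (Real.exp_le_exp.2 ?_)
    have h3 : Real.cos θ ≤ Real.cos φ :=
      Real.cos_le_cos_of_nonneg_of_le_pi (by linarith) hθ.2 h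
    have h4 := mul_le_mul_of_nonneg_left h3 hR.le
    have h5 := mul_le_mul_of_nonneg_left (Real.neg_one_le_cos (ν * θ)) (mul_pos hx hRp).le
    nlinarith

lemma tendsto_arc_bound {ν : ℝ} (h0 : 0 < ν) (h1 : ν < 1) {δ₁ δ₂ : ℝ} (hδ₁ : 0 < δ₁)
    (hδ₂ : 0 < δ₂) (c x : ℝ) :
    Filter.Tendsto (fun R : ℝ => R * Real.exp (c - δ₁ * R ^ ν) +
      R * Real.exp (-(δ₂ * R) + x * R ^ ν)) Filter.atTop (nhds 0) := by
  rw [← add_zero (0 : ℝ)]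
  refine Filter.Tendsto.add ?_ ?_
  · have h := ((tendsto_rpow_mul_exp_neg_mul_atTop_nhds_zero (1 / ν) δ₁ hδ₁).comp
      (tendsto_rpow_atTop h0)).const_mul (Real.exp c)
    rw [mul_zero] at h
    refine h.congr' ?_
    filter_upwards [Filter.eventually_gt_atTop 0] with R hR
    simp only [Function.comp]
    rw [← Real.rpow_mul hR.le, mul_one_div_cancel h0.ne', Real.rpow_one, sub_eq_add_neg,
      Real.exp_add, neg_mul]
    ring
  · have h := tendsto_rpow_mul_exp_neg_mul_atTop_nhds_zero 1 (δ₂ / 2) (by positivity)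
    refine squeeze_zero' ?_ ?_ h
    · filter_upwards [Filter.eventually_gt_atTop 0] with R hR
      positivity
    · have hb := ((rpow_isLittleO_id h1).const_mul_left x).bound (half_pos hδ₂)
      filter_upwards [hb, Filter.eventually_gt_atTop 0] with R hR hR0
      rw [Real.norm_eq_abs, Real.norm_eq_abs, abs_of_pos hR0] at hR
      rw [Real.rpow_one]
      gcongr
      linarith [le_abs_self (x * R ^ ν)]

/-- The integral over the negative axis equals the Bromwich integral over the upper half line. -/
lemma integral_ray_eq_integral_line {ν : ℝ} (h0 : 1 / 2 < ν) (h1 : ν < 1) {x : ℝ} (hx : 0 < x)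
    {c : ℝ} (hc : 0 < c) :
    ∫ u in Ioi (0 : ℝ), Real.exp (-u - x * u ^ ν * Real.cos (π * ν)) *
        Real.sin (x * u ^ ν * Real.sin (π * ν)) =
      (∫ y in Ioi (0 : ℝ), bromwichKernel ν x (c + y * Complex.I)).re := by
  have hν : 0 < ν := by linarith
  set k : ℝ → ℝ := fun u => Real.exp (-u - x * u ^ ν * Real.cos (π * ν)) *
    Real.sin (x * u ^ ν * Real.sin (π * ν)) with hk
  have hkc : Continuous k := by
    have hr := Real.continuous_rpow_const hν.le
    fun_prop
  have hki : IntegrableOn k (Ioi 0) := by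
    refine (integrableOn_exp_neg_add_mul_rpow hν h1 x).mono' hkc.aestronglyMeasurable ?_
    filter_upwards [ae_restrict_mem measurableSet_Ioi] with u hu
    have hu : (0 : ℝ) < u := hu
    rw [Real.norm_eq_abs, abs_mul, abs_of_pos (Real.exp_pos _)]
    refine (mul_le_of_le_one_right (Real.exp_pos _).le (Real.abs_sin_le_one _)).trans ?_
    refine Real.exp_le_exp.2 ?_
    have h2 := mul_le_mul_of_nonneg_left (Real.neg_one_le_cos (π * ν))
      (mul_nonneg hx.le (Real.rpow_nonneg hu.le ν))
    linarith
  obtain ⟨Q, hQ⟩ := exists_primitive_logKernel ν x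
  obtain ⟨δ₁, hδ₁, δ₂, hδ₂, harc⟩ := norm_logKernel_arc_le h0 h1 hx
  set M : ℝ → ℝ := fun R => R * Real.exp (c - δ₁ * R ^ ν) +
    R * Real.exp (-(δ₂ * R) + x * R ^ ν) with hM
  set N : ℝ → ℝ := fun ε => ε * Real.exp (ε + x * ε ^ ν) with hN
  have hmain : ∀ T : ℝ, 0 < T → ∀ ε : ℝ, 0 < ε → |(∫ u in ε..‖(c + T * Complex.I : ℂ)‖, k u) -
      (∫ y in (0 : ℝ)..T, bromwichKernel ν x (c + y * Complex.I)).re| ≤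
        (M ‖(c + T * Complex.I : ℂ)‖ + N ε) * π := by
    intro T hT ε hε
    set p : ℂ := c + T * Complex.I with hp
    have hR := norm_add_mul_I_pos hc T
    rw [← hp] at hR
    have hargI : 0 ≤ p.arg := Complex.arg_nonneg_iff.2 (by simp [hp, hT.le])
    have e1 := integral_ray_eq_primitive hν hQ hε hR
    have e2 := congrArg Complex.im (integral_bromwichKernel_eq_primitive hQ hc T)
    rw [Complex.I_mul_im, ← hp] at e2
    have e3 := im_primitive_ofReal_sub hQ (Real.log ε) (Real.log c)
    have hlogp : Complex.log p = (Real.log ‖p‖ : ℝ) + (p.arg : ℝ) * Complex.I := rfl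
    have e4 : ‖Q (Real.log ‖p‖ + π * Complex.I) - Q (Complex.log p)‖ ≤ M ‖p‖ * π := by
      rw [hlogp]
      refine norm_primitive_sub_le hQ hargI (Complex.arg_le_pi p) (by positivity) fun θ hθ => ?_
      refine harc c hc.le _ hR θ ⟨hargI.trans hθ.1, hθ.2⟩ ?_
      have h6 := Real.cos_le_cos_of_nonneg_of_le_pi hargI hθ.2 hθ.1
      have h7 : ‖p‖ * Real.cos p.arg = c := by
        rw [Complex.norm_mul_cos_arg]; simp [hp]
      exact (mul_le_mul_of_nonneg_left h6 hR.le).trans h7.le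
    have e5 : ‖Q (Real.log ε + π * Complex.I) - Q (Real.log ε : ℝ)‖ ≤ N ε * π := by
      have := norm_primitive_sub_le hQ (s := Real.log ε) le_rfl Real.pi_pos.le
        (M := N ε) (by positivity) fun θ hθ => ?_
      · simpa using this
      · rw [norm_logKernel, Real.exp_log hε, add_sub_assoc, Real.exp_add, Real.exp_log hε,
          mul_comm ν, ← Real.rpow_def_of_pos hε]
        refine mul_le_mul_of_nonneg_left (Real.exp_le_exp.2 ?_) hε.le
        have hr := Real.rpow_pos_of_pos hε ν
        nlinarith [mul_le_mul_of_nonneg_left (Real.cos_le_one θ) hε.le,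
          mul_le_mul_of_nonneg_left (Real.neg_one_le_cos (ν * θ)) (mul_pos hx hr).le]
    have e6 := (Complex.abs_im_le_norm _).trans e4
    have e7 := (Complex.abs_im_le_norm _).trans e5
    rw [Complex.ofReal_log hc.le] at e3
    rw [e1, e2]
    simp only [Complex.sub_im] at *
    rw [abs_le] at *
    constructor <;> linarith [e6.1, e6.2, e7.1, e7.2]
  have hmain' : ∀ T : ℝ, 0 < T → |(∫ u in (0 : ℝ)..‖(c + T * Complex.I : ℂ)‖, k u) -
      (∫ y in (0 : ℝ)..T, bromwichKernel ν x (c + y * Complex.I)).re| ≤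
        M ‖(c + T * Complex.I : ℂ)‖ * π := by
    intro T hT
    have hNt : Filter.Tendsto N (nhdsWithin 0 (Ioi 0)) (nhds 0) := by
      have hc : Continuous N := by
        have hr := Real.continuous_rpow_const hν.le
        fun_prop
      have := hc.tendsto 0
      simp only [hN, zero_mul] at this
      exact this.mono_left nhdsWithin_le_nhds
    have hIt : Filter.Tendsto (fun ε => ∫ u in ε..‖(c + T * Complex.I : ℂ)‖, k u)
        (nhdsWithin 0 (Ioi 0)) (nhds (∫ u in (0 : ℝ)..‖(c + T * Complex.I : ℂ)‖, k u)) := by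
      have : Continuous fun ε => ∫ u in ε..‖(c + T * Complex.I : ℂ)‖, k u := by
        simp only [intervalIntegral.integral_symm ‖(c + T * Complex.I : ℂ)‖]
        exact (intervalIntegral.continuous_primitive
          (fun a b => hkc.intervalIntegrable a b) _).neg
      exact (this.tendsto 0).mono_left nhdsWithin_le_nhds
    have hL := (hIt.sub_const
      (∫ y in (0 : ℝ)..T, bromwichKernel ν x (c + y * Complex.I)).re).abs
    have hRt := (hNt.const_add (M ‖(c + T * Complex.I : ℂ)‖)).mul_const π
    rw [add_zero] at hRt
    refine le_of_tendsto_of_tendsto hL hRt ?_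
    filter_upwards [self_mem_nhdsWithin] with ε hε using hmain T hT ε hε
  have hRT : Filter.Tendsto (fun T : ℝ => ‖(c + T * Complex.I : ℂ)‖) Filter.atTop
      Filter.atTop := by
    refine Filter.tendsto_atTop_mono (fun T => ?_) Filter.tendsto_id
    refine (le_abs_self T).trans ?_
    simpa using Complex.abs_im_le_norm (c + T * Complex.I)
  have hzero := ((tendsto_arc_bound hν h1 hδ₁ hδ₂ c x).comp hRT).mul_const π
  rw [zero_mul] at hzero
  have hlim1 := (intervalIntegral_tendsto_integral_Ioi 0 hki Filter.tendsto_id).comp hRT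
  have hlim2 := (Complex.continuous_re.tendsto _).comp (intervalIntegral_tendsto_integral_Ioi 0
    (integrable_bromwichKernel h0 h1 hx hc).integrableOn Filter.tendsto_id)
  have hdiff := hlim1.sub hlim2
  refine sub_eq_zero.1 (tendsto_nhds_unique hdiff ?_)
  refine squeeze_zero_norm' ?_ hzero
  filter_upwards [Filter.eventually_gt_atTop 0] with T hT using hmain' T hT

lemma conj_bromwichKernel {c : ℝ} (hc : 0 < c) (ν x y : ℝ) :
    bromwichKernel ν x (c + (-y : ℝ) * Complex.I) =
      (starRingEnd ℂ) (bromwichKernel ν x (c + y * Complex.I)) := by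
  have hp := Complex.slitPlane_arg_ne_pi (add_mul_I_mem_slitPlane hc y)
  have hconj : (c + (-y : ℝ) * Complex.I : ℂ) = (starRingEnd ℂ) (c + y * Complex.I : ℂ) := by
    simp
  rw [bromwichKernel, bromwichKernel, ← Complex.exp_conj, hconj, map_sub, map_mul,
    Complex.conj_ofReal, Complex.conj_cpow _ _ hp, Complex.conj_ofReal]

/-- The Bromwich representation of the auxiliary Wright function. -/
lemma wrightF_eq_integral_line {ν : ℝ} (h0 : 1 / 2 < ν) (h1 : ν < 1) {x : ℝ} (hx : 0 < x)
    {c : ℝ} (hc : 0 < c) :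
    (wrightF ν x : ℂ) = (1 / (2 * π) : ℝ) * ∫ y : ℝ, bromwichKernel ν x (c + y * Complex.I) := by
  have hint := integrable_bromwichKernel h0 h1 hx hc
  have hneg : ∫ y in Iic (0 : ℝ), bromwichKernel ν x (c + y * Complex.I) =
      (starRingEnd ℂ) (∫ y in Ioi (0 : ℝ), bromwichKernel ν x (c + y * Complex.I)) := by
    rw [← integral_conj, ← neg_zero, ← integral_comp_neg_Ioi, neg_zero]
    simp only [conj_bromwichKernel hc]
  rw [← intervalIntegral.integral_Iic_add_Ioi hint.integrableOn hint.integrableOn, hneg, add_comm,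
    Complex.add_conj, wrightF_eq_integral (by linarith) h1,
    integral_ray_eq_integral_line h0 h1 hx hc]
  generalize (∫ y in Ioi (0 : ℝ), bromwichKernel ν x (c + y * Complex.I)).re = r
  push_cast
  field_simp

lemma integrableOn_rpow_mul_exp_neg {a b : ℝ} (ha : 0 < a) (hb : 0 < b) :
    IntegrableOn (fun t : ℝ => t ^ (a - 1) * Real.exp (-(b * t))) (Ioi 0) := by
  simpa using integrableOn_rpow_mul_exp_neg_mul_rpow (s := a - 1) (p := 1) (by linarith) one_pos hb

lemma norm_rpow_mul_cexp_neg {a : ℝ} {z : ℂ} {t : ℝ} (ht : 0 < t) :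
    ‖((t ^ (a - 1) : ℝ) : ℂ) * Complex.exp (-(z * t))‖ =
      t ^ (a - 1) * Real.exp (-(z.re * t)) := by
  rw [norm_mul, Complex.norm_exp, Complex.norm_real,
    Real.norm_of_nonneg (Real.rpow_nonneg ht.le _)]
  simp

lemma aestronglyMeasurable_rpow_mul_cexp_neg (a : ℝ) (z : ℂ) :
    AEStronglyMeasurable (fun t : ℝ => ((t ^ (a - 1) : ℝ) : ℂ) * Complex.exp (-(z * t)))
      (volume.restrict (Ioi 0)) := by
  have : Measurable fun t : ℝ => ((t ^ (a - 1) : ℝ) : ℂ) :=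
    Complex.measurable_ofReal.comp (measurable_id.pow_const _)
  exact (this.mul (by fun_prop : Measurable fun t : ℝ =>
    Complex.exp (-(z * t)))).aestronglyMeasurable

lemma integrableOn_rpow_mul_cexp_neg {a : ℝ} (ha : 0 < a) {z : ℂ} (hz : 0 < z.re) :
    IntegrableOn (fun t : ℝ => ((t ^ (a - 1) : ℝ) : ℂ) * Complex.exp (-(z * t))) (Ioi 0) := by
  refine (integrableOn_rpow_mul_exp_neg ha hz).mono'
    (aestronglyMeasurable_rpow_mul_cexp_neg a z) ?_
  filter_upwards [ae_restrict_mem measurableSet_Ioi] with t ht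
  exact (norm_rpow_mul_cexp_neg ht).le

/-- The Laplace transform of a power function in the right half plane. -/
lemma integral_rpow_mul_cexp_neg {a : ℝ} (ha : 0 < a) {z : ℂ} (hz : 0 < z.re) :
    ∫ t in Ioi (0 : ℝ), ((t ^ (a - 1) : ℝ) : ℂ) * Complex.exp (-(z * t)) =
      Real.Gamma a * z ^ (-a : ℂ) := by
  set L : ℂ → ℂ := fun z => ∫ t in Ioi (0 : ℝ), ((t ^ (a - 1) : ℝ) : ℂ) * Complex.exp (-(z * t))
    with hL
  have hopen : IsOpen {z : ℂ | 0 < z.re} := isOpen_lt continuous_const Complex.continuous_re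
  have hLd : DifferentiableOn ℂ L {z : ℂ | 0 < z.re} := by
    intro z₀ hz₀
    have hz₀ : 0 < z₀.re := hz₀
    refine (hasDerivAt_integral_of_dominated_loc_of_deriv_le
      (F' := fun z (t : ℝ) => ((t ^ (a - 1) : ℝ) : ℂ) * (Complex.exp (-(z * t)) * -t))
      (bound := fun t : ℝ => t ^ (a + 1 - 1) * Real.exp (-(z₀.re / 2 * t)))
      (Metric.ball_mem_nhds z₀ (half_pos hz₀))
      (Filter.Eventually.of_forall fun z => aestronglyMeasurable_rpow_mul_cexp_neg a z)
      (integrableOn_rpow_mul_cexp_neg ha hz₀) ?_ ?_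
      (integrableOn_rpow_mul_exp_neg (by linarith) (half_pos hz₀))
      ?_).2.differentiableAt.differentiableWithinAt
    · have := (aestronglyMeasurable_rpow_mul_cexp_neg a z₀).mul
        (by fun_prop : Continuous fun t : ℝ => (-t : ℂ)).aestronglyMeasurable
      refine this.congr (Filter.Eventually.of_forall fun t => ?_)
      simp only [Pi.mul_apply, mul_assoc]
    · filter_upwards [ae_restrict_mem measurableSet_Ioi] with t ht z hz
      have ht : (0 : ℝ) < t := ht
      rw [← mul_assoc, norm_mul, norm_rpow_mul_cexp_neg ht, norm_neg, Complex.norm_real,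
        Real.norm_of_nonneg ht.le, mul_right_comm, ← Real.rpow_add_one ht.ne']
      have h1 : |z.re - z₀.re| < z₀.re / 2 := by
        rw [← Complex.sub_re]
        exact (Complex.abs_re_le_norm _).trans_lt (mem_ball_iff_norm.1 hz)
      have h2 : z₀.re / 2 ≤ z.re := by linarith [(abs_lt.1 h1).1]
      rw [show a - 1 + 1 = a + 1 - 1 by ring]
      gcongr
    · refine Filter.Eventually.of_forall fun t z _ => ?_
      have : HasDerivAt (fun z : ℂ => -(z * t)) (-t) z := by
        simpa using! ((hasDerivAt_id z).mul_const (t : ℂ)).neg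
      exact this.cexp.const_mul _
  have hRd : DifferentiableOn ℂ (fun z : ℂ => Real.Gamma a * z ^ (-a : ℂ))
      {z : ℂ | 0 < z.re} := fun z hz =>
    ((differentiableAt_id.cpow_const (Or.inl hz)).const_mul _).differentiableWithinAt
  have hpre : IsPreconnected {z : ℂ | 0 < z.re} :=
    (convex_halfSpace_re_gt 0).isPreconnected
  refine (hLd.analyticOnNhd hopen).eqOn_of_preconnected_of_frequently_eq
    (hRd.analyticOnNhd hopen) hpre (z₀ := 1) (by simp) ?_ hz
  have hreal : ∀ r : ℝ, 0 < r → L r = Real.Gamma a * (r : ℂ) ^ (-a : ℂ) := by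
    intro r hr
    have h := Real.integral_rpow_mul_exp_neg_mul_Ioi ha hr
    have h' : L r = ((∫ t in Ioi (0 : ℝ), t ^ (a - 1) * Real.exp (-(r * t)) : ℝ) : ℂ) := by
      rw [← integral_complex_ofReal]
      simp only [hL]
      push_cast
      rfl
    rw [h', h, ← Complex.ofReal_neg, ← Complex.ofReal_cpow hr.le, ← Complex.ofReal_mul,
      one_div, Real.inv_rpow hr.le, Real.rpow_neg hr.le, mul_comm]
  have htend : Filter.Tendsto (fun n : ℕ => (((1 + 1 / ((n : ℝ) + 1) : ℝ)) : ℂ)) Filter.atTop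
      (nhdsWithin 1 {1}ᶜ) := by
    refine tendsto_nhdsWithin_iff.2 ⟨?_, Filter.Eventually.of_forall fun n => ?_⟩
    · have := (tendsto_one_div_add_atTop_nhds_zero_nat (𝕜 := ℝ)).const_add 1
      rw [add_zero] at this
      simpa [Function.comp_def] using (Complex.continuous_ofReal.tendsto _).comp this
    · have : (0 : ℝ) < 1 / ((n : ℝ) + 1) := by positivity
      simp only [mem_compl_iff, mem_singleton_iff]
      exact_mod_cast (lt_add_of_pos_right 1 this).ne'
  exact htend.frequently (Filter.Frequently.of_forall fun n => hreal _ (by positivity))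

/-- Laplace's integral for the reciprocal of the Gamma function. -/
lemma integral_cexp_mul_cpow_neg {β : ℝ} (hβ : 1 < β) {c : ℝ} (hc : 0 < c) :
    ∫ y : ℝ, Complex.exp (c + y * Complex.I) * (c + y * Complex.I : ℂ) ^ (-β : ℂ) =
      2 * π / Real.Gamma β := by
  have hπ := Real.pi_pos
  have hΓ : (Real.Gamma β : ℂ) ≠ 0 := by
    exact_mod_cast (Real.Gamma_pos_of_pos (by linarith)).ne'
  set f : ℝ → ℂ := (Ioi 0).indicator fun t : ℝ =>
    ((t ^ (β - 1) : ℝ) : ℂ) * Complex.exp (-((c : ℂ) * t)) with hf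
  have hfi : Integrable f := (integrable_indicator_iff measurableSet_Ioi).2
    (integrableOn_rpow_mul_cexp_neg (by linarith) (by simpa using hc))
  have hF : ∀ ξ : ℝ, FourierTransform.fourier f ξ =
      Real.Gamma β * (c + ((2 * π) * ξ : ℝ) * Complex.I : ℂ) ^ (-β : ℂ) := by
    intro ξ
    rw [Real.fourier_eq', ← integral_rpow_mul_cexp_neg (by linarith) (by simpa using hc),
      ← integral_indicator measurableSet_Ioi]
    congr 1
    ext t
    by_cases ht : t ∈ Ioi (0 : ℝ)
    · simp only [hf, indicator_of_mem ht, smul_eq_mul]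
      rw [mul_left_comm, ← Complex.exp_add]
      congr 2
      simp
      ring
    · simp [hf, indicator_of_notMem ht]
  have hFi : Integrable (FourierTransform.fourier f) := by
    have h1 : Integrable fun y : ℝ => (c + y * Complex.I : ℂ) ^ (-β : ℂ) := by
      refine (integrable_norm_add_mul_I_rpow hc hβ).mono'
        (continuous_add_mul_I_cpow hc _).aestronglyMeasurable
        (Filter.Eventually.of_forall fun y => ?_)
      rw [← Complex.ofReal_neg, Complex.norm_cpow_real]
    have h2 := (h1.comp_mul_left' (R := 2 * π) (by positivity)).const_mul (Real.Gamma β : ℂ)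
    exact h2.congr (Filter.Eventually.of_forall fun ξ => (hF ξ).symm)
  have hcont : ContinuousAt f 1 := by
    have : ContinuousAt (fun t : ℝ => ((t ^ (β - 1) : ℝ) : ℂ) * Complex.exp (-((c : ℂ) * t))) 1 := by
      refine ContinuousAt.mul ?_ (by fun_prop)
      exact Complex.continuous_ofReal.continuousAt.comp
        (continuousAt_id.rpow_const (Or.inl one_ne_zero))
    refine this.congr ?_
    filter_upwards [Ioi_mem_nhds one_pos] with t ht
    rw [hf, indicator_of_mem ht]
  have hinv := hfi.fourierInv_fourier_eq hFi hcont
  have hf1 : f 1 = Complex.exp (-c) := by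
    rw [hf, indicator_of_mem (by simp)]
    simp
  rw [Real.fourierInv_eq', hf1] at hinv
  set g : ℝ → ℂ := fun y => Complex.exp (c + y * Complex.I) *
    (c + y * Complex.I : ℂ) ^ (-β : ℂ) with hg
  have hcomp := Measure.integral_comp_mul_left g (2 * π)
  have hfun : ∀ ξ : ℝ, Complex.exp (((2 * π * inner ℝ ξ 1 : ℝ) : ℂ) * Complex.I) •
      FourierTransform.fourier f ξ = (Real.Gamma β * Complex.exp (-c)) * g (2 * π * ξ) := by
    intro ξ
    have : Complex.exp (((2 * π * inner ℝ ξ 1 : ℝ) : ℂ) * Complex.I) =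
        Complex.exp (-c) * Complex.exp (c + ((2 * π * ξ : ℝ) : ℂ) * Complex.I) := by
      rw [← Complex.exp_add]
      congr 1
      simp
    rw [hF, hg, this, smul_eq_mul]
    ring
  simp only [hfun] at hinv
  rw [integral_const_mul, hcomp, abs_of_pos (by positivity), Complex.real_smul] at hinv
  have he := Complex.exp_ne_zero (-c)
  rw [mul_assoc, mul_left_comm] at hinv
  have h3 := mul_left_cancel₀ he (hinv.trans (mul_one _).symm)
  push_cast at h3
  rw [eq_div_iff hΓ]
  field_simp at h3
  linear_combination h3

lemma integral_cexp_neg_mul_sin {z : ℂ} (hz : 0 < z.re) (τ : ℝ) :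
    ∫ x in Ioi (0 : ℝ), Complex.exp (-(x * z)) * (Real.sin (τ * x) : ℝ) =
      τ / (z ^ 2 + (τ : ℂ) ^ 2) := by
  set a : ℂ := -z + -τ * Complex.I with ha
  set b : ℂ := -z + τ * Complex.I with hb
  have har : a.re < 0 := by simpa [ha] using hz
  have hbr : b.re < 0 := by simpa [hb] using hz
  have ha0 : a ≠ 0 := fun h => by simp [h] at har
  have hb0 : b ≠ 0 := fun h => by simp [h] at hbr
  have hab : z ^ 2 + (τ : ℂ) ^ 2 = a * b := by
    rw [ha, hb]
    linear_combination (τ : ℂ) ^ 2 * Complex.I_sq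
  have hfun : ∀ x : ℝ, Complex.exp (-(x * z)) * (Real.sin (τ * x) : ℝ) =
      Complex.I / 2 * Complex.exp (a * x) - Complex.I / 2 * Complex.exp (b * x) := by
    intro x
    rw [ha, hb, add_mul, add_mul, Complex.exp_add, Complex.exp_add, Complex.ofReal_sin,
      Complex.sin]
    push_cast
    rw [show -z * (x : ℂ) = -(x * z) by ring, show -(τ : ℂ) * Complex.I * x = -(τ * x) * Complex.I
      by ring, show (τ : ℂ) * Complex.I * x = τ * x * Complex.I by ring]
    ring
  simp only [hfun]
  rw [integral_sub ((integrableOn_exp_mul_complex_Ioi har 0).const_mul _)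
    ((integrableOn_exp_mul_complex_Ioi hbr 0).const_mul _), integral_const_mul, integral_const_mul,
    integral_exp_mul_complex_Ioi har, integral_exp_mul_complex_Ioi hbr, hab]
  simp only [Complex.ofReal_zero, mul_zero, Complex.exp_zero]
  field_simp
  rw [ha, hb]
  linear_combination (-2 * (τ : ℂ)) * Complex.I_sq

lemma integral_mul_exp_neg_mul {r : ℝ} (hr : 0 < r) :
    ∫ x in Ioi (0 : ℝ), x * Real.exp (-(r * x)) = 1 / r ^ 2 := by
  have h := Real.integral_rpow_mul_exp_neg_mul_Ioi (a := 2) two_pos hr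
  rw [show (2 : ℝ) - 1 = 1 by norm_num] at h
  simpa [Real.Gamma_two] using h

lemma integrable_mul_exp_neg_mul_norm_rpow {ν : ℝ} (h0 : 1 / 2 < ν) {b : ℝ} (hb : 0 < b)
    {c : ℝ} (hc : 0 < c) :
    Integrable (fun q : ℝ × ℝ =>
      q.1 * Real.exp (-(b * ‖(c + q.2 * Complex.I : ℂ)‖ ^ ν * q.1)))
      ((volume.restrict (Ioi 0)).prod volume) := by
  have hr : ∀ y : ℝ, 0 < b * ‖(c + y * Complex.I : ℂ)‖ ^ ν := fun y =>
    mul_pos hb (Real.rpow_pos_of_pos (norm_add_mul_I_pos hc y) ν)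
  have hcont : Continuous fun q : ℝ × ℝ => ‖(c + q.2 * Complex.I : ℂ)‖ ^ ν :=
    Continuous.rpow_const (by fun_prop) fun q => Or.inr (by linarith)
  refine (integrable_prod_iff' (Continuous.aestronglyMeasurable (by fun_prop))).2
    ⟨Filter.Eventually.of_forall fun y => ?_, ?_⟩
  · have := integrableOn_rpow_mul_exp_neg two_pos (hr y)
    rw [show (2 : ℝ) - 1 = 1 by norm_num] at this
    simpa [IntegrableOn] using this
  · have heq : ∀ y : ℝ, ∫ x in Ioi (0 : ℝ),
        ‖x * Real.exp (-(b * ‖(c + y * Complex.I : ℂ)‖ ^ ν * x))‖ =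
        1 / b ^ 2 * ‖(c + y * Complex.I : ℂ)‖ ^ (-(2 * ν)) := by
      intro y
      rw [setIntegral_congr_fun measurableSet_Ioi (fun x hx => Real.norm_of_nonneg
        (mul_nonneg (le_of_lt hx) (Real.exp_pos _).le)), integral_mul_exp_neg_mul (hr y),
        Real.rpow_neg (norm_nonneg _), mul_comm 2 ν, Real.rpow_mul (norm_nonneg _), Real.rpow_two]
      field_simp
    simp only [heq]
    exact (integrable_norm_add_mul_I_rpow hc (by linarith)).const_mul _

lemma re_add_mul_I_cpow_pos {ν : ℝ} (h0 : 0 < ν) (h1 : ν < 1) {c : ℝ} (hc : 0 < c) (y : ℝ) :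
    0 < ((c + y * Complex.I : ℂ) ^ (ν : ℂ)).re :=
  (mul_pos (cos_half_pi_mul_pos h0 h1)
    (Real.rpow_pos_of_pos (norm_add_mul_I_pos hc y) ν)).trans_le
    (cos_mul_norm_rpow_le_re_cpow h0 h1 (by simpa using hc))

/-- The sine transform of the auxiliary Wright function as a Bromwich integral. -/
lemma integral_wrightF_mul_sin {ν : ℝ} (h0 : 1 / 2 < ν) (h1 : ν < 1) (τ : ℝ)
    {c : ℝ} (hc : 0 < c) :
    ((∫ x in Ioi (0 : ℝ), wrightF ν x * Real.sin (τ * x) : ℝ) : ℂ) =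
      (1 / (2 * π) : ℝ) * ∫ y : ℝ, Complex.exp (c + y * Complex.I) *
        (τ / ((c + y * Complex.I : ℂ) ^ (2 * ν : ℂ) + (τ : ℂ) ^ 2)) := by
  have hν : 0 < ν := by linarith
  set b := Real.cos (π / 2 * ν) with hb
  have hb0 : 0 < b := cos_half_pi_mul_pos hν h1
  have hint : Integrable (Function.uncurry fun x y : ℝ =>
      bromwichKernel ν x (c + y * Complex.I) * (Real.sin (τ * x) : ℝ))
      ((volume.restrict (Ioi 0)).prod volume) := by
    refine ((integrable_mul_exp_neg_mul_norm_rpow h0 hb0 hc).const_mul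
      (|τ| * Real.exp c)).mono' ?_ ?_
    · have h : Continuous fun q : ℝ × ℝ => (c + q.2 * Complex.I : ℂ) ^ (ν : ℂ) :=
        (continuous_add_mul_I_cpow hc ν).comp continuous_snd
      unfold bromwichKernel Function.uncurry
      exact Continuous.aestronglyMeasurable (by fun_prop)
    · filter_upwards [Measure.quasiMeasurePreserving_fst.ae
        (ae_restrict_mem measurableSet_Ioi)] with q hq
      have hq : 0 < q.1 := hq
      have h2 := norm_bromwichKernel_le_exp hν h1 hq hc q.2
      have h3 : ‖((Real.sin (τ * q.1) : ℝ) : ℂ)‖ ≤ |τ| * q.1 := by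
        rw [Complex.norm_real, Real.norm_eq_abs]
        refine Real.abs_sin_le_abs.trans_eq ?_
        rw [abs_mul, abs_of_pos hq]
      refine (norm_mul_le _ _).trans ((mul_le_mul h2 h3 (norm_nonneg _)
        (by positivity)).trans_eq ?_)
      rw [mul_comm (b * _) q.1]
      ring
  rw [← integral_complex_ofReal]
  have hF : ∫ x in Ioi (0 : ℝ), ((wrightF ν x * Real.sin (τ * x) : ℝ) : ℂ) =
      (1 / (2 * π) : ℝ) * ∫ x in Ioi (0 : ℝ), ∫ y : ℝ,
        bromwichKernel ν x (c + y * Complex.I) * (Real.sin (τ * x) : ℝ) := by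
    rw [← integral_const_mul]
    refine setIntegral_congr_fun measurableSet_Ioi fun x hx => ?_
    rw [Complex.ofReal_mul, wrightF_eq_integral_line h0 h1 hx hc, mul_assoc, integral_mul_const]
  rw [hF, integral_integral_swap hint]
  congr 2
  ext y
  have hp : (c + y * Complex.I : ℂ) ≠ 0 := norm_pos_iff.1 (norm_add_mul_I_pos hc y)
  have hsq : (c + y * Complex.I : ℂ) ^ (2 * ν : ℂ) = ((c + y * Complex.I : ℂ) ^ (ν : ℂ)) ^ 2 := by
    rw [← Complex.cpow_nat_mul]
    norm_num
  rw [hsq, ← integral_cexp_neg_mul_sin (re_add_mul_I_cpow_pos hν h1 hc y), ← integral_const_mul]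
  congr 1
  ext x
  rw [bromwichKernel, sub_eq_add_neg, Complex.exp_add, mul_assoc]

/-- The Mittag-Leffler function as a Bromwich integral. -/
lemma integral_cexp_mul_inv_eq_mittagLeffler2 {α : ℝ} (hα : 1 < α) {c : ℝ} (hc : 0 < c) {τ : ℝ}
    (hτ : τ ^ 2 < c ^ α) :
    ∫ y : ℝ, Complex.exp (c + y * Complex.I) *
        (τ / ((c + y * Complex.I : ℂ) ^ (α : ℂ) + (τ : ℂ) ^ 2)) =
      2 * π * (τ * mittagLeffler2 α α (-τ ^ 2) : ℝ) := by
  have hα0 : 0 < α := by linarith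
  have hcα : 0 < c ^ α := Real.rpow_pos_of_pos hc α
  set q : ℝ := τ ^ 2 / c ^ α with hq
  have hq0 : 0 ≤ q := by positivity
  have hq1 : q < 1 := (div_lt_one hcα).2 hτ
  have hpow : ∀ (y : ℝ) (n : ℕ), (c + y * Complex.I : ℂ) ^ (-((α * n + α : ℝ) : ℂ)) =
      (((c + y * Complex.I : ℂ) ^ (α : ℂ))⁻¹) ^ n * ((c + y * Complex.I : ℂ) ^ (α : ℂ))⁻¹ := by
    intro y n
    rw [← pow_succ, ← Complex.cpow_neg, ← Complex.cpow_nat_mul]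
    congr 1
    push_cast
    ring
  have hnorm : ∀ y : ℝ, ‖((c + y * Complex.I : ℂ) ^ (α : ℂ))⁻¹‖ =
      ‖(c + y * Complex.I : ℂ)‖ ^ (-α) := fun y => by
    rw [norm_inv, Complex.norm_cpow_real, Real.rpow_neg (norm_nonneg _)]
  have hle : ∀ y : ℝ, ‖((c + y * Complex.I : ℂ) ^ (α : ℂ))⁻¹‖ ≤ (c ^ α)⁻¹ := fun y => by
    rw [hnorm, ← Real.rpow_neg hc.le]
    exact Real.rpow_le_rpow_of_nonpos hc (le_norm_add_mul_I hc y) (by linarith)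
  have hlt : ∀ y : ℝ, ‖(-τ ^ 2 : ℂ) * ((c + y * Complex.I : ℂ) ^ (α : ℂ))⁻¹‖ ≤ q := fun y => by
    rw [norm_mul, norm_neg, norm_pow, Complex.norm_real, Real.norm_eq_abs, sq_abs, hq,
      div_eq_mul_inv]
    exact mul_le_mul_of_nonneg_left (hle y) (sq_nonneg τ)
  have hexp : ∀ y : ℝ, ‖Complex.exp (c + y * Complex.I)‖ = Real.exp c := fun y => by
    rw [Complex.norm_exp]
    simp
  set f : ℕ → ℝ → ℂ := fun n y => (-τ ^ 2 : ℂ) ^ n * (Complex.exp (c + y * Complex.I) *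
    (c + y * Complex.I : ℂ) ^ (-((α * n + α : ℝ) : ℂ))) with hf
  have hf' : ∀ n y, f n y = Complex.exp (c + y * Complex.I) *
      ((c + y * Complex.I : ℂ) ^ (α : ℂ))⁻¹ *
        ((-τ ^ 2 : ℂ) * ((c + y * Complex.I : ℂ) ^ (α : ℂ))⁻¹) ^ n := fun n y => by
    simp only [hf]
    rw [hpow, mul_pow]
    ring
  have hsum := hasSum_integral_of_dominated_convergence (μ := volume) (F := f)
    (f := fun y : ℝ => Complex.exp (c + y * Complex.I) *
        (1 / ((c + y * Complex.I : ℂ) ^ (α : ℂ) + (τ : ℂ) ^ 2)))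
    (bound := fun n y => Real.exp c * ‖(c + y * Complex.I : ℂ)‖ ^ (-α) * q ^ n) ?_ ?_ ?_ ?_ ?_
  · have hfi : ∀ n : ℕ, ∫ y : ℝ, f n y =
        ((2 * π * ((-τ ^ 2) ^ n / Real.Gamma (α * n + α)) : ℝ) : ℂ) := by
      intro n
      have hβ : 1 < α * n + α := by nlinarith [(Nat.cast_nonneg n : (0 : ℝ) ≤ n)]
      simp only [hf]
      rw [integral_const_mul, integral_cexp_mul_cpow_neg hβ hc]
      push_cast
      ring
    simp only [hfi] at hsum
    have h2 := hsum.tsum_eq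
    rw [← Complex.ofReal_tsum, tsum_mul_left] at h2
    simp only [div_eq_mul_inv, one_mul] at h2 ⊢
    simp only [mul_left_comm _ (τ : ℂ)]
    rw [integral_const_mul, ← h2, mittagLeffler2]
    simp only [div_eq_mul_inv]
    push_cast
    ring
  · intro n
    have h1 : Continuous fun y : ℝ => Complex.exp (c + y * Complex.I) := by fun_prop
    exact ((h1.mul (continuous_add_mul_I_cpow hc _)).const_mul _).aestronglyMeasurable
  · refine fun n => Filter.Eventually.of_forall fun y => ?_
    rw [hf', norm_mul, norm_mul, norm_pow, hexp, hnorm]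
    gcongr
    exact hlt y
  · exact Filter.Eventually.of_forall fun y =>
      (summable_geometric_of_lt_one hq0 hq1).mul_left _
  · simp only [tsum_mul_left]
    exact ((integrable_norm_add_mul_I_rpow hc hα).const_mul _).mul_const _
  · refine Filter.Eventually.of_forall fun y => ?_
    have h1 := (hasSum_geometric_of_norm_lt_one ((hlt y).trans_lt hq1)).mul_left
      (Complex.exp (c + y * Complex.I) * ((c + y * Complex.I : ℂ) ^ (α : ℂ))⁻¹)
    simp only [hf']
    have hp : (c + y * Complex.I : ℂ) ^ (α : ℂ) ≠ 0 := by
      rw [Complex.cpow_ne_zero_iff]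
      exact Or.inl (norm_pos_iff.1 (norm_add_mul_I_pos hc y))
    have h2 : Complex.exp (c + y * Complex.I) *
        (1 / ((c + y * Complex.I : ℂ) ^ (α : ℂ) + (τ : ℂ) ^ 2)) =
        Complex.exp (c + y * Complex.I) * ((c + y * Complex.I : ℂ) ^ (α : ℂ))⁻¹ *
          (1 - -(τ : ℂ) ^ 2 * ((c + y * Complex.I : ℂ) ^ (α : ℂ))⁻¹)⁻¹ := by
      rw [mul_assoc, ← mul_inv, mul_sub, mul_one, mul_left_comm, mul_inv_cancel₀ hp, one_div]
      ring
    rw [h2]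
    exact h1

/-- The sine transform of the auxiliary Wright function is a Mittag-Leffler function. -/
lemma integral_wrightF_mul_sin_eq_mittagLeffler2 {ν : ℝ} (h0 : 1 / 2 < ν) (h1 : ν < 1) (τ : ℝ) :
    ∫ x in Ioi (0 : ℝ), wrightF ν x * Real.sin (τ * x) =
      τ * mittagLeffler2 (2 * ν) (2 * ν) (-τ ^ 2) := by
  have hc : 0 < 1 + τ ^ 2 := by positivity
  have hτ : τ ^ 2 < (1 + τ ^ 2) ^ (2 * ν) := by
    have := Real.rpow_le_rpow_of_exponent_le (show 1 ≤ 1 + τ ^ 2 by nlinarith)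
      (show 1 ≤ 2 * ν by linarith)
    rw [Real.rpow_one] at this
    linarith
  have h2 := integral_cexp_mul_inv_eq_mittagLeffler2 (by linarith) hc hτ
  rw [Complex.ofReal_mul 2 ν, Complex.ofReal_ofNat] at h2
  have h3 := integral_wrightF_mul_sin h0 h1 τ hc
  rw [h2] at h3
  have hπ : (π : ℂ) ≠ 0 := by exact_mod_cast Real.pi_ne_zero
  refine Complex.ofReal_injective (h3.trans ?_)
  push_cast
  field_simp

lemma norm_cexp_add_mul_I (c y : ℝ) : ‖Complex.exp (c + y * Complex.I)‖ = Real.exp c := by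
  rw [Complex.norm_exp]
  simp

/-- Integration by parts against the exponential on a vertical line. -/
lemma integral_cexp_mul_eq_neg (c : ℝ) {g g' : ℝ → ℂ}
    (hg : ∀ y, HasDerivAt g (Complex.I * g' y) y) (hgi : Integrable g) (hgi' : Integrable g') :
    ∫ y : ℝ, Complex.exp (c + y * Complex.I) * g y =
      -∫ y : ℝ, Complex.exp (c + y * Complex.I) * g' y := by
  have hE : Continuous fun y : ℝ => Complex.exp (c + y * Complex.I) := by fun_prop
  have hmul : ∀ {k : ℝ → ℂ}, Integrable k →
      Integrable fun y : ℝ => Complex.exp (c + y * Complex.I) * k y := fun hk =>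
    hk.bdd_mul hE.aestronglyMeasurable
      (Filter.Eventually.of_forall fun y => (norm_cexp_add_mul_I c y).le)
  have h := integral_mul_deriv_eq_deriv_mul_of_integrable
    (u := fun y : ℝ => Complex.exp (c + y * Complex.I)) (v := g)
    (fun y _ => (hasDerivAt_add_mul_I c y).cexp) (fun y _ => hg y)
    (hmul (hgi'.const_mul _))
    (((hmul hgi).const_mul Complex.I).congr (Filter.Eventually.of_forall fun y =>
      ((mul_assoc _ _ _).symm.trans (congrArg (· * g y) (mul_comm _ _)))))
    (hmul hgi)
  have h1 : ∀ y : ℝ, Complex.exp (c + y * Complex.I) * (Complex.I * g' y) =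
      Complex.I * (Complex.exp (c + y * Complex.I) * g' y) := fun y => mul_left_comm _ _ _
  have h2 : ∀ y : ℝ, Complex.exp (c + y * Complex.I) * Complex.I * g y =
      Complex.I * (Complex.exp (c + y * Complex.I) * g y) := fun y => by
    rw [mul_comm _ Complex.I, mul_assoc]
  simp only [h1, h2] at h
  rw [integral_const_mul, integral_const_mul, ← mul_neg] at h
  rw [mul_left_cancel₀ Complex.I_ne_zero h, neg_neg]

lemma norm_sq_add_sq_lower_bounds {z : ℂ} {b τ : ℝ} (hb0 : 0 < b) (hb1 : b ≤ 1) (hτ : 0 < τ)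
    (hz : b * ‖z‖ ≤ z.re) :
    b ^ 2 * ‖z‖ ^ 2 ≤ ‖z ^ 2 + (τ : ℂ) ^ 2‖ ∧
      b ^ 4 / 8 * ‖z‖ * τ ^ 3 ≤ ‖z ^ 2 + (τ : ℂ) ^ 2‖ ^ 2 := by
  have hfac : z ^ 2 + (τ : ℂ) ^ 2 = (z + τ * Complex.I) * (z - τ * Complex.I) := by
    linear_combination (τ : ℂ) ^ 2 * Complex.I_sq
  have hτn : ‖(τ * Complex.I : ℂ)‖ = τ := by simp [abs_of_pos hτ]
  have h1 : b * ‖z‖ ≤ ‖z + τ * Complex.I‖ :=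
    hz.trans (by simpa using Complex.re_le_norm (z + τ * Complex.I))
  have h2 : b * ‖z‖ ≤ ‖z - τ * Complex.I‖ :=
    hz.trans (by simpa using Complex.re_le_norm (z - τ * Complex.I))
  have h3 : τ - ‖z‖ ≤ ‖z + τ * Complex.I‖ := by
    have := norm_sub_norm_le (τ * Complex.I : ℂ) (-z)
    rw [norm_neg, hτn, sub_neg_eq_add, add_comm _ z] at this
    exact this
  have h4 : τ - ‖z‖ ≤ ‖z - τ * Complex.I‖ := by
    have := norm_sub_norm_le (τ * Complex.I : ℂ) z
    rw [hτn, norm_sub_rev] at this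
    exact this
  have hz0 := norm_nonneg z
  have key : ∀ m : ℝ, b * ‖z‖ ≤ m → τ - ‖z‖ ≤ m → b * τ / 2 ≤ m := by
    intro m hm hm'
    rcases le_total ‖z‖ (τ / 2) with h | h <;> nlinarith
  have h5 := key _ h1 h3
  have h6 := key _ h2 h4
  rw [hfac, norm_mul]
  set m := ‖z + τ * Complex.I‖
  set m' := ‖z - τ * Complex.I‖
  have hm : 0 < b * τ / 2 := by positivity
  constructor
  · calc b ^ 2 * ‖z‖ ^ 2 = (b * ‖z‖) * (b * ‖z‖) := by ring
      _ ≤ m * m' := by gcongr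
  · calc b ^ 4 / 8 * ‖z‖ * τ ^ 3 = (b * ‖z‖) * (b * τ / 2) * ((b * τ / 2) * (b * τ / 2)) := by ring
      _ ≤ m * m' * (m * m') := by gcongr
      _ = (m * m') ^ 2 := by ring

lemma hasDerivAt_add_mul_I_cpow {c : ℝ} (hc : 0 < c) (s : ℂ) (y : ℝ) :
    HasDerivAt (fun y : ℝ => (c + y * Complex.I : ℂ) ^ s)
      (Complex.I * (s * (c + y * Complex.I : ℂ) ^ (s - 1))) y := by
  refine ((Complex.hasStrictDerivAt_cpow_const (c := s)
    (add_mul_I_mem_slitPlane hc y)).hasDerivAt.comp_of_eq y (hasDerivAt_add_mul_I c y)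
      rfl).congr_deriv ?_
  ring

lemma exists_norm_integral_cexp_mul_inv_le {ν : ℝ} (h0 : 1 / 2 < ν) (h1 : ν < 1) {c : ℝ}
    (hc : 0 < c) :
    ∃ C, ∀ τ : ℝ, 0 < τ →
      ‖∫ y : ℝ, Complex.exp (c + y * Complex.I) *
        (1 / ((c + y * Complex.I : ℂ) ^ (2 * ν : ℂ) + (τ : ℂ) ^ 2))‖ ≤ C / τ ^ 3 := by
  have hν : 0 < ν := by linarith
  set b := Real.cos (π / 2 * ν) with hb
  have hb0 : 0 < b := cos_half_pi_mul_pos hν h1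
  have hb1 : b ≤ 1 := Real.cos_le_one _
  set α : ℂ := 2 * ν with hα
  clear_value α
  set B : ℝ := 8 * (2 * ν) / b ^ 4 + 16 * (2 * ν) ^ 2 / b ^ 6 with hB
  refine ⟨Real.exp c * (B * ∫ y : ℝ, ‖(c + y * Complex.I : ℂ)‖ ^ (-(2 - ν))), fun τ hτ => ?_⟩
  set D : ℝ → ℂ := fun y => (c + y * Complex.I : ℂ) ^ α + (τ : ℂ) ^ 2 with hD
  set g : ℝ → ℂ := fun y => (D y)⁻¹ with hg
  set g' : ℝ → ℂ := fun y => -(α * (c + y * Complex.I : ℂ) ^ (α - 1)) * (D y)⁻¹ ^ 2 with hg'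
  set g'' : ℝ → ℂ := fun y => -(α * ((α - 1) * (c + y * Complex.I : ℂ) ^ (α - 1 - 1))) *
    (D y)⁻¹ ^ 2 + 2 * (α * (c + y * Complex.I : ℂ) ^ (α - 1)) ^ 2 * (D y)⁻¹ ^ 3 with hg''
  have hr : ∀ y : ℝ, 0 < ‖(c + y * Complex.I : ℂ)‖ := norm_add_mul_I_pos hc
  have hs : ∀ y : ℝ, 0 < ‖(c + y * Complex.I : ℂ)‖ ^ ν := fun y => Real.rpow_pos_of_pos (hr y) ν
  have hDb : ∀ y : ℝ, b ^ 2 * (‖(c + y * Complex.I : ℂ)‖ ^ ν) ^ 2 ≤ ‖D y‖ ∧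
      b ^ 4 / 8 * ‖(c + y * Complex.I : ℂ)‖ ^ ν * τ ^ 3 ≤ ‖D y‖ ^ 2 := fun y => by
    have h := norm_sq_add_sq_lower_bounds (z := (c + y * Complex.I : ℂ) ^ (ν : ℂ)) hb0 hb1 hτ
      (by
        rw [Complex.norm_cpow_real]
        exact cos_mul_norm_rpow_le_re_cpow hν h1 (by simpa using hc))
    rw [Complex.norm_cpow_real] at h
    have hsq : D y = ((c + y * Complex.I : ℂ) ^ (ν : ℂ)) ^ 2 + (τ : ℂ) ^ 2 := by
      simp only [hD, hα]
      rw [← Complex.cpow_nat_mul]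
      norm_num
    rwa [hsq]
  have hDpos : ∀ y, 0 < ‖D y‖ := fun y =>
    (by have := hs y; positivity : 0 < b ^ 2 * (‖(c + y * Complex.I : ℂ)‖ ^ ν) ^ 2).trans_le
      (hDb y).1
  have hD0 : ∀ y, D y ≠ 0 := fun y => norm_pos_iff.1 (hDpos y)
  have hDd : ∀ y : ℝ, HasDerivAt D (Complex.I * (α * (c + y * Complex.I : ℂ) ^ (α - 1))) y :=
    fun y => (hasDerivAt_add_mul_I_cpow hc α y).add_const _
  have hDi : ∀ y : ℝ, HasDerivAt (fun y => (D y)⁻¹)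
      (-(Complex.I * (α * (c + y * Complex.I : ℂ) ^ (α - 1))) / D y ^ 2) y :=
    fun y => (hDd y).fun_inv (hD0 y)
  have hgd : ∀ y, HasDerivAt g (Complex.I * g' y) y := fun y => by
    refine (hDi y).congr_deriv ?_
    simp only [hg', inv_pow, div_eq_mul_inv]
    ring
  have hgd' : ∀ y, HasDerivAt g' (Complex.I * g'' y) y := fun y => by
    refine ((((hasDerivAt_add_mul_I_cpow hc (α - 1) y).const_mul α).fun_neg).fun_mul
      ((hDi y).fun_pow 2)).congr_deriv ?_
    simp only [hg'', inv_pow, div_eq_mul_inv]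
    generalize D y = d
    push_cast
    ring
  have hDic : Continuous fun y => (D y)⁻¹ :=
    continuous_iff_continuousAt.2 fun y => (hDi y).continuousAt
  have hc1 := continuous_add_mul_I_cpow hc (α - 1)
  have hc2 := continuous_add_mul_I_cpow hc (α - 1 - 1)
  have hn1 : ∀ y : ℝ, ‖(c + y * Complex.I : ℂ) ^ (α - 1)‖ =
      (‖(c + y * Complex.I : ℂ)‖ ^ ν) ^ 2 / ‖(c + y * Complex.I : ℂ)‖ := fun y => by
    rw [show α - 1 = ((2 * ν - 1 : ℝ) : ℂ) by simp [hα], Complex.norm_cpow_real,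
      Real.rpow_sub_one (hr y).ne', mul_comm 2 ν, Real.rpow_mul (hr y).le, Real.rpow_two]
  have hn2 : ∀ y : ℝ, ‖(c + y * Complex.I : ℂ) ^ (α - 1 - 1)‖ =
      (‖(c + y * Complex.I : ℂ)‖ ^ ν) ^ 2 / ‖(c + y * Complex.I : ℂ)‖ ^ 2 := fun y => by
    rw [show α - 1 - 1 = ((2 * ν - 1 - 1 : ℝ) : ℂ) by simp [hα], Complex.norm_cpow_real,
      Real.rpow_sub_one (hr y).ne', Real.rpow_sub_one (hr y).ne', mul_comm 2 ν,
      Real.rpow_mul (hr y).le, Real.rpow_two, div_div, sq ‖(c + y * Complex.I : ℂ)‖]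
  have hαn : ‖α‖ = 2 * ν := by simp [hα, abs_of_pos hν]
  have hαn' : ‖α - 1‖ ≤ 1 := by
    rw [show α - 1 = ((2 * ν - 1 : ℝ) : ℂ) by simp [hα], Complex.norm_real, Real.norm_eq_abs,
      abs_le]
    constructor <;> linarith
  have hgi : Integrable g := by
    refine ((integrable_norm_add_mul_I_rpow hc (s := 2 * ν) (by linarith)).const_mul
      (1 / b ^ 2)).mono' hDic.aestronglyMeasurable (Filter.Eventually.of_forall fun y => ?_)
    have h2 := hs y
    rw [norm_inv, Real.rpow_neg (hr y).le, mul_comm 2 ν, Real.rpow_mul (hr y).le, Real.rpow_two,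
      one_div, ← mul_inv]
    exact inv_anti₀ (by positivity) (hDb y).1
  have hgi' : Integrable g' := by
    refine ((integrable_norm_add_mul_I_rpow hc (s := 2 * ν + 1) (by linarith)).const_mul
      (2 * ν / b ^ 4)).mono' (Continuous.aestronglyMeasurable (by fun_prop))
      (Filter.Eventually.of_forall fun y => ?_)
    have h2 := hs y
    have h3 := hr y
    have h4 := hDpos y
    simp only [hg']
    rw [norm_mul, norm_neg, norm_mul, hn1, hαn, norm_pow, norm_inv, Real.rpow_neg h3.le,
      Real.rpow_add_one h3.ne', mul_comm 2 ν, Real.rpow_mul h3.le, Real.rpow_two]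
    have h5 : ‖D y‖⁻¹ ≤ (b ^ 2 * (‖(c + y * Complex.I : ℂ)‖ ^ ν) ^ 2)⁻¹ :=
      inv_anti₀ (by positivity) (hDb y).1
    refine (mul_le_mul_of_nonneg_left (pow_le_pow_left₀ (by positivity) h5 2)
      (by positivity)).trans_eq ?_
    field_simp
  have hgb : ∀ y : ℝ, ‖g'' y‖ ≤ B / τ ^ 3 * ‖(c + y * Complex.I : ℂ)‖ ^ (-(2 - ν)) := by
    intro y
    have h2 := hs y
    have h3 := hr y
    have h4 := hDpos y
    have h5 : ‖D y‖⁻¹ ≤ (b ^ 2 * (‖(c + y * Complex.I : ℂ)‖ ^ ν) ^ 2)⁻¹ :=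
      inv_anti₀ (by positivity) (hDb y).1
    have h6 : ‖D y‖⁻¹ ^ 2 ≤ (b ^ 4 / 8 * ‖(c + y * Complex.I : ℂ)‖ ^ ν * τ ^ 3)⁻¹ := by
      rw [inv_pow]
      exact inv_anti₀ (by positivity) (hDb y).2
    have h7 : ‖D y‖⁻¹ ^ 3 ≤ (b ^ 4 / 8 * ‖(c + y * Complex.I : ℂ)‖ ^ ν * τ ^ 3)⁻¹ *
        (b ^ 2 * (‖(c + y * Complex.I : ℂ)‖ ^ ν) ^ 2)⁻¹ := by
      rw [pow_succ]
      gcongr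
    have hpw : ‖(c + y * Complex.I : ℂ)‖ ^ (-(2 - ν)) =
        ‖(c + y * Complex.I : ℂ)‖ ^ ν / ‖(c + y * Complex.I : ℂ)‖ ^ 2 := by
      rw [neg_sub, Real.rpow_sub h3, Real.rpow_two]
    simp only [hg'']
    refine (norm_add_le _ _).trans ?_
    rw [norm_mul, norm_neg, norm_mul, norm_mul, norm_mul, norm_mul, norm_pow, norm_pow, norm_pow,
      norm_mul, norm_inv, hn1, hn2, hαn, hpw, Complex.norm_ofNat]
    generalize ‖(c + y * Complex.I : ℂ)‖ ^ ν = s at *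
    generalize ‖(c + y * Complex.I : ℂ)‖ = r at *
    calc _ ≤ 2 * ν * (1 * (s ^ 2 / r ^ 2)) * (b ^ 4 / 8 * s * τ ^ 3)⁻¹ +
          2 * (2 * ν * (s ^ 2 / r)) ^ 2 * ((b ^ 4 / 8 * s * τ ^ 3)⁻¹ * (b ^ 2 * s ^ 2)⁻¹) := by
          gcongr
      _ = _ := by
          rw [hB]
          field_simp
          ring
  have hint := integrable_norm_add_mul_I_rpow hc (s := 2 - ν) (by linarith)
  have hgi'' : Integrable g'' :=
    (hint.const_mul _).mono' (Continuous.aestronglyMeasurable (by fun_prop))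
      (Filter.Eventually.of_forall hgb)
  have hIBP : ∫ y : ℝ, Complex.exp (c + y * Complex.I) * (1 / D y) =
      ∫ y : ℝ, Complex.exp (c + y * Complex.I) * g'' y := by
    simp only [one_div]
    rw [integral_cexp_mul_eq_neg c hgd hgi hgi', integral_cexp_mul_eq_neg c hgd' hgi' hgi'',
      neg_neg]
  rw [hIBP]
  refine (norm_integral_le_of_norm_le ((hint.const_mul (B / τ ^ 3)).const_mul (Real.exp c))
    (Filter.Eventually.of_forall fun y => ?_)).trans_eq ?_
  · rw [norm_mul, norm_cexp_add_mul_I]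
    exact mul_le_mul_of_nonneg_left (hgb y) (Real.exp_pos c).le
  · rw [integral_const_mul, integral_const_mul]
    ring

/-- The odd extension of a function on the positive half line. -/
noncomputable def oddExtension (f : ℝ → ℝ) (x : ℝ) : ℂ :=
  (((Ioi 0).indicator f x : ℝ) : ℂ) - (((Ioi 0).indicator f (-x) : ℝ) : ℂ)

lemma integrable_oddExtension {f : ℝ → ℝ} (hf : IntegrableOn f (Ioi 0)) :
    Integrable (oddExtension f) := by
  have h : Integrable fun x : ℝ => (((Ioi 0).indicator f x : ℝ) : ℂ) :=
    ((integrable_indicator_iff measurableSet_Ioi).2 hf).ofReal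
  exact h.sub h.comp_neg

lemma oddExtension_of_pos (f : ℝ → ℝ) {x : ℝ} (hx : 0 < x) : oddExtension f x = f x := by
  rw [oddExtension, indicator_of_mem (mem_Ioi.2 hx),
    indicator_of_notMem (fun h => by linarith [mem_Ioi.1 h])]
  simp

lemma oddExtension_of_odd {f : ℝ → ℝ} (hf : ∀ x, f (-x) = -f x) (x : ℝ) :
    oddExtension f x = f x := by
  rcases lt_trichotomy x 0 with h | h | h
  · rw [oddExtension, indicator_of_notMem (fun h' => by linarith [mem_Ioi.1 h']),
      indicator_of_mem (mem_Ioi.2 (by linarith)), hf]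
    simp
  · have h0 : f 0 = 0 := by linarith [hf 0, congrArg f (neg_zero (G := ℝ))]
    rw [h, h0]
    simp [oddExtension]
  · exact oddExtension_of_pos f h

lemma integral_cexp_mul_oddExtension {f : ℝ → ℝ} (hf : IntegrableOn f (Ioi 0)) (θ : ℝ) :
    ∫ x : ℝ, Complex.exp ((θ * x : ℝ) * Complex.I) * oddExtension f x =
      2 * Complex.I * (∫ x in Ioi (0 : ℝ), f x * Real.sin (θ * x) : ℝ) := by
  set φ : ℝ → ℂ := fun x => (((Ioi 0).indicator f x : ℝ) : ℂ) with hφ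
  have hφi : Integrable φ := ((integrable_indicator_iff measurableSet_Ioi).2 hf).ofReal
  have hmul : ∀ (θ : ℝ) {k : ℝ → ℂ}, Integrable k →
      Integrable fun x : ℝ => Complex.exp ((θ * x : ℝ) * Complex.I) * k x := fun θ k hk =>
    hk.bdd_mul (c := 1) (Continuous.aestronglyMeasurable (by fun_prop))
      (Filter.Eventually.of_forall fun x => (Complex.norm_exp_ofReal_mul_I _).le)
  have hneg : ∫ x : ℝ, Complex.exp ((θ * x : ℝ) * Complex.I) * φ (-x) =
      ∫ x : ℝ, Complex.exp ((-θ * x : ℝ) * Complex.I) * φ x := by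
    rw [← integral_neg_eq_self]
    simp only [mul_neg, neg_neg, neg_mul]
  simp only [oddExtension, mul_sub]
  rw [integral_sub (hmul θ hφi) (hmul θ hφi.comp_neg), hneg,
    ← integral_sub (hmul θ hφi) (hmul (-θ) hφi), ← integral_complex_ofReal,
    ← integral_const_mul, ← integral_indicator measurableSet_Ioi]
  congr 1
  ext x
  by_cases hx : x ∈ Ioi (0 : ℝ)
  · simp only [hφ, indicator_of_mem hx]
    push_cast
    rw [Complex.sin, neg_mul (θ : ℂ) x]
    linear_combination (-(f x : ℂ) * (Complex.exp (-(θ * x) * Complex.I) -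
      Complex.exp (θ * x * Complex.I))) * Complex.I_sq
  · simp [hφ, indicator_of_notMem hx]

/-- Inversion of the sine transform. -/
lemma sine_transform_inversion {f : ℝ → ℝ} (hf : IntegrableOn f (Ioi 0)) {G : ℝ → ℝ}
    (hG : ∀ τ, G τ = ∫ x in Ioi (0 : ℝ), f x * Real.sin (τ * x)) (hGi : IntegrableOn G (Ioi 0))
    {x : ℝ} (hx : 0 < x) (hfx : ContinuousAt f x) :
    f x = (2 / π) * ∫ τ in Ioi (0 : ℝ), G τ * Real.sin (x * τ) := by
  have hπ := Real.pi_pos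
  have hodd : ∀ τ, G (-τ) = -G τ := fun τ => by
    rw [hG, hG, ← integral_neg]
    simp
  have hF : ∀ ξ : ℝ, FourierTransform.fourier (oddExtension f) ξ =
      -2 * Complex.I * oddExtension G (2 * π * ξ) := by
    intro ξ
    have h := integral_cexp_mul_oddExtension hf (-(2 * π * ξ))
    rw [← hG, hodd] at h
    rw [Real.fourier_eq', oddExtension_of_odd hodd]
    convert h using 1
    · congr 1
      ext v
      rw [smul_eq_mul, RCLike.inner_apply, conj_trivial,
        show -2 * π * (ξ * v) = -(2 * π * ξ) * v by ring]
    · push_cast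
      ring
  have hFi : Integrable (FourierTransform.fourier (oddExtension f)) :=
    (((integrable_oddExtension hGi).comp_mul_left' (R := 2 * π) (by positivity)).const_mul
      (-2 * Complex.I)).congr (Filter.Eventually.of_forall fun ξ => (hF ξ).symm)
  have hcont : ContinuousAt (oddExtension f) x := by
    refine (Complex.continuous_ofReal.continuousAt.comp hfx).congr ?_
    filter_upwards [Ioi_mem_nhds hx] with y hy using (oddExtension_of_pos f hy).symm
  have hinv := (integrable_oddExtension hf).fourierInv_fourier_eq hFi hcont
  rw [Real.fourierInv_eq', oddExtension_of_pos f hx] at hinv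
  have hcomp := Measure.integral_comp_mul_left
    (fun τ : ℝ => Complex.exp ((x * τ : ℝ) * Complex.I) * oddExtension G τ) (2 * π)
  have hfun : ∀ ξ : ℝ, Complex.exp (((2 * π * inner ℝ ξ x : ℝ) : ℂ) * Complex.I) •
      FourierTransform.fourier (oddExtension f) ξ = -2 * Complex.I *
        (Complex.exp ((x * (2 * π * ξ) : ℝ) * Complex.I) * oddExtension G (2 * π * ξ)) := by
    intro ξ
    rw [hF, smul_eq_mul, mul_left_comm, RCLike.inner_apply, conj_trivial,
      show 2 * π * (x * ξ) = x * (2 * π * ξ) by ring]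
  simp only [hfun] at hinv
  rw [integral_const_mul, hcomp, abs_of_pos (by positivity), Complex.real_smul,
    integral_cexp_mul_oddExtension hGi] at hinv
  refine Complex.ofReal_injective (hinv.symm.trans ?_)
  generalize (∫ τ in Ioi (0 : ℝ), G τ * Real.sin (x * τ)) = r
  have hπ' : (π : ℂ) ≠ 0 := by exact_mod_cast hπ.ne'
  push_cast
  field_simp
  linear_combination (-(r : ℂ)) * Complex.I_sq

lemma integrableOn_Ioi_of_norm_le_div_sq {f : ℝ → ℝ} (hf : Continuous f) {C : ℝ}
    (hC : ∀ x, 0 < x → |f x| ≤ C / x ^ 2) : IntegrableOn f (Ioi 0) := by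
  rw [← Ioc_union_Ioi_eq_Ioi zero_le_one]
  refine (hf.integrableOn_Icc.mono_set Ioc_subset_Icc_self).union ?_
  refine ((integrableOn_Ioi_rpow_of_lt (a := -2) (by norm_num) one_pos).const_mul C).mono'
    hf.aestronglyMeasurable ?_
  filter_upwards [ae_restrict_mem measurableSet_Ioi] with x hx
  have hx0 : 0 < x := one_pos.trans hx
  rw [Real.rpow_neg hx0.le, Real.rpow_two, ← div_eq_mul_inv]
  exact hC x hx0

lemma integrableOn_wrightF {ν : ℝ} (h0 : 1 / 2 < ν) (h1 : ν < 1) :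
    IntegrableOn (wrightF ν) (Ioi 0) := by
  have hν : 0 < ν := by linarith
  have hint := integrable_norm_add_mul_I_rpow one_pos (s := 2 * ν) (by linarith)
  refine integrableOn_Ioi_of_norm_le_div_sq (continuous_wrightF hν h1)
    (C := 1 / (2 * π) * (2 * Real.exp 1 / Real.cos (π / 2 * ν) ^ 2 *
      ∫ y : ℝ, ‖((1 : ℝ) + y * Complex.I : ℂ)‖ ^ (-(2 * ν)))) fun x hx => ?_
  rw [← Real.norm_eq_abs, ← Complex.norm_real, wrightF_eq_integral_line h0 h1 hx one_pos,
    norm_mul, Complex.norm_real, Real.norm_of_nonneg (by positivity)]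
  refine (mul_le_mul_of_nonneg_left (norm_integral_le_of_norm_le (hint.const_mul _)
    (Filter.Eventually.of_forall (norm_bromwichKernel_le hν h1 hx one_pos)))
    (by positivity)).trans_eq ?_
  rw [integral_const_mul, mul_pow]
  generalize (∫ y : ℝ, ‖((1 : ℝ) + y * Complex.I : ℂ)‖ ^ (-(2 * ν))) = r
  field_simp

lemma continuous_integral_mul_sin {f : ℝ → ℝ} (hf : IntegrableOn f (Ioi 0)) :
    Continuous fun τ : ℝ => ∫ x in Ioi (0 : ℝ), f x * Real.sin (τ * x) := by
  refine continuous_of_dominated (bound := fun x => |f x|) (fun τ => ?_) (fun τ => ?_) hf.abs ?_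
  · exact hf.aestronglyMeasurable.mul (Continuous.aestronglyMeasurable (by fun_prop))
  · refine Filter.Eventually.of_forall fun x => ?_
    rw [Real.norm_eq_abs, abs_mul]
    exact mul_le_of_le_one_right (abs_nonneg _) (Real.abs_sin_le_one _)
  · exact Filter.Eventually.of_forall fun x => by fun_prop

lemma integrableOn_integral_wrightF_mul_sin {ν : ℝ} (h0 : 1 / 2 < ν) (h1 : ν < 1) :
    IntegrableOn (fun τ => ∫ x in Ioi (0 : ℝ), wrightF ν x * Real.sin (τ * x)) (Ioi 0) := by
  obtain ⟨C, hC⟩ := exists_norm_integral_cexp_mul_inv_le h0 h1 one_pos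
  refine integrableOn_Ioi_of_norm_le_div_sq
    (continuous_integral_mul_sin (integrableOn_wrightF h0 h1)) (C := 1 / (2 * π) * C)
    fun τ hτ => ?_
  have h := hC τ hτ
  rw [← Real.norm_eq_abs, ← Complex.norm_real, integral_wrightF_mul_sin h0 h1 τ one_pos, norm_mul,
    Complex.norm_real, Real.norm_of_nonneg (by positivity)]
  simp only [div_eq_mul_inv _ (_ + _), one_mul] at h ⊢
  simp only [mul_left_comm _ (τ : ℂ)]
  rw [integral_const_mul, norm_mul, Complex.norm_real, Real.norm_of_nonneg hτ.le]
  refine (mul_le_mul_of_nonneg_left (mul_le_mul_of_nonneg_left h hτ.le)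
    (by positivity)).trans_eq ?_
  field_simp

theorem wrightF_sine_transform (ν : ℝ) (hν0 : 1 / 2 ≤ ν) (hν1 : ν < 1)
    (x : ℝ) (hx : 0 < x) :
    IntegrableOn
      (fun τ : ℝ => τ * mittagLeffler2 (2 * ν) (2 * ν) (-τ ^ 2) * Real.sin (x * τ)) (Ioi 0) ∧
    wrightF ν x =
      (2 / π) *
        ∫ τ in Ioi (0 : ℝ), τ * mittagLeffler2 (2 * ν) (2 * ν) (-τ ^ 2) * Real.sin (x * τ) := by
  rcases hν0.eq_or_lt with rfl | h0
  · exact wrightF_sine_transform_half x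
  · have hfi := integrableOn_wrightF h0 hν1
    have hGi := integrableOn_integral_wrightF_mul_sin h0 hν1
    simp only [integral_wrightF_mul_sin_eq_mittagLeffler2 h0 hν1] at hGi
    refine ⟨?_, sine_transform_inversion hfi
      (fun τ => (integral_wrightF_mul_sin_eq_mittagLeffler2 h0 hν1 τ).symm) hGi hx
      (continuous_wrightF (by linarith) hν1).continuousAt⟩
    exact hGi.mul_bdd (c := 1) (Continuous.aestronglyMeasurable (by fun_prop))
      (Filter.Eventually.of_forall fun τ => Real.abs_sin_le_one _)
end

section
/- For every 1/2 < ν < 1 there exists c > 0 such that: (i) M_ν attains its global maximum over [0,∞) exactly at the point c; (ii) consequently, for every t > 0 the Cauchy Green function x ↦ G_c(x,t;ν) attains its global maximum over ℝ exactly at the two points x = ±c·t^ν, with maximum value G_c^*(t;ν) = M_ν(c)/(2 t^ν); and (iii) the product of the maximum value with the positive maximum location is independent of time: G_c^*(t;ν) · (c t^ν) = c·M_ν(c)/2 for all t > 0. -/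
open Real MeasureTheory Set

/-- The Mainardi function `M_ν(x) = Σ_{n=0}^∞ (−x)^n/(n! · Γ(1 − ν − νn))`. -/
noncomputable def mainardi (ν x : ℝ) : ℝ :=
  ∑' n : ℕ, (-x) ^ n / ((n.factorial : ℝ) * Real.Gamma (1 - ν - ν * n))

/-- The Green function of the Cauchy problem for the time-fractional
diffusion-wave equation: `G_c(x,t;ν) = M_ν(|x|/t^ν)/(2 t^ν)`. -/
noncomputable def greenCauchy (ν x t : ℝ) : ℝ :=
  mainardi ν (|x| / t ^ ν) / (2 * t ^ ν)

/-- The Laplace transform of `t ^ (s - 1)` on the open right half-plane. -/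
theorem integral_rpow_mul_cexp_neg_mul_Ioi {s : ℝ} (hs : 0 < s) {r : ℂ} (hr : 0 < r.re) :
    ∫ t : ℝ in Ioi 0, ((t ^ (s - 1) : ℝ) : ℂ) * Complex.exp (-(r * t)) =
      (Real.Gamma s : ℂ) * r ^ (-s : ℂ) := by
  set U : Set ℂ := {z | 0 < z.re} with hU
  have hUo : IsOpen U := isOpen_lt continuous_const Complex.continuous_re
  have hUc : IsPreconnected U := (convex_halfSpace_re_gt 0).isPreconnected
  have hmeas (q : ℝ) (z : ℂ) : AEStronglyMeasurable
      (fun t : ℝ => ((t ^ q : ℝ) : ℂ) * Complex.exp (-(z * t))) (volume.restrict (Ioi 0)) := by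
    refine Measurable.aestronglyMeasurable ?_
    fun_prop
  have hint (q b : ℝ) (hq : -1 < q) (hb : 0 < b) :
      IntegrableOn (fun t : ℝ => t ^ q * Real.exp (-b * t)) (Ioi 0) := by
    simpa using integrableOn_rpow_mul_exp_neg_mul_rpow hq one_pos hb
  have hnorm (q t : ℝ) (ht : 0 < t) (z : ℂ) :
      ‖((t ^ q : ℝ) : ℂ) * Complex.exp (-(z * t))‖ = t ^ q * Real.exp (-z.re * t) := by
    rw [norm_mul, Complex.norm_real, Real.norm_of_nonneg (by positivity), Complex.norm_exp]
    simp
  have hL : DifferentiableOn ℂ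
      (fun z : ℂ => ∫ t : ℝ in Ioi 0, ((t ^ (s - 1) : ℝ) : ℂ) * Complex.exp (-(z * t))) U := by
    intro z hz
    have hz' : 0 < z.re := hz
    set b := z.re / 2 with hb
    have hb0 : 0 < b := by positivity
    have key := hasDerivAt_integral_of_dominated_loc_of_deriv_le
      (μ := volume.restrict (Ioi (0 : ℝ)))
      (F := fun (z : ℂ) (t : ℝ) => ((t ^ (s - 1) : ℝ) : ℂ) * Complex.exp (-(z * t)))
      (F' := fun (z : ℂ) (t : ℝ) =>
        ((t ^ (s - 1) : ℝ) : ℂ) * (Complex.exp (-(z * t)) * -((1 : ℂ) * t)))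
      (bound := fun t => t ^ s * Real.exp (-b * t)) (x₀ := z) (s := {w : ℂ | b < w.re})
      ((isOpen_lt continuous_const Complex.continuous_re).mem_nhds
        (by change b < z.re; linarith))
      (Filter.Eventually.of_forall fun w => hmeas _ w)
      (by
        refine Integrable.mono' (hint (s - 1) z.re (by linarith) hz') (hmeas _ _) ?_
        filter_upwards [ae_restrict_mem measurableSet_Ioi] with t ht
        rw [hnorm _ _ ht])
      (by
        refine Measurable.aestronglyMeasurable ?_
        fun_prop)
      (by
        filter_upwards [ae_restrict_mem measurableSet_Ioi] with t ht w hw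
        have ht' : (0 : ℝ) < t := ht
        have hw' : b < w.re := hw
        rw [← mul_assoc, norm_mul, hnorm _ _ ht, norm_neg, one_mul, Complex.norm_real,
          Real.norm_of_nonneg ht'.le, mul_right_comm, ← Real.rpow_add_one ht'.ne']
        simp only [sub_add_cancel]
        gcongr)
      (hint s b (by linarith) hb0)
      (by
        filter_upwards with t w _
        exact ((((hasDerivAt_id w).mul_const (t : ℂ)).neg).cexp).const_mul _)
    exact key.2.differentiableAt.differentiableWithinAt
  have hR : DifferentiableOn ℂ (fun z : ℂ => (Real.Gamma s : ℂ) * z ^ (-s : ℂ)) U := by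
    intro z hz
    have : z ∈ Complex.slitPlane := Or.inl hz
    fun_prop (disch := assumption)
  refine (hL.analyticOnNhd hUo).eqOn_of_preconnected_of_frequently_eq (hR.analyticOnNhd hUo) hUc
    (z₀ := 1) (by simp [hU]) ?_ hr
  have hreal : ∀ x : ℝ, 0 < x →
      ∫ t : ℝ in Ioi 0, ((t ^ (s - 1) : ℝ) : ℂ) * Complex.exp (-((x : ℂ) * t)) =
        (Real.Gamma s : ℂ) * (x : ℂ) ^ (-s : ℂ) := by
    intro x hx
    have := Complex.integral_cpow_mul_exp_neg_mul_Ioi (a := (s : ℂ)) (r := x) (by simpa) hx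
    rw [Complex.Gamma_ofReal, one_div, Complex.inv_cpow_eq_ite,
      if_neg (by rw [Complex.arg_ofReal_of_nonneg hx.le]; exact Real.pi_pos.ne),
      ← Complex.cpow_neg, mul_comm] at this
    rw [← this]
    refine setIntegral_congr_fun measurableSet_Ioi fun t ht => ?_
    have ht' : (0 : ℝ) < t := ht
    rw [Complex.ofReal_cpow ht'.le]
    push_cast
    rfl
  have hfreq : ∃ᶠ x : ℝ in nhdsWithin (1 : ℝ) {1}ᶜ, 0 < x :=
    Filter.Eventually.frequently (nhdsWithin_le_nhds (lt_mem_nhds one_pos))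
  have htend : Filter.Tendsto (fun x : ℝ => (x : ℂ)) (nhdsWithin (1 : ℝ) {1}ᶜ)
      (nhdsWithin (1 : ℂ) {1}ᶜ) := by
    refine tendsto_nhdsWithin_iff.2 ⟨?_, ?_⟩
    · exact (Complex.continuous_ofReal.tendsto' 1 1 (by simp)).mono_left nhdsWithin_le_nhds
    · filter_upwards [self_mem_nhdsWithin] with x hx
      simpa using hx
  exact htend.frequently (hfreq.mono fun x hx => hreal x hx)

/-- The coefficient of `X ^ k` in `(1 - X) ^ (s - 1)`. -/
noncomputable def oneSubCoeff (s : ℝ) (k : ℕ) : ℝ := ∏ i ∈ Finset.range k, (1 - s / (i + 1))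

theorem coeff_rescale_binomialSeries (a : ℝ) (k : ℕ) :
    PowerSeries.coeff k (PowerSeries.rescale (-1 : ℝ) (PowerSeries.binomialSeries ℝ a)) =
      oneSubCoeff (a + 1) k := by
  rw [PowerSeries.coeff_rescale, PowerSeries.binomialSeries_coeff, smul_eq_mul, mul_one]
  induction k with
  | zero => simp [oneSubCoeff]
  | succ k ih =>
    have h : Ring.choose a (k + 1) = Ring.choose a k * ((a - k) / (k + 1)) := by
      rw [Ring.choose_eq_smul, Ring.choose_eq_smul, descPochhammer_succ_right,
        Polynomial.smeval_mul, Nat.factorial_succ]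
      simp [Polynomial.smeval_sub, Polynomial.smeval_natCast]
      field_simp
    rw [h, oneSubCoeff, Finset.prod_range_succ, ← oneSubCoeff, ← ih, pow_succ]
    field_simp
    ring

theorem coeff_mul_nonneg {f g : PowerSeries ℝ} (hf : ∀ k, 0 ≤ PowerSeries.coeff k f)
    (hg : ∀ k, 0 ≤ PowerSeries.coeff k g) (k : ℕ) : 0 ≤ PowerSeries.coeff k (f * g) := by
  rw [PowerSeries.coeff_mul]
  exact Finset.sum_nonneg fun p _ => mul_nonneg (hf _) (hg _)

/-- Positivity of the coefficients of `(1 - X) ^ (ν - 1) * (1 - (1 - X) ^ ν) ^ n`. -/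
theorem sum_choose_mul_oneSubCoeff_nonneg {ν : ℝ} (hν0 : 0 ≤ ν) (hν1 : ν ≤ 1) (n k : ℕ) :
    0 ≤ ∑ j ∈ Finset.range (n + 1), (-1) ^ j * (n.choose j : ℝ) * oneSubCoeff (ν * (j + 1)) k := by
  set A : ℝ → PowerSeries ℝ := fun a =>
    PowerSeries.rescale (-1 : ℝ) (PowerSeries.binomialSeries ℝ a) with hA
  have hadd (a b : ℝ) : A (a + b) = A a * A b := by simp [hA]
  have hzero : A 0 = 1 := by simp [hA]
  have hpow (j : ℕ) : A (ν * j) = A ν ^ j := by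
    induction j with
    | zero => simp [hzero]
    | succ j ih => rw [pow_succ, ← ih, ← hadd]; congr 1; push_cast; ring
  have h1 : ∀ k, 0 ≤ PowerSeries.coeff k (A (ν - 1)) := fun k => by
    rw [coeff_rescale_binomialSeries, oneSubCoeff]
    refine Finset.prod_nonneg fun i _ => ?_
    rw [sub_nonneg, div_le_one (by positivity)]
    have : (0 : ℝ) ≤ i := by positivity
    linarith
  have h2 : ∀ k, 0 ≤ PowerSeries.coeff k (1 - A ν) := fun k => by
    rw [map_sub, coeff_rescale_binomialSeries, oneSubCoeff]
    cases k with
    | zero => simp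
    | succ k =>
      rw [Finset.prod_range_succ', PowerSeries.coeff_one, if_neg (by simp)]
      have : 0 ≤ ∏ i ∈ Finset.range k, (1 - (ν + 1) / (((i + 1 : ℕ) : ℝ) + 1)) := by
        refine Finset.prod_nonneg fun i _ => ?_
        rw [sub_nonneg, div_le_one (by positivity)]
        have : (0 : ℝ) ≤ i := by positivity
        push_cast
        linarith
      simp only [Nat.cast_zero, zero_add, div_one]
      nlinarith
  have h3 : ∀ n k, 0 ≤ PowerSeries.coeff k (A (ν - 1) * (1 - A ν) ^ n) := by
    intro n
    induction n with
    | zero => simpa using h1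
    | succ n ih => rw [pow_succ, ← mul_assoc]; exact coeff_mul_nonneg ih h2
  convert h3 n k using 1
  rw [sub_eq_neg_add 1 (A ν), (Commute.one_right _).add_pow, Finset.mul_sum, map_sum]
  refine Finset.sum_congr rfl fun j _ => ?_
  have : A (ν - 1) * ((-A ν) ^ j * 1 ^ (n - j) * (n.choose j : PowerSeries ℝ)) =
      ((-1) ^ j * (n.choose j : ℝ)) • A (ν * j + (ν - 1)) := by
    rw [hadd, hpow, neg_pow, PowerSeries.smul_eq_C_mul]
    simp
    ring
  rw [this, PowerSeries.coeff_smul, coeff_rescale_binomialSeries, smul_eq_mul]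
  congr 2
  ring

theorem oneSubCoeff_eq (s : ℝ) (k : ℕ) :
    oneSubCoeff s k = (∏ i ∈ Finset.range k, (1 - s + i)) / k.factorial := by
  induction k with
  | zero => simp [oneSubCoeff]
  | succ k ih =>
    rw [oneSubCoeff, Finset.prod_range_succ, ← oneSubCoeff, ih, Finset.prod_range_succ,
      Nat.factorial_succ]
    push_cast
    field_simp
    ring

theorem tendsto_rpow_mul_oneSubCoeff (s : ℝ) :
    Filter.Tendsto (fun k : ℕ => (k : ℝ) ^ s * oneSubCoeff s k) Filter.atTop
      (nhds (Real.Gamma (1 - s))⁻¹) := by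
  by_cases h : Real.Gamma (1 - s) = 0
  · obtain ⟨m, hm⟩ := (Real.Gamma_eq_zero_iff _).1 h
    rw [h, inv_zero]
    refine tendsto_const_nhds.congr' ?_
    filter_upwards [Filter.eventually_gt_atTop m] with k hk
    rw [oneSubCoeff_eq, Finset.prod_eq_zero (Finset.mem_range.2 hk) (by rw [hm]; ring)]
    simp
  · have h1 := (Real.GammaSeq_tendsto_Gamma (1 - s)).inv₀ h
    have h2 : Filter.Tendsto (fun k : ℕ => (1 + (1 - s) / (k : ℝ))⁻¹) Filter.atTop (nhds 1) := by
      have := ((tendsto_const_div_atTop_nhds_zero_nat (1 - s)).const_add 1).inv₀ (by simp)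
      simpa using this
    have h3 := h1.mul h2
    rw [mul_one] at h3
    refine h3.congr' ?_
    filter_upwards [Filter.eventually_gt_atTop 0, Filter.eventually_gt_atTop ⌈|s|⌉₊] with k hk hks
    have hk' : (0 : ℝ) < k := by exact_mod_cast hk
    have hks' : s < k := (le_abs_self s).trans_lt ((Nat.le_ceil _).trans_lt (by exact_mod_cast hks))
    have h4 : (1 - s + k) ≠ 0 := by linarith
    have h5 : 1 + (1 - s) / (k : ℝ) = (1 - s + k) / k := by field_simp; ring
    rw [h5, Real.GammaSeq, oneSubCoeff_eq, Finset.prod_range_succ, Real.rpow_sub hk', Real.rpow_one]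
    have h6 : (k : ℝ) ^ s ≠ 0 := by positivity
    have h7 : (k.factorial : ℝ) ≠ 0 := by positivity
    field_simp

theorem abs_oneSubCoeff_le_exp {s : ℝ} (k : ℕ) (hk : (k : ℝ) ≤ s) :
    |oneSubCoeff s k| ≤ Real.exp s := by
  have hs : 0 ≤ s := (Nat.cast_nonneg k).trans hk
  refine le_trans ?_ (Real.pow_div_factorial_le_exp s hs k)
  rw [oneSubCoeff_eq, abs_div, Nat.abs_cast, Finset.abs_prod]
  gcongr
  rw [← Finset.card_range k, ← Finset.prod_const, Finset.card_range]
  refine Finset.prod_le_prod (fun _ _ => abs_nonneg _) fun i hi => ?_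
  have : ((i : ℝ) + 1) ≤ k := by exact_mod_cast Finset.mem_range.1 hi
  have hi0 : (0 : ℝ) ≤ i := Nat.cast_nonneg i
  rw [abs_le]
  constructor <;> linarith

theorem abs_oneSubCoeff_le {s : ℝ} (hs : 0 ≤ s) (k : ℕ) :
    |oneSubCoeff s k| ≤ Real.exp s * ((s + 2) / (k + 1)) ^ s := by
  induction k with
  | zero =>
    simp only [oneSubCoeff, Finset.range_zero, Finset.prod_empty, abs_one, Nat.cast_zero, zero_add,
      div_one]
    exact one_le_mul_of_one_le_of_one_le (Real.one_le_exp hs)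
      (Real.one_le_rpow (by linarith) hs)
  | succ k ih =>
    have hstep : oneSubCoeff s (k + 1) = oneSubCoeff s k * (1 - s / (k + 1)) := by
      rw [oneSubCoeff, Finset.prod_range_succ, ← oneSubCoeff]
    rcases le_or_gt s k with h | h
    · have h0 : 0 ≤ 1 - s / ((k : ℝ) + 1) := by
        rw [sub_nonneg, div_le_one (by positivity)]; linarith
      have h1 : 1 - s / ((k : ℝ) + 1) ≤ (((k : ℝ) + 1) / (k + 2)) ^ s := by
        have hl : Real.log (((k : ℝ) + 2) / (k + 1)) ≤ 1 / (k + 1) := by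
          refine (Real.log_le_sub_one_of_pos (by positivity)).trans (le_of_eq ?_)
          field_simp; ring
        have hl' : Real.log (((k : ℝ) + 1) / (k + 2)) = -Real.log (((k : ℝ) + 2) / (k + 1)) := by
          rw [← Real.log_inv, inv_div]
        rw [Real.rpow_def_of_pos (by positivity), hl']
        refine le_trans (Real.one_sub_le_exp_neg _) (Real.exp_le_exp.2 ?_)
        have := mul_le_mul_of_nonneg_right hl hs
        rw [one_div_mul_eq_div] at this
        linarith
      rw [hstep, abs_mul, abs_of_nonneg h0]
      calc |oneSubCoeff s k| * (1 - s / (k + 1))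
          ≤ (Real.exp s * ((s + 2) / (k + 1)) ^ s) * (((k : ℝ) + 1) / (k + 2)) ^ s := by gcongr
        _ = Real.exp s * ((s + 2) / ((k + 1 : ℕ) + 1)) ^ s := by
          rw [mul_assoc, ← Real.mul_rpow (by positivity) (by positivity)]
          congr 2
          push_cast
          field_simp
          ring
    · have h1 : 1 ≤ ((s + 2) / (((k + 1 : ℕ) : ℝ) + 1)) ^ s := by
        refine Real.one_le_rpow ?_ hs
        rw [one_le_div (by positivity)]
        push_cast
        linarith
      refine le_trans ?_ (le_mul_of_one_le_right (Real.exp_pos s).le h1)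
      rcases le_or_gt ((k : ℝ) + 1) s with h2 | h2
      · exact abs_oneSubCoeff_le_exp (k + 1) (by push_cast; exact h2)
      · rw [hstep, abs_mul]
        refine (mul_le_of_le_one_right (abs_nonneg _) ?_).trans (abs_oneSubCoeff_le_exp k h.le)
        have h3 : s / ((k : ℝ) + 1) ≤ 1 := by rw [div_le_one (by positivity)]; exact h2.le
        have h4 : 0 ≤ s / ((k : ℝ) + 1) := by positivity
        rw [abs_le]; constructor <;> linarith

theorem rpow_mul_abs_oneSubCoeff_le {s : ℝ} (hs : 0 ≤ s) (k : ℕ) :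
    (k : ℝ) ^ s * |oneSubCoeff s k| ≤ Real.exp s * (s + 2) ^ s := by
  calc (k : ℝ) ^ s * |oneSubCoeff s k|
      ≤ ((k : ℝ) + 1) ^ s * (Real.exp s * ((s + 2) / (k + 1)) ^ s) := by
        gcongr
        · linarith
        · exact abs_oneSubCoeff_le hs k
    _ = Real.exp s * (s + 2) ^ s := by
        rw [Real.div_rpow (by positivity) (by positivity)]
        have : ((k : ℝ) + 1) ^ s ≠ 0 := by positivity
        field_simp

theorem summable_pow_div_factorial_mul_rpow {ν : ℝ} (hν0 : 0 ≤ ν) (hν1 : ν < 1) {x : ℝ}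
    (hx : 0 ≤ x) :
    Summable fun j : ℕ => x ^ j / (j.factorial : ℝ) *
      (Real.exp (ν * (j + 1)) * (ν * (j + 1) + 2) ^ (ν * (j + 1))) := by
  have hlim : Filter.Tendsto (fun j : ℕ => x * Real.exp 2 * ((j : ℝ) + 3) ^ (-(1 - ν)))
      Filter.atTop (nhds 0) := by
    have h := (tendsto_rpow_neg_atTop (y := 1 - ν) (by linarith)).comp
      (Filter.tendsto_atTop_add_const_right _ (3 : ℝ) tendsto_natCast_atTop_atTop)
    simpa using h.const_mul (x * Real.exp 2)
  have hsum : Summable fun j : ℕ => Real.exp 4 * (((j : ℝ) + 3) * (1 / 2) ^ j) := by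
    refine Summable.mul_left _ ?_
    have h1 := summable_pow_mul_geometric_of_norm_lt_one (R := ℝ) 1 (r := 1 / 2) (by norm_num)
    have h2 := (summable_geometric_two).mul_left 3
    refine (h1.add h2).congr fun j => ?_
    simp; ring
  refine Summable.of_norm_bounded_eventually_nat hsum ?_
  filter_upwards [hlim.eventually_le_const (show (0 : ℝ) < 1 / 2 by norm_num)] with j hj
  rw [Real.norm_of_nonneg (by positivity)]
  set N : ℝ := (j : ℝ) + 3 with hN
  have hN1 : 1 ≤ N := by linarith [(Nat.cast_nonneg j : (0 : ℝ) ≤ j)]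
  have hN0 : 0 < N := by linarith
  have hs : ν * (j + 1) ≤ j + 1 := mul_le_of_le_one_left (by positivity) hν1.le
  have hfac : N ^ j / (j.factorial : ℝ) ≤ Real.exp N := Real.pow_div_factorial_le_exp N hN0.le j
  calc x ^ j / (j.factorial : ℝ) * (Real.exp (ν * (j + 1)) * (ν * (j + 1) + 2) ^ (ν * (j + 1)))
      ≤ x ^ j / (j.factorial : ℝ) * (Real.exp (j + 1) * N ^ (ν * (j + 1))) := by
        gcongr
        linarith
    _ = (N ^ j / (j.factorial : ℝ)) * (x ^ j * Real.exp (j + 1) * (N ^ (ν * (j + 1)) / N ^ j)) := by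
        field_simp
    _ ≤ Real.exp N * (x ^ j * Real.exp (j + 1) * (N ^ (ν * (j + 1)) / N ^ j)) := by gcongr
    _ = Real.exp 4 * (N ^ ν * (x * Real.exp 2 * N ^ (-(1 - ν))) ^ j) := by
        have e1 : N ^ (ν * (j + 1)) / N ^ j = N ^ ν * (N ^ (-(1 - ν))) ^ j := by
          rw [← Real.rpow_natCast, ← Real.rpow_natCast, ← Real.rpow_mul hN0.le,
            ← Real.rpow_sub hN0, ← Real.rpow_add hN0]
          congr 1; ring
        have e2 : Real.exp N * Real.exp (j + 1) = Real.exp 4 * Real.exp 2 ^ j := by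
          rw [← Real.exp_add, ← Real.exp_nat_mul, ← Real.exp_add]
          congr 1; rw [hN]; ring
        rw [e1, mul_pow, mul_pow]
        linear_combination (x ^ j * (N ^ ν * (N ^ (-(1 - ν))) ^ j)) * e2
    _ ≤ Real.exp 4 * (N * (1 / 2) ^ j) := by
        gcongr
        calc N ^ ν ≤ N ^ (1 : ℝ) := Real.rpow_le_rpow_of_exponent_le hN1 hν1.le
          _ = N := Real.rpow_one N

theorem mainardi_nonneg {ν : ℝ} (hν0 : 0 < ν) (hν1 : ν < 1) {x : ℝ} (hx : 0 ≤ x) :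
    0 ≤ mainardi ν x := by
  set n : ℕ → ℕ := fun k => ⌊x * (k : ℝ) ^ ν⌋₊ with hn
  have hkν : Filter.Tendsto (fun k : ℕ => (k : ℝ) ^ ν) Filter.atTop Filter.atTop :=
    (tendsto_rpow_atTop hν0).comp tendsto_natCast_atTop_atTop
  have hratio : Filter.Tendsto (fun k : ℕ => (n k : ℝ) / (k : ℝ) ^ ν) Filter.atTop (nhds x) :=
    (tendsto_nat_floor_mul_div_atTop hx).comp hkν
  have hchoose (j : ℕ) : Filter.Tendsto
      (fun k : ℕ => ((n k).choose j : ℝ) / ((k : ℝ) ^ ν) ^ j) Filter.atTop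
      (nhds (x ^ j / j.factorial)) := by
    have h1 : Filter.Tendsto (fun k : ℕ => ∏ i ∈ Finset.range j,
        ((n k : ℝ) / (k : ℝ) ^ ν - (i : ℝ) / (k : ℝ) ^ ν)) Filter.atTop
        (nhds (∏ _i ∈ Finset.range j, (x - 0))) :=
      tendsto_finsetProd _ fun i _ => hratio.sub (hkν.const_div_atTop _)
    simp only [sub_zero, Finset.prod_const, Finset.card_range] at h1
    refine (h1.div_const _).congr fun k => ?_
    have h2 : ((n k).choose j : ℝ) = (∏ i ∈ Finset.range j, ((n k : ℝ) - i)) / j.factorial := by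
      rw [← descPochhammer_eval_eq_prod_range, descPochhammer_eval_eq_descFactorial,
        Nat.descFactorial_eq_factorial_mul_choose]
      push_cast
      field_simp
    rw [h2]
    simp_rw [← sub_div]
    rw [Finset.prod_div_distrib, Finset.prod_const, Finset.card_range]
    ring
  have hrpow (k j : ℕ) (hk : 0 < k) :
      ((k : ℝ) ^ ν) ^ j * (k : ℝ) ^ ν = (k : ℝ) ^ (ν * (j + 1)) := by
    rw [← pow_succ, ← Real.rpow_mul_natCast (Nat.cast_nonneg k)]
    push_cast; rfl
  have hterm (k j : ℕ) (hk : 0 < k) :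
      (k : ℝ) ^ ν * ((-1) ^ j * ((n k).choose j : ℝ) * oneSubCoeff (ν * (j + 1)) k) =
        (-1) ^ j * (((n k).choose j : ℝ) / ((k : ℝ) ^ ν) ^ j) *
          ((k : ℝ) ^ (ν * (j + 1)) * oneSubCoeff (ν * (j + 1)) k) := by
    have : (0 : ℝ) < k := by exact_mod_cast hk
    rw [← hrpow k j hk]
    field_simp
  have hlim : Filter.Tendsto (fun k : ℕ => ∑' j : ℕ,
      (k : ℝ) ^ ν * ((-1) ^ j * ((n k).choose j : ℝ) * oneSubCoeff (ν * (j + 1)) k)) Filter.atTop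
      (nhds (∑' j : ℕ, (-x) ^ j / ((j.factorial : ℝ) * Real.Gamma (1 - ν - ν * j)))) := by
    refine tendsto_tsum_of_dominated_convergence
      (summable_pow_div_factorial_mul_rpow hν0.le hν1 hx) (fun j => ?_) ?_
    · have h := (((hchoose j).const_mul ((-1) ^ j))).mul
        (tendsto_rpow_mul_oneSubCoeff (ν * (j + 1)))
      have e : (-x) ^ j / ((j.factorial : ℝ) * Real.Gamma (1 - ν - ν * j)) =
          (-1) ^ j * (x ^ j / j.factorial) * (Real.Gamma (1 - ν * (j + 1)))⁻¹ := by
        rw [show 1 - ν * ((j : ℝ) + 1) = 1 - ν - ν * j by ring, neg_pow, div_mul_eq_div_div]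
        ring
      rw [e]
      refine h.congr' ?_
      filter_upwards [Filter.eventually_gt_atTop 0] with k hk
      rw [hterm k j hk]
    · filter_upwards [Filter.eventually_gt_atTop 0] with k hk j
      have hk' : (0 : ℝ) < k := by exact_mod_cast hk
      rw [hterm k j hk, norm_mul, norm_mul, norm_pow, norm_neg, norm_one, one_pow, one_mul,
        Real.norm_of_nonneg (by positivity), norm_mul, Real.norm_of_nonneg (by positivity)]
      have hle : ((n k).choose j : ℝ) / ((k : ℝ) ^ ν) ^ j ≤ x ^ j / j.factorial := by
        rw [div_le_iff₀ (by positivity)]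
        calc ((n k).choose j : ℝ) ≤ (n k : ℝ) ^ j / j.factorial := Nat.choose_le_pow_div j (n k)
          _ ≤ (x * (k : ℝ) ^ ν) ^ j / j.factorial := by
            gcongr
            exact Nat.floor_le (by positivity)
          _ = x ^ j / j.factorial * ((k : ℝ) ^ ν) ^ j := by rw [mul_pow]; ring
      exact mul_le_mul hle (rpow_mul_abs_oneSubCoeff_le (by positivity) k) (by positivity)
        (by positivity)
  refine ge_of_tendsto hlim (Filter.Eventually.of_forall fun k => ?_)
  rw [tsum_eq_sum (s := Finset.range (n k + 1)), ← Finset.mul_sum]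
  · exact mul_nonneg (by positivity) (sum_choose_mul_oneSubCoeff_nonneg hν0.le hν1.le _ _)
  · intro j hj
    rw [Nat.choose_eq_zero_of_lt (by simpa [Nat.lt_succ_iff] using hj)]
    simp

theorem integrableOn_rpow_mul_exp_mul_sub {α a s : ℝ} (hα : 1 < α) (ha : 0 < a) (hs : -1 < s)
    (k : ℝ) : IntegrableOn (fun r : ℝ => r ^ s * Real.exp (k * r - a * r ^ α)) (Ioi 0) := by
  obtain ⟨R, hR0, hR⟩ : ∃ R : ℝ, 0 ≤ R ∧ ∀ r, R ≤ r → k ≤ a / 2 * r ^ (α - 1) := by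
    have h := ((tendsto_rpow_atTop (y := α - 1) (by linarith)).const_mul_atTop
      (half_pos ha)).eventually_ge_atTop k
    obtain ⟨R, hR⟩ := Filter.eventually_atTop.1 h
    exact ⟨max R 0, le_max_right _ _, fun r hr => hR r ((le_max_left _ _).trans hr)⟩
  have hbound : ∀ r : ℝ, 0 < r → k * r - a * r ^ α ≤ |k| * R + -(a / 2) * r ^ α := by
    intro r hr
    have hrα : 0 ≤ a / 2 * r ^ α := by positivity
    rcases le_total R r with h | h
    · have h1 : k * r ≤ a / 2 * r ^ α := by
        calc k * r ≤ a / 2 * r ^ (α - 1) * r := by gcongr; exact hR r h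
          _ = a / 2 * r ^ α := by
            rw [mul_assoc, ← Real.rpow_add_one hr.ne', sub_add_cancel]
      have : 0 ≤ |k| * R := by positivity
      linarith
    · have h1 : k * r ≤ |k| * R := by
        calc k * r ≤ |k| * r := by gcongr; exact le_abs_self k
          _ ≤ |k| * R := by gcongr
      linarith
  refine Integrable.mono' ((integrableOn_rpow_mul_exp_neg_mul_rpow hs (by linarith : 0 < α)
    (half_pos ha)).const_mul (Real.exp (|k| * R))) ?_ ?_
  · refine Measurable.aestronglyMeasurable ?_
    fun_prop
  · filter_upwards [ae_restrict_mem measurableSet_Ioi] with r hr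
    have hr' : (0 : ℝ) < r := hr
    rw [Real.norm_of_nonneg (by positivity), mul_left_comm, ← Real.exp_add]
    gcongr
    exact hbound r hr

/-- The integrand `r ^ s * exp (-ρ r ^ α - x r ω)`. -/
noncomputable def rayIntegrand (α : ℝ) (ρ ω : ℂ) (s x r : ℝ) : ℂ :=
  ((r ^ s : ℝ) : ℂ) * Complex.exp (-(ρ * ((r ^ α : ℝ) : ℂ)) - x * (r * ω))

/-- The integral of `r ^ s * exp (-ρ r ^ α - x r ω)` over the positive half-line. -/
noncomputable def rayIntegral (α : ℝ) (ρ ω : ℂ) (s x : ℝ) : ℂ :=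
  ∫ r in Ioi (0 : ℝ), rayIntegrand α ρ ω s x r

theorem measurable_rayIntegrand (α : ℝ) (ρ ω : ℂ) (s x : ℝ) :
    Measurable (rayIntegrand α ρ ω s x) := by
  unfold rayIntegrand
  fun_prop

theorem norm_rayIntegrand (α : ℝ) (ρ ω : ℂ) (s x : ℝ) {r : ℝ} (hr : 0 < r) :
    ‖rayIntegrand α ρ ω s x r‖ = r ^ s * Real.exp (-(x * ω.re) * r - ρ.re * r ^ α) := by
  rw [rayIntegrand, norm_mul, Complex.norm_real, Real.norm_of_nonneg (by positivity),
    Complex.norm_exp]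
  congr 2
  simp
  ring

theorem integrableOn_rayIntegrand {α : ℝ} {ρ : ℂ} (hα : 1 < α) (hρ : 0 < ρ.re) (ω : ℂ) {s : ℝ}
    (hs : -1 < s) (x : ℝ) : IntegrableOn (rayIntegrand α ρ ω s x) (Ioi 0) := by
  refine Integrable.mono' (integrableOn_rpow_mul_exp_mul_sub hα hρ hs (-(x * ω.re)))
    (measurable_rayIntegrand α ρ ω s x).aestronglyMeasurable ?_
  filter_upwards [ae_restrict_mem measurableSet_Ioi] with r hr
  rw [norm_rayIntegrand _ _ _ _ _ hr]

theorem hasDerivAt_rayIntegral {α : ℝ} {ρ : ℂ} (hα : 1 < α) (hρ : 0 < ρ.re) {ω : ℂ}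
    (hω : 0 < ω.re) {s : ℝ} (hs : -1 < s) (x : ℝ) :
    HasDerivAt (rayIntegral α ρ ω s) (-ω * rayIntegral α ρ ω (s + 1) x) x := by
  have hmul : ∀ y r : ℝ, 0 < r → -ω * rayIntegrand α ρ ω (s + 1) y r =
      ((r ^ s : ℝ) : ℂ) * (Complex.exp (-(ρ * ((r ^ α : ℝ) : ℂ)) - y * (r * ω)) *
        -(((1 : ℝ) : ℂ) * (r * ω))) := by
    intro y r hr
    rw [rayIntegrand, Real.rpow_add_one hr.ne']
    push_cast
    ring
  have key := hasDerivAt_integral_of_dominated_loc_of_deriv_le (𝕜 := ℝ)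
    (μ := volume.restrict (Ioi (0 : ℝ)))
    (F := fun (y : ℝ) (r : ℝ) => rayIntegrand α ρ ω s y r)
    (F' := fun (y : ℝ) (r : ℝ) => -ω * rayIntegrand α ρ ω (s + 1) y r)
    (bound := fun r => ‖ω‖ * (r ^ (s + 1) * Real.exp (-((x - 1) * ω.re) * r - ρ.re * r ^ α)))
    (x₀ := x) (s := Ioi (x - 1)) (Ioi_mem_nhds (by linarith))
    (Filter.Eventually.of_forall fun y =>
      (measurable_rayIntegrand α ρ ω s y).aestronglyMeasurable)
    (integrableOn_rayIntegrand hα hρ ω hs x)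
    ((measurable_rayIntegrand α ρ ω (s + 1) x).const_mul _).aestronglyMeasurable
    (by
      filter_upwards [ae_restrict_mem measurableSet_Ioi] with r hr y hy
      have hr' : (0 : ℝ) < r := hr
      have hy' : x - 1 < y := hy
      rw [norm_mul, norm_neg, norm_rayIntegrand _ _ _ _ _ hr]
      gcongr)
    ((integrableOn_rpow_mul_exp_mul_sub hα hρ (by linarith) _).const_mul _)
    (by
      filter_upwards [ae_restrict_mem measurableSet_Ioi] with r hr y _
      rw [hmul y r hr]
      have h1 : HasDerivAt (fun y : ℝ => (y : ℂ) * (r * ω)) (((1 : ℝ) : ℂ) * (r * ω)) y :=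
        (HasDerivAt.ofReal_comp (hasDerivAt_id y)).mul_const _
      exact ((h1.const_sub (-(ρ * ((r ^ α : ℝ) : ℂ)))).cexp).const_mul _)
  have h := key.2
  rwa [integral_const_mul] at h

theorem tendsto_rayIntegral_atTop {α : ℝ} {ρ : ℂ} (hα : 1 < α) (hρ : 0 < ρ.re) {ω : ℂ}
    (hω : 0 < ω.re) {s : ℝ} (hs : -1 < s) :
    Filter.Tendsto (rayIntegral α ρ ω s) Filter.atTop (nhds 0) := by
  rw [show (0 : ℂ) = ∫ _r in Ioi (0 : ℝ), (0 : ℂ) by simp]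
  refine tendsto_integral_filter_of_dominated_convergence
    (fun r => r ^ s * Real.exp (-(0 * ω.re) * r - ρ.re * r ^ α))
    (Filter.Eventually.of_forall fun y =>
      (measurable_rayIntegrand α ρ ω s y).aestronglyMeasurable) ?_
    (integrableOn_rpow_mul_exp_mul_sub hα hρ hs _) ?_
  · filter_upwards [Filter.eventually_ge_atTop 0] with x hx
    filter_upwards [ae_restrict_mem measurableSet_Ioi] with r hr
    have hr' : (0 : ℝ) < r := hr
    rw [norm_rayIntegrand _ _ _ _ _ hr]
    gcongr
  · filter_upwards [ae_restrict_mem measurableSet_Ioi] with r hr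
    have hr' : (0 : ℝ) < r := hr
    rw [tendsto_zero_iff_norm_tendsto_zero]
    simp_rw [norm_rayIntegrand _ _ _ _ _ hr]
    rw [← mul_zero (r ^ s)]
    refine Filter.Tendsto.const_mul _ (Real.tendsto_exp_atBot.comp ?_)
    refine Filter.tendsto_atBot_add_const_right _ _ ?_
    have : Filter.Tendsto (fun x : ℝ => -((ω.re * r) * x)) Filter.atTop Filter.atBot :=
      Filter.tendsto_neg_atTop_atBot.comp
        (Filter.tendsto_id.const_mul_atTop (mul_pos hω hr'))
    exact this.congr fun x => by ring

theorem rayIntegral_sub_mul {α : ℝ} {ρ : ℂ} (hα : 1 < α) (hρ : 0 < ρ.re) {ω : ℂ}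
    (hω : 0 < ω.re) {p : ℝ} (hp : 0 ≤ p) :
    rayIntegral α ρ ω 0 p - p * ω * rayIntegral α ρ ω 1 p = α * ρ * rayIntegral α ρ ω α p := by
  have hI (s : ℝ) (hs : -1 < s) := integrableOn_rayIntegrand hα hρ ω hs p
  have hderiv : ∀ r ∈ Ioi (0 : ℝ), HasDerivAt (rayIntegrand α ρ ω 1 p)
      (rayIntegrand α ρ ω 0 p r - p * ω * rayIntegrand α ρ ω 1 p r -
        α * ρ * rayIntegrand α ρ ω α p r) r := by
    intro r hr
    have hr' : (0 : ℝ) < r := hr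
    have h1 : HasDerivAt (fun r : ℝ => ((r ^ (1 : ℝ) : ℝ) : ℂ)) ((1 : ℝ) : ℂ) r := by
      simpa using HasDerivAt.ofReal_comp (hasDerivAt_id r)
    have h2 : HasDerivAt (fun r : ℝ => ((r ^ α : ℝ) : ℂ)) ((α * r ^ (α - 1) : ℝ) : ℂ) r :=
      HasDerivAt.ofReal_comp (Real.hasDerivAt_rpow_const (Or.inl hr'.ne'))
    have h3 : HasDerivAt (fun r : ℝ => (p : ℂ) * (r * ω)) (p * (((1 : ℝ) : ℂ) * ω)) r :=
      ((HasDerivAt.ofReal_comp (hasDerivAt_id r)).mul_const ω).const_mul _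
    have h4 := h1.mul (((h2.const_mul ρ).neg.sub h3).cexp)
    refine h4.congr_deriv ?_
    simp only [rayIntegrand, Real.rpow_zero, Real.rpow_one, Pi.sub_apply, Pi.neg_apply]
    have h5 : r ^ α = r * r ^ (α - 1) := by
      rw [mul_comm, ← Real.rpow_add_one hr'.ne', sub_add_cancel]
    rw [show ((r ^ α : ℝ) : ℂ) * Complex.exp (-(ρ * ((r ^ α : ℝ) : ℂ)) - p * (r * ω)) =
      ((r * r ^ (α - 1) : ℝ) : ℂ) * Complex.exp (-(ρ * ((r ^ α : ℝ) : ℂ)) - p * (r * ω)) by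
        rw [← h5]]
    push_cast
    ring
  have hint01 : IntegrableOn (fun r => rayIntegrand α ρ ω 0 p r -
      p * ω * rayIntegrand α ρ ω 1 p r) (Ioi 0) :=
    (hI 0 (by norm_num)).sub ((hI 1 (by norm_num)).const_mul _)
  have hint : IntegrableOn (fun r => rayIntegrand α ρ ω 0 p r - p * ω * rayIntegrand α ρ ω 1 p r -
      α * ρ * rayIntegrand α ρ ω α p r) (Ioi 0) :=
    hint01.sub ((hI α (by linarith)).const_mul _)
  have hcont : ContinuousWithinAt (rayIntegrand α ρ ω 1 p) (Ici 0) 0 := by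
    refine Continuous.continuousWithinAt ?_
    unfold rayIntegrand
    have : Continuous fun r : ℝ => r ^ α := Real.continuous_rpow_const (by linarith)
    simp only [Real.rpow_one]
    fun_prop
  have htop : Filter.Tendsto (rayIntegrand α ρ ω 1 p) Filter.atTop (nhds 0) := by
    rw [tendsto_zero_iff_norm_tendsto_zero]
    have h := Real.tendsto_pow_mul_exp_neg_atTop_nhds_zero 1
    have h' : Filter.Tendsto (fun r : ℝ => r ^ 1 * Real.exp (-(ρ.re * r)))
        Filter.atTop (nhds 0) := by
      have h0 := (h.comp (Filter.tendsto_id.const_mul_atTop hρ)).const_mul ρ.re⁻¹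
      rw [mul_zero] at h0
      refine h0.congr fun r => ?_
      simp
      field_simp
    refine squeeze_zero' (Filter.Eventually.of_forall fun _ => norm_nonneg _) ?_ h'
    filter_upwards [Filter.eventually_ge_atTop 1] with r hr
    have hr0 : 0 < r := by linarith
    rw [norm_rayIntegrand _ _ _ _ _ hr0, Real.rpow_one, pow_one]
    have h1 : r ≤ r ^ α := by
      simpa using Real.rpow_le_rpow_of_exponent_le hr hα.le
    have h2 : 0 ≤ p * ω.re * r := by positivity
    have h3 : ρ.re * r ≤ ρ.re * r ^ α := by gcongr
    gcongr
    linarith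
  have key := integral_Ioi_of_hasDerivAt_of_tendsto hcont hderiv hint htop
  rw [show rayIntegrand α ρ ω 1 p 0 = 0 by simp [rayIntegrand], sub_zero,
    integral_sub hint01 ((hI α (by linarith)).const_mul _),
    integral_sub (hI 0 (by norm_num)) ((hI 1 (by norm_num)).const_mul _),
    integral_const_mul, integral_const_mul, sub_eq_zero] at key
  exact key

theorem rayIntegral_zero {α : ℝ} {ρ : ℂ} (hα : 1 < α) (hρ : 0 < ρ.re) (ω : ℂ) {s : ℝ}
    (hs : -1 < s) : rayIntegral α ρ ω s 0 =
      ((α⁻¹ * Real.Gamma ((s + 1) / α) : ℝ) : ℂ) * ρ ^ (-((s + 1) / α : ℝ) : ℂ) := by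
  have hα0 : 0 < α := by linarith
  have h := integral_comp_rpow_Ioi_of_pos (p := α)
    (g := fun t : ℝ => ((t ^ ((s + 1) / α - 1) : ℝ) : ℂ) * Complex.exp (-(ρ * t))) hα0
  rw [integral_rpow_mul_cexp_neg_mul_Ioi (div_pos (by linarith) hα0) hρ] at h
  rw [Complex.ofReal_mul, mul_assoc, ← h, ← integral_const_mul]
  refine setIntegral_congr_fun measurableSet_Ioi fun r hr => ?_
  have hr' : (0 : ℝ) < r := hr
  have e : r ^ s = r ^ (α - 1) * (r ^ α) ^ ((s + 1) / α - 1) := by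
    rw [← Real.rpow_mul hr'.le, ← Real.rpow_add hr']
    congr 1
    field_simp
    ring
  simp only [rayIntegrand, Complex.ofReal_zero, zero_mul, sub_zero, e, Complex.real_smul]
  push_cast
  have : (α : ℂ) ≠ 0 := by exact_mod_cast hα0.ne'
  field_simp

theorem hasSum_rayIntegral {α : ℝ} {ρ : ℂ} (hα : 1 < α) (hρ : 0 < ρ.re) {ω : ℂ} (hω : ‖ω‖ ≤ 1)
    (x : ℝ) :
    HasSum (fun n : ℕ => (-(x * ω)) ^ n / n.factorial * rayIntegral α ρ ω n 0)
      (rayIntegral α ρ ω 0 x) := by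
  have hterm (n : ℕ) (r : ℝ) : (-(x * ω)) ^ n / n.factorial * rayIntegrand α ρ ω n 0 r =
      Complex.exp (-(ρ * ((r ^ α : ℝ) : ℂ))) * ((-(x * (r * ω))) ^ n / n.factorial) := by
    simp only [rayIntegrand, Complex.ofReal_zero, zero_mul, sub_zero, Real.rpow_natCast]
    rw [show -((x : ℂ) * (r * ω)) = -(x * ω) * r by ring, mul_pow]
    push_cast
    ring
  have h := hasSum_integral_of_dominated_convergence (μ := volume.restrict (Ioi (0 : ℝ)))
    (F := fun (n : ℕ) r => (-(x * ω)) ^ n / n.factorial * rayIntegrand α ρ ω n 0 r)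
    (f := rayIntegrand α ρ ω 0 x)
    (fun n r => Real.exp (-(ρ.re * r ^ α)) * ((|x| * r) ^ n / n.factorial))
    (fun n => ((measurable_rayIntegrand α ρ ω n 0).const_mul _).aestronglyMeasurable)
    (fun n => by
      filter_upwards [ae_restrict_mem measurableSet_Ioi] with r hr
      have hr' : (0 : ℝ) < r := hr
      rw [hterm, norm_mul, Complex.norm_exp, norm_div, norm_pow, norm_neg, norm_mul, norm_mul,
        Complex.norm_real, Complex.norm_real, Real.norm_of_nonneg hr'.le, Complex.norm_natCast,
        Real.norm_eq_abs, Complex.neg_re, Complex.re_mul_ofReal]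
      gcongr
      exact mul_le_of_le_one_right hr'.le hω)
    (by
      filter_upwards with r
      exact (Real.summable_pow_div_factorial _).mul_left _)
    (by
      have e : ∀ r : ℝ, ∑' n : ℕ, Real.exp (-(ρ.re * r ^ α)) * ((|x| * r) ^ n / n.factorial) =
          r ^ (0 : ℝ) * Real.exp (|x| * r - ρ.re * r ^ α) := by
        intro r
        rw [tsum_mul_left, Real.rpow_zero, one_mul, sub_eq_neg_add, Real.exp_add]
        congr 1
        rw [Real.exp_eq_exp_ℝ, NormedSpace.exp_eq_tsum_div]
      simp_rw [e]
      exact integrableOn_rpow_mul_exp_mul_sub hα hρ (by norm_num) _)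
    (by
      filter_upwards with r
      simp_rw [hterm]
      rw [rayIntegrand, Real.rpow_zero, Complex.ofReal_one, one_mul, sub_eq_add_neg,
        Complex.exp_add]
      refine HasSum.mul_left _ ?_
      rw [Complex.exp_eq_exp_ℂ]
      exact NormedSpace.expSeries_div_hasSum_exp _)
  simp_rw [integral_const_mul] at h
  exact h

theorem integrableOn_Ioi_of_norm_le_rpow {f : ℝ → ℂ} (hf : Measurable f) {a b C : ℝ} (ha : -1 < a)
    (hb : b < -1) (h0 : ∀ y, 0 < y → y ≤ 1 → ‖f y‖ ≤ C * y ^ a)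
    (h1 : ∀ y, 1 ≤ y → ‖f y‖ ≤ C * y ^ b) : IntegrableOn f (Ioi 0) := by
  rw [← Ioc_union_Ioi_eq_Ioi zero_le_one]
  refine IntegrableOn.union ?_ ?_
  · have hi : IntegrableOn (fun y : ℝ => C * y ^ a) (Ioc 0 1) :=
      ((intervalIntegrable_iff_integrableOn_Ioc_of_le zero_le_one).1
        (intervalIntegral.intervalIntegrable_rpow' ha)).const_mul C
    refine Integrable.mono' hi hf.aestronglyMeasurable ?_
    filter_upwards [ae_restrict_mem measurableSet_Ioc] with y hy using h0 y hy.1 hy.2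
  · refine Integrable.mono' ((integrableOn_Ioi_rpow_of_lt hb one_pos).const_mul C)
      hf.aestronglyMeasurable ?_
    filter_upwards [ae_restrict_mem measurableSet_Ioi] with y hy using h1 y (le_of_lt hy)

theorem tendsto_nhdsGT_zero_of_norm_le_rpow {f : ℝ → ℂ} {e C : ℝ} (he : 0 < e)
    (h : ∀ y, 0 < y → y ≤ 1 → ‖f y‖ ≤ C * y ^ e) :
    Filter.Tendsto f (nhdsWithin 0 (Ioi 0)) (nhds 0) := by
  refine squeeze_zero_norm' (a := fun y : ℝ => C * y ^ e) ?_ ?_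
  · filter_upwards [Ioc_mem_nhdsGT (zero_lt_one' ℝ)] with y hy using h y hy.1 hy.2
  · have : Filter.Tendsto (fun y : ℝ => C * y ^ e) (nhds 0) (nhds (C * 0 ^ e)) :=
      ((Real.continuous_rpow_const he.le).const_mul C).tendsto 0
    rw [Real.zero_rpow he.ne', mul_zero] at this
    exact this.mono_left nhdsWithin_le_nhds

theorem tendsto_atTop_zero_of_norm_le_rpow {f : ℝ → ℂ} {e C : ℝ} (he : 0 < e)
    (h : ∀ y, 1 ≤ y → ‖f y‖ ≤ C * y ^ (-e)) : Filter.Tendsto f Filter.atTop (nhds 0) := by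
  refine squeeze_zero_norm' (a := fun y : ℝ => C * y ^ (-e)) ?_ ?_
  · filter_upwards [Filter.eventually_ge_atTop 1] with y hy using h y hy
  · simpa using (tendsto_rpow_neg_atTop he).const_mul C

theorem norm_cexp_neg_mul_le_one {ω : ℂ} (hω : 0 < ω.re) {y : ℝ} (hy : 0 ≤ y) :
    ‖Complex.exp (-(y * ω))‖ ≤ 1 := by
  rw [Complex.norm_exp, Real.exp_le_one_iff]
  simp
  positivity

theorem norm_one_sub_cexp_le {ω : ℂ} (hω1 : ‖ω‖ = 1) {y : ℝ} (hy : 0 ≤ y) (hy1 : y ≤ 1) :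
    ‖1 - Complex.exp (-(y * ω))‖ ≤ 2 * y := by
  have h : ‖-((y : ℂ) * ω)‖ = y := by
    rw [norm_neg, norm_mul, hω1, mul_one, Complex.norm_real, Real.norm_of_nonneg hy]
  have := Complex.norm_exp_sub_one_le (x := -(y * ω)) (by rwa [h])
  rwa [h, norm_sub_rev] at this

theorem norm_one_sub_cexp_le_two {ω : ℂ} (hω : 0 < ω.re) {y : ℝ} (hy : 0 ≤ y) :
    ‖1 - Complex.exp (-(y * ω))‖ ≤ 2 := by
  refine (norm_sub_le _ _).trans ?_
  have := norm_cexp_neg_mul_le_one hω hy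
  rw [norm_one]
  linarith

/-- The first-order Taylor remainder `1 - y z - exp (-y z)`. -/
noncomputable def expRemainder (z : ℂ) (y : ℝ) : ℂ := 1 - y * z - Complex.exp (-(y * z))

theorem norm_expRemainder_le_sq {ω : ℂ} (hω1 : ‖ω‖ = 1) {y : ℝ} (hy : 0 ≤ y) (hy1 : y ≤ 1) :
    ‖expRemainder ω y‖ ≤ y ^ 2 := by
  have h : ‖-((y : ℂ) * ω)‖ = y := by
    rw [norm_neg, norm_mul, hω1, mul_one, Complex.norm_real, Real.norm_of_nonneg hy]
  have := Complex.norm_exp_sub_one_sub_id_le (x := -(y * ω)) (by rwa [h])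
  rw [h, ← norm_neg] at this
  have e : expRemainder ω y = -(Complex.exp (-(y * ω)) - 1 - -(y * ω)) := by
    rw [expRemainder]; ring
  rw [e]
  exact this

theorem norm_expRemainder_le {ω : ℂ} (hω1 : ‖ω‖ = 1) (hω : 0 < ω.re) {y : ℝ} (hy : 1 ≤ y) :
    ‖expRemainder ω y‖ ≤ 3 * y := by
  have h : ‖(y : ℂ) * ω‖ = y := by
    rw [norm_mul, hω1, mul_one, Complex.norm_real, Real.norm_of_nonneg (by linarith)]
  have h1 := norm_sub_le (1 - y * ω) (Complex.exp (-(y * ω)))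
  have h2 := norm_sub_le 1 (y * ω)
  have h3 := norm_cexp_neg_mul_le_one hω (by linarith : 0 ≤ y)
  rw [norm_one, h] at h2
  rw [expRemainder]
  linarith

theorem integrableOn_expRemainder {α : ℝ} (hα1 : 1 < α) (hα2 : α < 2) {ω : ℂ} (hω1 : ‖ω‖ = 1)
    (hω : 0 < ω.re) :
    IntegrableOn (fun y : ℝ => expRemainder ω y * ((y ^ (-1 - α) : ℝ) : ℂ)) (Ioi 0) := by
  refine integrableOn_Ioi_of_norm_le_rpow (a := 1 - α) (b := -α) (C := 3) ?_ (by linarith)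
    (by linarith) (fun y hy hy1 => ?_) (fun y hy => ?_)
  · unfold expRemainder
    fun_prop
  · rw [norm_mul, Complex.norm_real, Real.norm_of_nonneg (by positivity)]
    calc ‖expRemainder ω y‖ * y ^ (-1 - α) ≤ y ^ 2 * y ^ (-1 - α) := by
          gcongr; exact norm_expRemainder_le_sq hω1 hy.le hy1
      _ = y ^ (1 - α) := by
          rw [← Real.rpow_natCast, ← Real.rpow_add hy]; congr 1; push_cast; ring
      _ ≤ 3 * y ^ (1 - α) := le_mul_of_one_le_left (by positivity) (by norm_num)
  · have hy0 : 0 < y := by linarith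
    rw [norm_mul, Complex.norm_real, Real.norm_of_nonneg (by positivity)]
    calc ‖expRemainder ω y‖ * y ^ (-1 - α) ≤ 3 * y * y ^ (-1 - α) := by
          gcongr; exact norm_expRemainder_le hω1 hω hy
      _ = 3 * y ^ (-α) := by
          rw [mul_assoc, mul_comm y, ← Real.rpow_add_one hy0.ne']; congr 2; ring

theorem integral_one_sub_cexp {α : ℝ} (hα1 : 1 < α) (hα2 : α < 2) {ω : ℂ} (hω1 : ‖ω‖ = 1)
    (hω : 0 < ω.re) :
    IntegrableOn (fun y : ℝ => (1 - Complex.exp (-(y * ω))) * ((y ^ (-α) : ℝ) : ℂ)) (Ioi 0) ∧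
    ∫ y in Ioi (0 : ℝ), (1 - Complex.exp (-(y * ω))) * ((y ^ (-α) : ℝ) : ℂ) =
      ((Real.Gamma (2 - α) / (α - 1) : ℝ) : ℂ) * ω ^ ((α - 1 : ℝ) : ℂ) := by
  have hω0 : ω ≠ 0 := by rintro rfl; simp at hω
  have hint : IntegrableOn
      (fun y : ℝ => (1 - Complex.exp (-(y * ω))) * ((y ^ (-α) : ℝ) : ℂ)) (Ioi 0) := by
    refine integrableOn_Ioi_of_norm_le_rpow (a := 1 - α) (b := -α) (C := 2) (by fun_prop)
      (by linarith) (by linarith) (fun y hy hy1 => ?_) (fun y hy => ?_)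
    · rw [norm_mul, Complex.norm_real, Real.norm_of_nonneg (by positivity)]
      calc ‖1 - Complex.exp (-(y * ω))‖ * y ^ (-α) ≤ 2 * y * y ^ (-α) := by
            gcongr; exact norm_one_sub_cexp_le hω1 hy.le hy1
        _ = 2 * y ^ (1 - α) := by
            rw [mul_assoc, mul_comm y, ← Real.rpow_add_one hy.ne']; congr 2; ring
    · have hy0 : 0 < y := by linarith
      rw [norm_mul, Complex.norm_real, Real.norm_of_nonneg (by positivity)]
      gcongr
      exact norm_one_sub_cexp_le_two hω hy0.le
  refine ⟨hint, ?_⟩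
  have hΓ := integral_rpow_mul_cexp_neg_mul_Ioi (s := 2 - α) (by linarith) hω
  have hα0 : (1 - α : ℝ) ≠ 0 := by linarith
  have hu : ∀ y ∈ Ioi (0 : ℝ), HasDerivAt (fun y : ℝ => 1 - Complex.exp (-(y * ω)))
      (ω * Complex.exp (-(y * ω))) y := by
    intro y _
    have h1 : HasDerivAt (fun y : ℝ => -((y : ℂ) * ω)) (-(((1 : ℝ) : ℂ) * ω)) y :=
      ((HasDerivAt.ofReal_comp (hasDerivAt_id y)).mul_const ω).neg
    refine (h1.cexp.const_sub 1).congr_deriv ?_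
    push_cast
    ring
  have hv : ∀ y ∈ Ioi (0 : ℝ), HasDerivAt (fun y : ℝ => ((y ^ (1 - α) / (1 - α) : ℝ) : ℂ))
      ((y ^ (-α) : ℝ) : ℂ) y := by
    intro y hy
    have hy' : (0 : ℝ) < y := hy
    refine HasDerivAt.ofReal_comp
      (((Real.hasDerivAt_rpow_const (Or.inl hy'.ne')).div_const (1 - α)).congr_deriv ?_)
    rw [mul_div_cancel_left₀ _ hα0]
    congr 1
    ring
  have heq : ∀ y : ℝ, ω * Complex.exp (-(y * ω)) * ((y ^ (1 - α) / (1 - α) : ℝ) : ℂ) =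
      (ω / ((1 - α : ℝ) : ℂ)) * (((y ^ (2 - α - 1) : ℝ) : ℂ) * Complex.exp (-(ω * y))) := by
    intro y
    rw [show 2 - α - 1 = 1 - α by ring, mul_comm (y : ℂ) ω, Complex.ofReal_div]
    ring
  have hint2 : IntegrableOn (fun y : ℝ =>
      ω * Complex.exp (-(y * ω)) * ((y ^ (1 - α) / (1 - α) : ℝ) : ℂ)) (Ioi 0) := by
    simp_rw [heq]
    refine Integrable.const_mul ?_ _
    have h0 := integrableOn_rpow_mul_exp_neg_mul_rpow (p := 1) (s := 2 - α - 1) (b := ω.re)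
      (by linarith) one_pos hω
    refine Integrable.mono' h0 (Measurable.aestronglyMeasurable (by fun_prop)) ?_
    filter_upwards [ae_restrict_mem measurableSet_Ioi] with y hy
    have hy' : (0 : ℝ) < y := hy
    rw [norm_mul, Complex.norm_real, Real.norm_of_nonneg (by positivity), Complex.norm_exp]
    simp
  have hnorm : ∀ y : ℝ, 0 < y → ‖((y ^ (1 - α) / (1 - α) : ℝ) : ℂ)‖ = y ^ (1 - α) / (α - 1) := by
    intro y hy
    rw [Complex.norm_real, norm_div, Real.norm_of_nonneg (by positivity), Real.norm_eq_abs,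
      abs_sub_comm, abs_of_pos (by linarith)]
  have hα1' : 0 < α - 1 := by linarith
  have h0 : Filter.Tendsto ((fun y : ℝ => 1 - Complex.exp (-(y * ω))) *
      (fun y : ℝ => ((y ^ (1 - α) / (1 - α) : ℝ) : ℂ))) (nhdsWithin 0 (Ioi 0)) (nhds 0) := by
    refine tendsto_nhdsGT_zero_of_norm_le_rpow (e := 2 - α) (C := 2 / (α - 1)) (by linarith)
      fun y hy hy1 => ?_
    rw [Pi.mul_apply, norm_mul, hnorm y hy]
    calc ‖1 - Complex.exp (-(y * ω))‖ * (y ^ (1 - α) / (α - 1))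
        ≤ 2 * y * (y ^ (1 - α) / (α - 1)) := by
          gcongr; exact norm_one_sub_cexp_le hω1 hy.le hy1
      _ = 2 / (α - 1) * y ^ (2 - α) := by
          rw [show 2 - α = 1 - α + 1 by ring, Real.rpow_add_one hy.ne']; ring
  have htop : Filter.Tendsto ((fun y : ℝ => 1 - Complex.exp (-(y * ω))) *
      (fun y : ℝ => ((y ^ (1 - α) / (1 - α) : ℝ) : ℂ))) Filter.atTop (nhds 0) := by
    refine tendsto_atTop_zero_of_norm_le_rpow (e := α - 1) (C := 2 / (α - 1)) hα1'
      fun y hy => ?_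
    have hy0 : 0 < y := by linarith
    rw [Pi.mul_apply, norm_mul, hnorm y hy0]
    calc ‖1 - Complex.exp (-(y * ω))‖ * (y ^ (1 - α) / (α - 1))
        ≤ 2 * (y ^ (1 - α) / (α - 1)) := by
          gcongr; exact norm_one_sub_cexp_le_two hω hy0.le
      _ = 2 / (α - 1) * y ^ (-(α - 1)) := by rw [neg_sub]; ring
  rw [integral_Ioi_mul_deriv_eq_deriv_mul hu hv hint hint2 h0 htop]
  simp_rw [heq]
  rw [integral_const_mul, hΓ, sub_zero, zero_sub]
  have e : ω ^ ((α - 1 : ℝ) : ℂ) = ω * ω ^ (-((2 - α : ℝ) : ℂ)) := by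
    rw [show ((α - 1 : ℝ) : ℂ) = 1 + -((2 - α : ℝ) : ℂ) by push_cast; ring,
      Complex.cpow_add _ _ hω0, Complex.cpow_one]
  rw [e]
  have h1 : ((1 - α : ℝ) : ℂ) ≠ 0 := by exact_mod_cast hα0
  have h2 : ((α - 1 : ℝ) : ℂ) ≠ 0 := by exact_mod_cast hα1'.ne'
  rw [Complex.ofReal_div]
  field_simp
  push_cast
  ring

/-- The value of the stable subordination integral. -/
theorem integral_expRemainder {α : ℝ} (hα1 : 1 < α) (hα2 : α < 2) {ω : ℂ} (hω1 : ‖ω‖ = 1)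
    (hω : 0 < ω.re) :
    ∫ y in Ioi (0 : ℝ), expRemainder ω y * ((y ^ (-1 - α) : ℝ) : ℂ) =
      -((Real.Gamma (2 - α) / (α * (α - 1)) : ℝ) : ℂ) * ω ^ (α : ℂ) := by
  have hω0 : ω ≠ 0 := by rintro rfl; simp at hω
  have hα0 : 0 < α := by linarith
  obtain ⟨hi, hv0⟩ := integral_one_sub_cexp hα1 hα2 hω1 hω
  have hu : ∀ y ∈ Ioi (0 : ℝ), HasDerivAt (expRemainder ω)
      (-ω * (1 - Complex.exp (-(y * ω)))) y := by
    intro y _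
    have h1 : HasDerivAt (fun y : ℝ => (y : ℂ) * ω) (((1 : ℝ) : ℂ) * ω) y :=
      (HasDerivAt.ofReal_comp (hasDerivAt_id y)).mul_const ω
    refine ((h1.const_sub 1).sub (h1.neg.cexp)).congr_deriv ?_
    simp only [Pi.neg_apply]
    push_cast
    ring
  have hv : ∀ y ∈ Ioi (0 : ℝ), HasDerivAt (fun y : ℝ => ((y ^ (-α) / (-α) : ℝ) : ℂ))
      ((y ^ (-1 - α) : ℝ) : ℂ) y := by
    intro y hy
    have hy' : (0 : ℝ) < y := hy
    refine HasDerivAt.ofReal_comp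
      (((Real.hasDerivAt_rpow_const (Or.inl hy'.ne')).div_const (-α)).congr_deriv ?_)
    rw [mul_div_cancel_left₀ _ (neg_ne_zero.2 hα0.ne')]
    congr 1
    ring
  have heq : ∀ y : ℝ, -ω * (1 - Complex.exp (-(y * ω))) * ((y ^ (-α) / (-α) : ℝ) : ℂ) =
      (ω / α) * ((1 - Complex.exp (-(y * ω))) * ((y ^ (-α) : ℝ) : ℂ)) := by
    intro y
    have : (α : ℂ) ≠ 0 := by exact_mod_cast hα0.ne'
    rw [Complex.ofReal_div]
    push_cast
    field_simp
  have hint2 : IntegrableOn (fun y : ℝ =>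
      -ω * (1 - Complex.exp (-(y * ω))) * ((y ^ (-α) / (-α) : ℝ) : ℂ)) (Ioi 0) := by
    simp_rw [heq]
    exact hi.const_mul _
  have hnorm : ∀ y : ℝ, 0 < y → ‖((y ^ (-α) / (-α) : ℝ) : ℂ)‖ = y ^ (-α) / α := by
    intro y hy
    rw [Complex.norm_real, norm_div, Real.norm_of_nonneg (by positivity), norm_neg,
      Real.norm_of_nonneg hα0.le]
  have h0 : Filter.Tendsto (expRemainder ω *
      (fun y : ℝ => ((y ^ (-α) / (-α) : ℝ) : ℂ))) (nhdsWithin 0 (Ioi 0)) (nhds 0) := by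
    refine tendsto_nhdsGT_zero_of_norm_le_rpow (e := 2 - α) (C := 1 / α) (by linarith)
      fun y hy hy1 => ?_
    rw [Pi.mul_apply, norm_mul, hnorm y hy]
    calc ‖expRemainder ω y‖ * (y ^ (-α) / α) ≤ y ^ 2 * (y ^ (-α) / α) := by
          gcongr; exact norm_expRemainder_le_sq hω1 hy.le hy1
      _ = 1 / α * y ^ (2 - α) := by
          rw [show 2 - α = -α + (2 : ℕ) by push_cast; ring, Real.rpow_add_natCast hy.ne']; ring
  have htop : Filter.Tendsto (expRemainder ω *
      (fun y : ℝ => ((y ^ (-α) / (-α) : ℝ) : ℂ))) Filter.atTop (nhds 0) := by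
    refine tendsto_atTop_zero_of_norm_le_rpow (e := α - 1) (C := 3 / α) (by linarith)
      fun y hy => ?_
    have hy0 : 0 < y := by linarith
    rw [Pi.mul_apply, norm_mul, hnorm y hy0]
    calc ‖expRemainder ω y‖ * (y ^ (-α) / α) ≤ 3 * y * (y ^ (-α) / α) := by
          gcongr; exact norm_expRemainder_le hω1 hω hy
      _ = 3 / α * y ^ (-(α - 1)) := by
          rw [show -(α - 1) = -α + 1 by ring, Real.rpow_add_one hy0.ne']; ring
  rw [integral_Ioi_mul_deriv_eq_deriv_mul hu hv (integrableOn_expRemainder hα1 hα2 hω1 hω) hint2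
    h0 htop]
  simp_rw [heq]
  rw [integral_const_mul, hv0, sub_zero, zero_sub]
  have e : ω ^ (α : ℂ) = ω * ω ^ ((α - 1 : ℝ) : ℂ) := by
    conv_lhs => rw [show (α : ℂ) = 1 + ((α - 1 : ℝ) : ℂ) by push_cast; ring,
      Complex.cpow_add _ _ hω0, Complex.cpow_one]
  rw [e]
  have h1 : (α : ℂ) ≠ 0 := by exact_mod_cast hα0.ne'
  have h2 : (α : ℂ) - 1 ≠ 0 := by exact_mod_cast (sub_pos.2 hα1).ne'
  push_cast
  field_simp

theorem integrableOn_integral_mul_comp_mul {w g : ℝ → ℂ} (hw : Measurable w) (hg : Measurable g)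
    (hwi : IntegrableOn (fun r : ℝ => (r⁻¹ : ℝ) • w r) (Ioi 0)) (hgi : IntegrableOn g (Ioi 0)) :
    IntegrableOn (fun y : ℝ => ∫ r in Ioi (0 : ℝ), w r * g (r * y)) (Ioi 0) ∧
    ∫ y in Ioi (0 : ℝ), ∫ r in Ioi (0 : ℝ), w r * g (r * y) =
      (∫ r in Ioi (0 : ℝ), (r⁻¹ : ℝ) • w r) * ∫ u in Ioi (0 : ℝ), g u := by
  have hscale (h : ℝ → ℂ) {r : ℝ} (hr : 0 < r) :
      ∫ y in Ioi (0 : ℝ), h (r * y) = r⁻¹ • ∫ u in Ioi (0 : ℝ), h u := by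
    simpa using integral_comp_mul_left_Ioi h 0 hr
  have hscaleR (h : ℝ → ℝ) {r : ℝ} (hr : 0 < r) :
      ∫ y in Ioi (0 : ℝ), h (r * y) = r⁻¹ • ∫ u in Ioi (0 : ℝ), h u := by
    simpa using integral_comp_mul_left_Ioi h 0 hr
  have hprod : Integrable (fun z : ℝ × ℝ => w z.1 * g (z.1 * z.2))
      ((volume.restrict (Ioi 0)).prod (volume.restrict (Ioi 0))) := by
    have hm : Measurable (fun z : ℝ × ℝ => w z.1 * g (z.1 * z.2)) := by fun_prop
    rw [integrable_prod_iff hm.aestronglyMeasurable]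
    constructor
    · filter_upwards [ae_restrict_mem measurableSet_Ioi] with r hr
      have : IntegrableOn (fun y => g (r * y)) (Ioi 0) := by
        have := (integrableOn_Ioi_comp_mul_left_iff g 0 hr).2 (by simpa using hgi)
        exact this
      exact this.const_mul _
    · refine (hwi.norm.mul_const (∫ u in Ioi (0 : ℝ), ‖g u‖)).congr ?_
      filter_upwards [ae_restrict_mem measurableSet_Ioi] with r hr
      have hr' : (0 : ℝ) < r := hr
      simp_rw [norm_mul]
      rw [integral_const_mul, hscaleR (fun u => ‖g u‖) hr, norm_smul, norm_inv,
        Real.norm_of_nonneg hr'.le, smul_eq_mul]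
      ring
  refine ⟨hprod.integral_prod_right, ?_⟩
  rw [← integral_integral_swap (f := fun r y => w r * g (r * y)) hprod, ← integral_mul_const]
  refine setIntegral_congr_fun measurableSet_Ioi fun r hr => ?_
  rw [integral_const_mul, hscale g hr, mul_smul_comm, smul_mul_assoc]

theorem integral_rayIntegral_remainder {α : ℝ} {ρ : ℂ} (hα1 : 1 < α) (hα2 : α < 2)
    (hρ : 0 < ρ.re) {ω : ℂ} (hω1 : ‖ω‖ = 1) (hω : 0 < ω.re) (p : ℝ) :
    IntegrableOn (fun y : ℝ => (rayIntegral α ρ ω 0 p - y * ω * rayIntegral α ρ ω 1 p -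
      rayIntegral α ρ ω 0 (p + y)) * ((y ^ (-1 - α) : ℝ) : ℂ)) (Ioi 0) ∧
    ∫ y in Ioi (0 : ℝ), (rayIntegral α ρ ω 0 p - y * ω * rayIntegral α ρ ω 1 p -
      rayIntegral α ρ ω 0 (p + y)) * ((y ^ (-1 - α) : ℝ) : ℂ) =
      -((Real.Gamma (2 - α) / (α * (α - 1)) : ℝ) : ℂ) * ω ^ (α : ℂ) * rayIntegral α ρ ω α p := by
  have hw : ∀ r ∈ Ioi (0 : ℝ), (r⁻¹ : ℝ) • (rayIntegrand α ρ ω 0 p r * ((r ^ (1 + α) : ℝ) : ℂ)) =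
      rayIntegrand α ρ ω α p r := by
    intro r hr
    have hr' : (r : ℂ) ≠ 0 := by exact_mod_cast (ne_of_gt hr)
    rw [rayIntegrand, rayIntegrand, add_comm, Real.rpow_add_one (ne_of_gt hr), Real.rpow_zero,
      Complex.real_smul]
    push_cast
    field_simp
  have hg : Measurable fun u : ℝ => expRemainder ω u * ((u ^ (-1 - α) : ℝ) : ℂ) := by
    unfold expRemainder
    fun_prop
  have hmw := measurable_rayIntegrand α ρ ω 0 p
  obtain ⟨h1, h2⟩ := integrableOn_integral_mul_comp_mul
    (w := fun r => rayIntegrand α ρ ω 0 p r * ((r ^ (1 + α) : ℝ) : ℂ))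
    (by fun_prop) hg
    ((integrableOn_rayIntegrand hα1 hρ ω (by linarith) p).congr_fun
      (fun r hr => (hw r hr).symm) measurableSet_Ioi)
    (integrableOn_expRemainder hα1 hα2 hω1 hω)
  have hinner : ∀ y ∈ Ioi (0 : ℝ), ∫ r in Ioi (0 : ℝ), rayIntegrand α ρ ω 0 p r *
      ((r ^ (1 + α) : ℝ) : ℂ) * (expRemainder ω (r * y) * (((r * y) ^ (-1 - α) : ℝ) : ℂ)) =
      (rayIntegral α ρ ω 0 p - y * ω * rayIntegral α ρ ω 1 p -
        rayIntegral α ρ ω 0 (p + y)) * ((y ^ (-1 - α) : ℝ) : ℂ) := by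
    intro y hy
    have hy' : (0 : ℝ) < y := hy
    have hI (s : ℝ) (hs : -1 < s) (q : ℝ) := integrableOn_rayIntegrand hα1 hρ ω hs q
    rw [rayIntegral, rayIntegral, rayIntegral, ← integral_const_mul, ← integral_sub,
      ← integral_sub, ← integral_mul_const]
    · refine setIntegral_congr_fun measurableSet_Ioi fun r hr => ?_
      have hr' : (0 : ℝ) < r := hr
      have e : r ^ (1 + α) * (r * y) ^ (-1 - α) = y ^ (-1 - α) := by
        rw [Real.mul_rpow hr'.le hy'.le, ← mul_assoc, ← Real.rpow_add hr']
        norm_num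
      have e' : ((r ^ (1 + α) : ℝ) : ℂ) * (((r * y) ^ (-1 - α) : ℝ) : ℂ) =
          ((y ^ (-1 - α) : ℝ) : ℂ) := by rw [← Complex.ofReal_mul, e]
      rw [← e']
      simp only [rayIntegrand, expRemainder]
      rw [show -(ρ * ((r ^ α : ℝ) : ℂ)) - ((p + y : ℝ) : ℂ) * (r * ω) =
        (-(ρ * ((r ^ α : ℝ) : ℂ)) - (p : ℂ) * (r * ω)) + -(((r * y : ℝ) : ℂ) * ω) by
          push_cast; ring, Complex.exp_add, Real.rpow_one, Real.rpow_zero]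
      push_cast
      ring
    · exact (hI 0 (by norm_num) p).sub ((hI 1 (by norm_num) p).const_mul _)
    · exact hI 0 (by norm_num) (p + y)
    · exact hI 0 (by norm_num) p
    · exact (hI 1 (by norm_num) p).const_mul _
  refine ⟨h1.congr_fun hinner measurableSet_Ioi, ?_⟩
  rw [← setIntegral_congr_fun measurableSet_Ioi hinner, h2, setIntegral_congr_fun
    measurableSet_Ioi hw, integral_expRemainder hα1 hα2 hω1 hω, mul_comm]
  rfl

/-- Data of the rotated contour along which the Wright integral of `mainardi ν` converges. -/
structure IsRayData (ν : ℝ) (ρ ω : ℂ) : Prop where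
  re_pos : 0 < ρ.re
  re_pos' : 0 < ω.re
  norm_eq : ‖ω‖ = 1
  cpow_eq : ω ^ ((ν⁻¹ : ℝ) : ℂ) = -ρ
  mul_eq : ∀ n : ℕ, ω ^ (n + 1) * ρ ^ (-(ν * (n + 1) : ℝ) : ℂ) =
    Complex.exp ((π * (ν * (n + 1)) : ℝ) * Complex.I)

theorem exp_mul_I_cpow {φ : ℝ} (h : -π < φ) (h' : φ ≤ π) (a : ℝ) :
    Complex.exp (φ * Complex.I) ^ (a : ℂ) = Complex.exp ((φ * a : ℝ) * Complex.I) := by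
  rw [Complex.cpow_def_of_ne_zero (Complex.exp_ne_zero _), Complex.log_exp (by simpa) (by simpa)]
  congr 1
  push_cast
  ring

theorem exists_isRayData {ν : ℝ} (hν0 : 1 / 2 < ν) (hν1 : ν < 1) : ∃ ρ ω, IsRayData ν ρ ω := by
  have hπ := Real.pi_pos
  have hν : 0 < ν := by linarith
  have hα1 : 1 < ν⁻¹ := (one_lt_inv₀ hν).2 hν1
  have hα2 : ν⁻¹ < 2 := by rw [inv_lt_comm₀ hν two_pos]; linarith
  have hνi : ν * ν⁻¹ = 1 := mul_inv_cancel₀ hν.ne'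
  refine ⟨Complex.exp ((π * (ν⁻¹ - 3) / 4 : ℝ) * Complex.I),
    Complex.exp ((π * (ν + 1) / 4 : ℝ) * Complex.I), ?_, ?_, ?_, ?_, fun n => ?_⟩
  · rw [Complex.exp_ofReal_mul_I_re]
    exact Real.cos_pos_of_mem_Ioo ⟨by nlinarith, by nlinarith⟩
  · rw [Complex.exp_ofReal_mul_I_re]
    exact Real.cos_pos_of_mem_Ioo ⟨by nlinarith, by nlinarith⟩
  · exact Complex.norm_exp_ofReal_mul_I _
  · rw [exp_mul_I_cpow (by nlinarith) (by nlinarith), ← neg_one_mul, ← Complex.exp_pi_mul_I,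
      ← Complex.exp_add]
    have : π * (ν + 1) / 4 * ν⁻¹ = π + π * (ν⁻¹ - 3) / 4 := by linear_combination π / 4 * hνi
    rw [this]
    congr 1
    push_cast
    ring
  · rw [← Complex.ofReal_neg, exp_mul_I_cpow (by nlinarith) (by nlinarith), ← Complex.exp_nat_mul,
      ← Complex.exp_add]
    have : π * (ν * (n + 1)) = (n + 1) * (π * (ν + 1) / 4) +
        π * (ν⁻¹ - 3) / 4 * (-(ν * (n + 1))) := by
      linear_combination π / 4 * (n + 1) * hνi
    rw [this]
    congr 1
    push_cast
    ring

theorem IsRayData.rayIntegral_zero {ν : ℝ} {ρ ω : ℂ} (h : IsRayData ν ρ ω) (hν0 : 0 < ν)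
    (hν1 : ν < 1) (n : ℕ) : ω ^ (n + 1) * rayIntegral ν⁻¹ ρ ω n 0 =
      ((ν * Real.Gamma (ν * (n + 1)) : ℝ) : ℂ) *
        Complex.exp ((π * (ν * (n + 1)) : ℝ) * Complex.I) := by
  have hn : (-1 : ℝ) < n := by have : (0 : ℝ) ≤ n := n.cast_nonneg; linarith
  rw [_root_.rayIntegral_zero ((one_lt_inv₀ hν0).2 hν1) h.re_pos ω hn, ← h.mul_eq, div_inv_eq_mul,
    inv_inv, mul_comm _ ν]
  ring

theorem div_Gamma_one_sub {s : ℝ} (hs : 0 < s) (a : ℝ) :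
    a / Real.Gamma (1 - s) = π⁻¹ * (a * (Real.Gamma s * Real.sin (π * s))) := by
  have h := Real.Gamma_mul_Gamma_one_sub s
  have hG := (Real.Gamma_pos_of_pos hs).ne'
  have hπ := Real.pi_pos.ne'
  rcases eq_or_ne (Real.sin (π * s)) 0 with h0 | h0
  · rw [h0, div_zero] at h
    rw [(mul_eq_zero.1 h).resolve_left hG, h0]
    simp
  · have h1 : Real.Gamma (1 - s) ≠ 0 := fun h1 => by
      rw [h1, mul_zero] at h
      exact div_ne_zero hπ h0 h.symm
    rw [eq_div_iff h0] at h
    generalize Real.sin (π * s) = S at *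
    field_simp
    linear_combination -a * h

theorem IsRayData.mainardi_eq {ν : ℝ} {ρ ω : ℂ} (h : IsRayData ν ρ ω) (hν0 : 0 < ν)
    (hν1 : ν < 1) (x : ℝ) :
    mainardi ν x = (π * ν)⁻¹ * (ω * rayIntegral ν⁻¹ ρ ω 0 x).im := by
  have hs := (hasSum_rayIntegral ((one_lt_inv₀ hν0).2 hν1) h.re_pos h.norm_eq.le x).mul_left ω
  have hs' := (Complex.hasSum_im hs).mul_left (π * ν)⁻¹
  rw [← hs'.tsum_eq, mainardi]
  refine tsum_congr fun n => ?_
  have e : ω * ((-(x * ω)) ^ n / n.factorial * rayIntegral ν⁻¹ ρ ω n 0) =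
      (((-x) ^ n / n.factorial : ℝ) : ℂ) * (ω ^ (n + 1) * rayIntegral ν⁻¹ ρ ω n 0) := by
    rw [show -((x : ℂ) * ω) = -x * ω by ring, mul_pow]
    push_cast
    ring
  rw [e, h.rayIntegral_zero hν0 hν1, Complex.im_ofReal_mul, Complex.im_ofReal_mul,
    Complex.exp_ofReal_mul_I_im, ← div_div, show 1 - ν - ν * n = 1 - ν * (n + 1) by ring,
    div_Gamma_one_sub (by positivity)]
  field_simp

/-- The derivative of the Mainardi function. -/
noncomputable def mainardiDeriv (ν : ℝ) (ρ ω : ℂ) (x : ℝ) : ℝ :=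
  -(π * ν)⁻¹ * (ω ^ 2 * rayIntegral ν⁻¹ ρ ω 1 x).im

theorem IsRayData.hasDerivAt_mainardi {ν : ℝ} {ρ ω : ℂ} (h : IsRayData ν ρ ω) (hν0 : 0 < ν)
    (hν1 : ν < 1) (x : ℝ) : HasDerivAt (mainardi ν) (mainardiDeriv ν ρ ω x) x := by
  have hd := (hasDerivAt_rayIntegral ((one_lt_inv₀ hν0).2 hν1) h.re_pos h.re_pos'
    (s := 0) (by norm_num) x).const_mul ω
  have hi := ((Complex.imCLM.hasFDerivAt.comp_hasDerivAt x hd)).const_mul (π * ν)⁻¹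
  have he : mainardi ν = fun y => (π * ν)⁻¹ * (Complex.imCLM ∘ fun y =>
      ω * rayIntegral ν⁻¹ ρ ω 0 y) y := by
    funext y
    rw [h.mainardi_eq hν0 hν1]
    rfl
  rw [he]
  refine hi.congr_deriv ?_
  rw [mainardiDeriv, zero_add, Complex.imCLM_apply, show ω * (-ω * rayIntegral ν⁻¹ ρ ω 1 x) =
    -(ω ^ 2 * rayIntegral ν⁻¹ ρ ω 1 x) by ring, Complex.neg_im]
  ring

theorem mainardi_zero_pos {ν : ℝ} (hν1 : ν < 1) : 0 < mainardi ν 0 := by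
  have : mainardi ν 0 = 1 / Real.Gamma (1 - ν) := by
    rw [mainardi, tsum_eq_single 0 fun n hn => by simp [hn]]
    simp
  rw [this]
  exact one_div_pos.2 (Real.Gamma_pos_of_pos (by linarith))

theorem IsRayData.mainardiDeriv_zero_pos {ν : ℝ} {ρ ω : ℂ} (h : IsRayData ν ρ ω) (hν0 : 1 / 2 < ν)
    (hν1 : ν < 1) : 0 < mainardiDeriv ν ρ ω 0 := by
  have hν : 0 < ν := by linarith
  have hπ := Real.pi_pos
  have e := h.rayIntegral_zero hν hν1 1
  norm_num at e
  have hsin : Real.sin (π * (ν * 2)) < 0 := by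
    have : π * (ν * 2) = (π * (ν * 2) - π) + π := by ring
    rw [this, Real.sin_add_pi, neg_lt_zero]
    exact Real.sin_pos_of_pos_of_lt_pi (by nlinarith) (by nlinarith)
  have hG := Real.Gamma_pos_of_pos (by linarith : 0 < ν * 2)
  have e2 : (ω ^ 2 * rayIntegral ν⁻¹ ρ ω 1 0).im =
      ν * Real.Gamma (ν * 2) * Real.sin (π * (ν * 2)) := by
    rw [e, ← Complex.exp_ofReal_mul_I_im, ← Complex.im_ofReal_mul]
    push_cast
    rfl
  rw [mainardiDeriv, e2, neg_mul, neg_pos]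
  exact mul_neg_of_pos_of_neg (by positivity) (mul_neg_of_pos_of_neg (by positivity) hsin)

theorem IsRayData.tendsto_mainardi {ν : ℝ} {ρ ω : ℂ} (h : IsRayData ν ρ ω) (hν0 : 0 < ν)
    (hν1 : ν < 1) : Filter.Tendsto (mainardi ν) Filter.atTop (nhds 0) := by
  have ht := (tendsto_rayIntegral_atTop ((one_lt_inv₀ hν0).2 hν1) h.re_pos h.re_pos'
    (s := 0) (by norm_num)).const_mul ω
  have := ((Complex.continuous_im.tendsto _).comp ht).const_mul (π * ν)⁻¹
  simp only [mul_zero, Complex.zero_im] at this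
  exact this.congr fun x => (h.mainardi_eq hν0 hν1 x).symm

theorem IsRayData.integral_mainardi_sub {ν : ℝ} {ρ ω : ℂ} (h : IsRayData ν ρ ω)
    (hν0 : 1 / 2 < ν) (hν1 : ν < 1) {p : ℝ} (hp : 0 ≤ p) (hd : mainardiDeriv ν ρ ω p = 0) :
    IntegrableOn (fun y => (mainardi ν p - mainardi ν (p + y)) * y ^ (-1 - ν⁻¹)) (Ioi 0) ∧
    ∫ y in Ioi (0 : ℝ), (mainardi ν p - mainardi ν (p + y)) * y ^ (-1 - ν⁻¹) =
      Real.Gamma (2 - ν⁻¹) / (ν⁻¹ * (ν⁻¹ - 1)) / ν⁻¹ * mainardi ν p := by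
  have hν : 0 < ν := by linarith
  have hα1 : 1 < ν⁻¹ := (one_lt_inv₀ hν).2 hν1
  have hα2 : ν⁻¹ < 2 := by rw [inv_lt_comm₀ hν two_pos]; linarith
  obtain ⟨h1, h2⟩ := integral_rayIntegral_remainder hα1 hα2 h.re_pos h.norm_eq h.re_pos' p
  have him : (ω ^ 2 * rayIntegral ν⁻¹ ρ ω 1 p).im = 0 := by
    rw [mainardiDeriv] at hd
    exact (mul_eq_zero.1 hd).resolve_left
      (neg_ne_zero.2 (inv_ne_zero (mul_pos Real.pi_pos hν).ne'))
  have hpt : ∀ y : ℝ, (mainardi ν p - mainardi ν (p + y)) * y ^ (-1 - ν⁻¹) =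
      Complex.imCLM (((π * ν)⁻¹ : ℝ) * ω * ((rayIntegral ν⁻¹ ρ ω 0 p -
        y * ω * rayIntegral ν⁻¹ ρ ω 1 p - rayIntegral ν⁻¹ ρ ω 0 (p + y)) *
          ((y ^ (-1 - ν⁻¹) : ℝ) : ℂ))) := by
    intro y
    rw [h.mainardi_eq hν hν1, h.mainardi_eq hν hν1, Complex.imCLM_apply,
      show (((π * ν)⁻¹ : ℝ) : ℂ) * ω * ((rayIntegral ν⁻¹ ρ ω 0 p -
        y * ω * rayIntegral ν⁻¹ ρ ω 1 p - rayIntegral ν⁻¹ ρ ω 0 (p + y)) *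
          ((y ^ (-1 - ν⁻¹) : ℝ) : ℂ)) = (((π * ν)⁻¹ * y ^ (-1 - ν⁻¹) : ℝ) : ℂ) *
          (ω * rayIntegral ν⁻¹ ρ ω 0 p - (y : ℂ) * (ω ^ 2 * rayIntegral ν⁻¹ ρ ω 1 p) -
            ω * rayIntegral ν⁻¹ ρ ω 0 (p + y)) by push_cast; ring,
      Complex.im_ofReal_mul, Complex.sub_im, Complex.sub_im, Complex.im_ofReal_mul, him]
    ring
  simp_rw [hpt]
  refine ⟨Complex.imCLM.integrable_comp (h1.const_mul _), ?_⟩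
  rw [ContinuousLinearMap.integral_comp_comm _ (h1.const_mul _), integral_const_mul, h2, h.cpow_eq,
    h.mainardi_eq hν hν1, Complex.imCLM_apply]
  have hr := rayIntegral_sub_mul hα1 h.re_pos h.re_pos' hp
  have hαc : ((ν⁻¹ : ℝ) : ℂ) ≠ 0 := by exact_mod_cast (inv_ne_zero hν.ne')
  set κ := Real.Gamma (2 - ν⁻¹) / (ν⁻¹ * (ν⁻¹ - 1))
  clear_value κ
  have e : (((π * ν)⁻¹ : ℝ) : ℂ) * ω * (-(κ : ℂ) * -ρ * rayIntegral ν⁻¹ ρ ω ν⁻¹ p) =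
      (((π * ν)⁻¹ * κ / ν⁻¹ : ℝ) : ℂ) * (ω * rayIntegral ν⁻¹ ρ ω 0 p -
        (p : ℂ) * (ω ^ 2 * rayIntegral ν⁻¹ ρ ω 1 p)) := by
    rw [show ω * rayIntegral ν⁻¹ ρ ω 0 p - (p : ℂ) * (ω ^ 2 * rayIntegral ν⁻¹ ρ ω 1 p) =
      ω * (rayIntegral ν⁻¹ ρ ω 0 p - p * ω * rayIntegral ν⁻¹ ρ ω 1 p) by ring, hr,
      Complex.ofReal_div, Complex.ofReal_mul, div_mul_eq_mul_div, eq_div_iff hαc]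
    ring
  rw [e, Complex.im_ofReal_mul, Complex.sub_im, Complex.im_ofReal_mul, him]
  ring

theorem integrableOn_Ioi_comp_add_right (h : ℝ → ℝ) (ℓ : ℝ) :
    IntegrableOn (fun y => h (y + ℓ)) (Ioi 0) ↔ IntegrableOn h (Ioi ℓ) := by
  have := (measurePreserving_add_right (volume : Measure ℝ) ℓ).integrableOn_comp_preimage
    (measurableEmbedding_addRight ℓ) (f := h) (s := Ioi ℓ)
  simpa [Function.comp_def] using this

theorem integral_Ioi_comp_add_right (h : ℝ → ℝ) (ℓ : ℝ) :
    ∫ y in Ioi (0 : ℝ), h (y + ℓ) = ∫ y in Ioi ℓ, h y := by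
  have := (measurePreserving_add_right (volume : Measure ℝ) ℓ).setIntegral_preimage_emb
    (measurableEmbedding_addRight ℓ) h (Ioi ℓ)
  simpa using this

theorem setIntegral_Ioi_pos {h : ℝ → ℝ} {a x : ℝ} (hc : ContinuousOn h (Ioi a))
    (hi : IntegrableOn h (Ioi a)) (h0 : ∀ y ∈ Ioi a, 0 ≤ h y) (hx : x ∈ Ioi a) (hpos : 0 < h x) :
    0 < ∫ y in Ioi a, h y := by
  rw [setIntegral_pos_iff_support_of_nonneg_ae
    ((ae_restrict_mem measurableSet_Ioi).mono h0) hi, inter_comm]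
  exact (hc.isOpen_inter_preimage isOpen_Ioi isOpen_compl_singleton).measure_pos volume
    ⟨x, hx, hpos.ne'⟩

theorem exists_isMaxOn_Ici {f : ℝ → ℝ} (hcont : Continuous f) (h0 : 0 < f 0)
    (hlim : Filter.Tendsto f Filter.atTop (nhds 0)) : ∃ c, 0 ≤ c ∧ IsMaxOn f (Ici 0) c := by
  obtain ⟨R, hR⟩ := Filter.eventually_atTop.1 (hlim.eventually (gt_mem_nhds h0))
  obtain ⟨c, hc, hmax⟩ := (isCompact_Icc (a := (0 : ℝ)) (b := max R 0)).exists_isMaxOn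
    ⟨0, by simp⟩ hcont.continuousOn
  refine ⟨c, hc.1, fun x hx => ?_⟩
  rcases le_total x (max R 0) with h | h
  · exact hmax ⟨hx, h⟩
  · exact (hR x ((le_max_left _ _).trans h)).le.trans (hmax ⟨le_rfl, le_max_right _ _⟩)

theorem IsMaxOn.pos_of_hasDerivAt_zero {f : ℝ → ℝ} {c d : ℝ} (hmax : IsMaxOn f (Ici 0) c)
    (hc : 0 ≤ c) (hf : HasDerivAt f d 0) (hd : 0 < d) : 0 < c := by
  refine lt_of_le_of_ne hc ?_
  rintro rfl
  have hs := (hasDerivAt_iff_tendsto_slope.1 hf).mono_left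
    (nhdsWithin_mono (0 : ℝ) (s := Ioi 0) (t := {0}ᶜ) fun x hx => ne_of_gt hx)
  obtain ⟨x, hx, hx0⟩ := ((hs.eventually (lt_mem_nhds hd)).and self_mem_nhdsWithin).exists
  have hx0' : (0 : ℝ) < x := hx0
  rw [slope_def_field, sub_zero] at hx
  have h2 : f x ≤ f 0 := hmax hx0'.le
  exact absurd hx (not_lt.2 (div_nonpos_of_nonpos_of_nonneg (by linarith) hx0'.le))

theorem exists_critical_between_max {f f' : ℝ → ℝ} (hf : ∀ x, HasDerivAt f (f' x) x) {c₁ c₂ : ℝ}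
    (h12 : c₁ < c₂) (he : f c₁ = f c₂) (h1 : f' c₁ = 0) :
    ∃ b, c₁ ≤ b ∧ b < c₂ ∧ f' b = 0 ∧ ∀ x, b ≤ x → x ≤ c₂ → f b ≤ f x := by
  have hcont : Continuous f := continuous_iff_continuousAt.2 fun x => (hf x).continuousAt
  obtain ⟨b, hb, hmin⟩ := (isCompact_Icc (a := c₁) (b := c₂)).exists_isMinOn
    ⟨c₁, left_mem_Icc.2 h12.le⟩ hcont.continuousOn
  by_cases hbb : b = c₁ ∨ b = c₂
  · refine ⟨c₁, le_rfl, h12, h1, fun x hx hx2 => ?_⟩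
    have : f b ≤ f x := hmin ⟨hx, hx2⟩
    rcases hbb with rfl | rfl
    · exact this
    · rwa [he]
  · push Not at hbb
    have hb1 := lt_of_le_of_ne hb.1 (Ne.symm hbb.1)
    have hb2 := lt_of_le_of_ne hb.2 hbb.2
    exact ⟨b, hb.1, hb2, (hmin.isLocalMin (Icc_mem_nhds hb1 hb2)).hasDerivAt_eq_zero (hf b),
      fun x hx hx2 => hmin ⟨hb.1.trans hx, hx2⟩⟩

theorem IsMaxOn.lt_of_integral_eq {f f' : ℝ → ℝ} {α D : ℝ} (hα : 0 < α)
    (hf : ∀ x, HasDerivAt f (f' x) x) (hnn : ∀ x, 0 ≤ x → 0 ≤ f x) (h0 : 0 < f 0)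
    (hlim : Filter.Tendsto f Filter.atTop (nhds 0))
    (hint : ∀ p, 0 ≤ p → f' p = 0 →
      IntegrableOn (fun y => (f p - f (p + y)) * y ^ (-1 - α)) (Ioi 0) ∧
      ∫ y in Ioi (0 : ℝ), (f p - f (p + y)) * y ^ (-1 - α) = D * f p)
    {b c : ℝ} (hb : 0 ≤ b) (hbc : b < c) (hb' : f' b = 0) (hc' : f' c = 0)
    (hmin : ∀ x, b ≤ x → x ≤ c → f b ≤ f x) : ¬ IsMaxOn f (Ici 0) c := by
  intro hmax
  have hcont : Continuous f := continuous_iff_continuousAt.2 fun x => (hf x).continuousAt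
  have hm : 0 < f c := h0.trans_le (hmax (mem_Ici.2 le_rfl))
  have hc0 : 0 ≤ c := hb.trans hbc.le
  obtain ⟨ℓ, hℓ, rfl⟩ : ∃ ℓ, 0 < ℓ ∧ b + ℓ = c := ⟨c - b, by linarith, by ring⟩
  obtain ⟨hib, heb⟩ := hint b hb hb'
  obtain ⟨hic, hec⟩ := hint (b + ℓ) hc0 hc'
  have hmax' : ∀ y, 0 ≤ y → f (b + ℓ + y) ≤ f (b + ℓ) := fun y hy =>
    hmax (mem_Ici.2 (by linarith))
  have hrpow : ContinuousOn (fun y : ℝ => (y + ℓ) ^ (-1 - α)) (Ioi 0) :=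
    ContinuousOn.rpow_const (by fun_prop) fun y hy => Or.inl (by
      have : (0 : ℝ) < y := hy
      positivity)
  have hrpow0 : ContinuousOn (fun y : ℝ => y ^ (-1 - α)) (Ioi 0) :=
    ContinuousOn.rpow_const (by fun_prop) fun y hy => Or.inl (ne_of_gt hy)
  -- the tail of the integral at `b`, written around `b + ℓ`
  have hiφ := (integrableOn_Ioi_comp_add_right _ ℓ).2 (hib.mono_set (Ioi_subset_Ioi hℓ.le))
  have hi1 : IntegrableOn (fun y : ℝ => (y + ℓ) ^ (-1 - α)) (Ioi 0) :=
    (integrableOn_Ioi_comp_add_right (fun y : ℝ => y ^ (-1 - α)) ℓ).2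
      (integrableOn_Ioi_rpow_of_lt (by linarith) hℓ)
  have hv1 : ∫ y in Ioi (0 : ℝ), (y + ℓ) ^ (-1 - α) = ℓ ^ (-α) / α := by
    rw [integral_Ioi_comp_add_right (fun y : ℝ => y ^ (-1 - α)) ℓ,
      integral_Ioi_rpow_of_lt (by linarith) hℓ, show -1 - α + 1 = -α by ring, neg_div_neg_eq]
  have hJφ : ∀ y : ℝ, (f (b + ℓ) - f (b + ℓ + y)) * (y + ℓ) ^ (-1 - α) =
      (f b - f (b + (y + ℓ))) * (y + ℓ) ^ (-1 - α) +
        (f (b + ℓ) - f b) * (y + ℓ) ^ (-1 - α) := by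
    intro y
    rw [show b + (y + ℓ) = b + ℓ + y by ring]
    ring
  have hiJ : IntegrableOn (fun y : ℝ => (f (b + ℓ) - f (b + ℓ + y)) * (y + ℓ) ^ (-1 - α))
      (Ioi 0) := by
    simp_rw [hJφ]
    exact hiφ.add (hi1.const_mul _)
  set J := ∫ y in Ioi (0 : ℝ), (f (b + ℓ) - f (b + ℓ + y)) * (y + ℓ) ^ (-1 - α) with hJ
  set A := ℓ ^ (-α) / α
  have hhead : ∫ y in Ioc (0 : ℝ) ℓ, (f b - f (b + y)) * y ^ (-1 - α) ≤ 0 :=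
    setIntegral_nonpos measurableSet_Ioc fun y hy =>
      mul_nonpos_of_nonpos_of_nonneg
        (sub_nonpos.2 (hmin _ (by linarith [hy.1]) (by linarith [hy.2])))
        (Real.rpow_nonneg hy.1.le _)
  have htail : J = (∫ y in Ioi ℓ, (f b - f (b + y)) * y ^ (-1 - α)) + (f (b + ℓ) - f b) * A := by
    rw [hJ, ← hv1, ← integral_Ioi_comp_add_right (fun y => (f b - f (b + y)) * y ^ (-1 - α)) ℓ,
      ← integral_const_mul,
      ← integral_add hiφ (hi1.const_mul _)]
    exact integral_congr_ae (Filter.Eventually.of_forall hJφ)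
  have hsplit : D * f b ≤ J - (f (b + ℓ) - f b) * A := by
    rw [← heb, ← Ioc_union_Ioi_eq_Ioi hℓ.le, setIntegral_union (Ioc_disjoint_Ioi le_rfl)
      measurableSet_Ioi (hib.mono_set Ioc_subset_Ioi_self)
      (hib.mono_set (Ioi_subset_Ioi hℓ.le)), htail]
    linarith
  have hJ1 : J < f (b + ℓ) * A := by
    have hpos : 0 < ∫ y in Ioi (0 : ℝ), f (b + ℓ) * (y + ℓ) ^ (-1 - α) -
        (f (b + ℓ) - f (b + ℓ + y)) * (y + ℓ) ^ (-1 - α) := by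
      have hev : ∀ᶠ y in nhdsWithin (0 : ℝ) (Ioi 0), 0 < f (b + ℓ + y) := by
        have : Filter.Tendsto (fun y => f (b + ℓ + y)) (nhds 0) (nhds (f (b + ℓ + 0))) :=
          (by fun_prop : Continuous fun y => f (b + ℓ + y)).tendsto 0
        rw [add_zero] at this
        exact (this.eventually (lt_mem_nhds hm)).filter_mono nhdsWithin_le_nhds
      obtain ⟨x, hx, hx0⟩ := (hev.and self_mem_nhdsWithin).exists
      have hx0' : (0 : ℝ) < x := hx0
      refine setIntegral_Ioi_pos (x := x) (by fun_prop) ((hi1.const_mul _).sub hiJ)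
        (fun y hy => ?_) hx0 ?_
      · have hy' : (0 : ℝ) < y := hy
        rw [← sub_mul, sub_sub_cancel]
        exact mul_nonneg (hnn _ (by linarith)) (by positivity)
      · rw [← sub_mul, sub_sub_cancel]
        positivity
    rw [integral_sub (hi1.const_mul _) hiJ, integral_const_mul, hv1] at hpos
    linarith
  have hJ2 : J < D * f (b + ℓ) := by
    have hpos : 0 < ∫ y in Ioi (0 : ℝ), (f (b + ℓ) - f (b + ℓ + y)) * y ^ (-1 - α) -
        (f (b + ℓ) - f (b + ℓ + y)) * (y + ℓ) ^ (-1 - α) := by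
      obtain ⟨x, hx, hx0⟩ := ((hlim.eventually (gt_mem_nhds hm)).and
        (Filter.eventually_gt_atTop (b + ℓ))).exists
      have hlt : ∀ y : ℝ, 0 < y → (y + ℓ) ^ (-1 - α) < y ^ (-1 - α) := fun y hy =>
        Real.rpow_lt_rpow_of_neg hy (by linarith) (by linarith)
      refine setIntegral_Ioi_pos (x := x - (b + ℓ)) (by fun_prop) (hic.sub hiJ)
        (fun y hy => ?_) (sub_pos.2 hx0) ?_
      · rw [← mul_sub]
        exact mul_nonneg (sub_nonneg.2 (hmax' y (le_of_lt hy))) (sub_nonneg.2 (hlt y hy).le)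
      · rw [← mul_sub, add_sub_cancel]
        exact mul_pos (sub_pos.2 hx) (sub_pos.2 (hlt _ (sub_pos.2 hx0)))
    rw [integral_sub hic hiJ, hec] at hpos
    linarith
  have hfb := hnn b hb
  have hle : f b ≤ f (b + ℓ) := hmin _ (by linarith) le_rfl
  rcases le_total A D with hAD | hAD
  · nlinarith
  · nlinarith

theorem exists_forall_mainardi_lt {ν : ℝ} (hν0 : 1 / 2 < ν) (hν1 : ν < 1) :
    ∃ c : ℝ, 0 < c ∧ ∀ x : ℝ, 0 ≤ x → x ≠ c → mainardi ν x < mainardi ν c := by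
  have hν : 0 < ν := by linarith
  have hα1 : 1 < ν⁻¹ := (one_lt_inv₀ hν).2 hν1
  obtain ⟨ρ, ω, h⟩ := exists_isRayData hν0 hν1
  have hf := h.hasDerivAt_mainardi hν hν1
  have h0 := mainardi_zero_pos hν1
  have hlim := h.tendsto_mainardi hν hν1
  have hcrit : ∀ {c : ℝ}, 0 < c → IsMaxOn (mainardi ν) (Ici 0) c → mainardiDeriv ν ρ ω c = 0 :=
    fun hc hmax => (hmax.isLocalMax (Ici_mem_nhds hc)).hasDerivAt_eq_zero (hf _)
  have hunique : ∀ {c₁ c₂ : ℝ}, 0 < c₁ → c₁ < c₂ → mainardi ν c₁ = mainardi ν c₂ →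
      IsMaxOn (mainardi ν) (Ici 0) c₁ → ¬ IsMaxOn (mainardi ν) (Ici 0) c₂ := by
    intro c₁ c₂ hc₁ h12 he hmax₁ hmax₂
    obtain ⟨b, hb1, hb2, hb', hmin⟩ := exists_critical_between_max hf h12 he (hcrit hc₁ hmax₁)
    exact IsMaxOn.lt_of_integral_eq (zero_lt_one.trans hα1) hf
      (fun x hx => mainardi_nonneg hν hν1 hx) h0 hlim
      (fun p hp hp' => h.integral_mainardi_sub hν0 hν1 hp hp') (hc₁.le.trans hb1) hb2 hb'
      (hcrit (hc₁.trans h12) hmax₂) hmin hmax₂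
  have hpos : ∀ {c : ℝ}, 0 ≤ c → IsMaxOn (mainardi ν) (Ici 0) c → 0 < c := fun hc hmax =>
    hmax.pos_of_hasDerivAt_zero hc (hf 0) (h.mainardiDeriv_zero_pos hν0 hν1)
  obtain ⟨c, hc, hmax⟩ := exists_isMaxOn_Ici
    (continuous_iff_continuousAt.2 fun x => (hf x).continuousAt) h0 hlim
  refine ⟨c, hpos hc hmax, fun x hx hxc => lt_of_le_of_ne (hmax hx) fun he => ?_⟩
  have hmaxx : IsMaxOn (mainardi ν) (Ici 0) x := fun y hy => (hmax hy).trans he.ge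
  rcases lt_or_gt_of_ne hxc with hlt | hlt
  · exact hunique (hpos hx hmaxx) hlt he hmaxx hmax
  · exact hunique (hpos hc hmax) hlt he.symm hmax hmaxx

theorem greenCauchy_maximum (ν : ℝ) (hν0 : 1 / 2 < ν) (hν1 : ν < 1) :
    ∃ c : ℝ, 0 < c ∧
      -- (i) `M_ν` attains its global maximum over `[0,∞)` exactly at `c`
      (∀ x : ℝ, 0 ≤ x → x ≠ c → mainardi ν x < mainardi ν c) ∧
      -- (ii) for every `t > 0`, `x ↦ G_c(x,t;ν)` attains its global maximum over `ℝ`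
      -- exactly at the two points `x = ±c·t^ν`, with value `M_ν(c)/(2 t^ν)`
      (∀ t : ℝ, 0 < t →
        (∀ x : ℝ, x ≠ c * t ^ ν → x ≠ -(c * t ^ ν) →
          greenCauchy ν x t < greenCauchy ν (c * t ^ ν) t) ∧
        greenCauchy ν (-(c * t ^ ν)) t = greenCauchy ν (c * t ^ ν) t ∧
        greenCauchy ν (c * t ^ ν) t = mainardi ν c / (2 * t ^ ν)) ∧
      -- (iii) the product of the maximum value with the positive maximum
      -- location is independent of time
      (∀ t : ℝ, 0 < t →
        greenCauchy ν (c * t ^ ν) t * (c * t ^ ν) = c * mainardi ν c / 2) := by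
  obtain ⟨c, hc, hmax⟩ := exists_forall_mainardi_lt hν0 hν1
  have hval : ∀ t : ℝ, 0 < t → greenCauchy ν (c * t ^ ν) t = mainardi ν c / (2 * t ^ ν) := by
    intro t ht
    have hT : 0 < t ^ ν := Real.rpow_pos_of_pos ht ν
    rw [greenCauchy, abs_of_pos (mul_pos hc hT), mul_div_cancel_right₀ _ hT.ne']
  refine ⟨c, hc, hmax, fun t ht => ⟨fun x hx hx' => ?_, ?_, hval t ht⟩, fun t ht => ?_⟩
  · have hT : 0 < t ^ ν := Real.rpow_pos_of_pos ht ν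
    rw [hval t ht, greenCauchy]
    refine div_lt_div_of_pos_right (hmax _ (by positivity) fun he => ?_) (by positivity)
    rw [div_eq_iff hT.ne'] at he
    rcases eq_or_eq_neg_of_abs_eq he with he | he
    · exact hx he
    · exact hx' he
  · rw [greenCauchy, greenCauchy, abs_neg]
  · have hT : 0 < t ^ ν := Real.rpow_pos_of_pos ht ν
    rw [hval t ht]
    field_simp
end
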